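/- (Robin's criterion) The Riemann hypothesis holds if and only if Li(θ(x)) − π(x) > 0 for all sufficiently large real x, where θ is the first Chebyshev function, π is the prime counting function, and Li(y) = ∫₂^y dt / log t is the offset logarithmic integral. -/

import Mathlib

open Filter

/-- The first Chebyshev function θ(x) = Σ_{p ≤ x, p prime} log p. -/
noncomputable def chebyshevTheta (x : ℝ) : ℝ :=
  ∑ p ∈ (Finset.Iic ⌊x⌋₊).filter Nat.Prime, Real.log p

/-- The prime counting function π(x), the number of primes ≤ x. -/
noncomputable def primePi (x : ℝ) : ℕ := Nat.primeCounting ⌊x⌋₊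

/-- The offset logarithmic integral Li(y) = ∫₂^y dt / log t. -/
noncomputable def Li (y : ℝ) : ℝ := ∫ t in (2 : ℝ)..y, 1 / Real.log t

section Landau

open MeasureTheory ProbabilityTheory Metric

variable {Ω : Type*} [MeasurableSpace Ω] {μ : Measure Ω} {X : Ω → ℝ}

theorem Ioi_subset_interior_integrableExpSet {σ : ℝ}
    (hint : ∀ t > σ, Integrable (fun ω ↦ Real.exp (t * X ω)) μ) {t : ℝ} (ht : σ < t) :
    t ∈ interior (integrableExpSet X μ) :=
  interior_maximal (fun _ hy ↦ hint _ hy) isOpen_Ioi ht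

/-- **Landau's lemma**: the moment generating function of a nonpositive variable cannot be continued
holomorphically to a neighbourhood of its abscissa of convergence. -/
theorem exists_lt_integrable_exp_of_differentiableOn_ball (hX : AEMeasurable X μ)
    (hX0 : ∀ᵐ ω ∂μ, X ω ≤ 0) {σ r : ℝ} (hr : 0 < r)
    (hint : ∀ t > σ, Integrable (fun ω ↦ Real.exp (t * X ω)) μ) {G : ℂ → ℂ}
    (hG : DifferentiableOn ℂ G (ball (σ : ℂ) (2 * r)))
    (hEq : ∀ z ∈ ball (σ : ℂ) (2 * r), σ < z.re → G z = complexMGF X μ z) :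
    ∃ t < σ, Integrable (fun ω ↦ Real.exp (t * X ω)) μ := by
  set c : ℝ := σ + r / 2 with hc
  have hcσ : σ < c := by linarith
  have hsub : ball (c : ℂ) (3 / 2 * r) ⊆ ball (σ : ℂ) (2 * r) := by
    refine ball_subset_ball' ?_
    rw [dist_eq_norm, ← Complex.ofReal_sub, Complex.norm_real, Real.norm_eq_abs, abs_of_pos] <;>
    linarith
  refine ⟨c - r, by linarith, ?_⟩
  have hz : ((c - r : ℝ) : ℂ) ∈ ball (c : ℂ) (3 / 2 * r) := by
    rw [mem_ball, dist_eq_norm, ← Complex.ofReal_sub, Complex.norm_real, Real.norm_eq_abs, abs_lt]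
    constructor <;> linarith
  have hsum := Complex.hasSum_taylorSeries_on_ball (hG.mono hsub) hz
  have hev : G =ᶠ[nhds (c : ℂ)] complexMGF X μ := by
    have h1 : ball (σ : ℂ) (2 * r) ∈ nhds (c : ℂ) :=
      isOpen_ball.mem_nhds (hsub (mem_ball_self (by linarith)))
    have h2 : {z : ℂ | σ < z.re} ∈ nhds (c : ℂ) :=
      (isOpen_lt continuous_const Complex.continuous_re).mem_nhds (by simpa using hcσ)
    filter_upwards [h1, h2] with z h1 h2 using hEq z h1 h2
  have hcint : c ∈ interior (integrableExpSet X μ) :=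
    Ioi_subset_interior_integrableExpSet hint hcσ
  set F : ℕ → Ω → ℝ := fun n ω ↦ (n.factorial : ℝ)⁻¹ * (-r * X ω) ^ n * Real.exp (c * X ω) with hF
  have hFint : ∀ n, Integrable (F n) μ := by
    intro n
    have := (integrable_pow_mul_exp_of_mem_interior_integrableExpSet hcint n).const_mul
      ((n.factorial : ℝ)⁻¹ * (-r) ^ n)
    refine this.congr (Eventually.of_forall fun ω ↦ ?_)
    simp only [hF, mul_pow]; ring
  have hterm : ∀ n : ℕ, ((n.factorial : ℂ))⁻¹ • (((c - r : ℝ) : ℂ) - c) ^ n • iteratedDeriv n G c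
      = ((∫ ω, F n ω ∂μ : ℝ) : ℂ) := by
    intro n
    rw [hev.iteratedDeriv_eq n, iteratedDeriv_complexMGF (by simpa using hcint), smul_eq_mul,
      smul_eq_mul, ← integral_const_mul, ← integral_const_mul, ← integral_complex_ofReal]
    refine integral_congr_ae (Eventually.of_forall fun ω ↦ ?_)
    simp only [hF]
    push_cast
    have : ((c : ℂ) - r - c) = -r := by ring
    rw [this, mul_pow]
    ring
  have hsum' : Summable fun n ↦ ∫ ω, F n ω ∂μ := by
    rw [← Complex.summable_ofReal]
    simpa only [hterm] using hsum.summable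
  have hF0 : ∀ n, 0 ≤ᵐ[μ] F n := by
    intro n
    filter_upwards [hX0] with ω hω
    have : 0 ≤ -r * X ω := by nlinarith
    simp only [hF, Pi.zero_apply]
    positivity
  have hpt : ∀ᵐ ω ∂μ, ENNReal.ofReal (Real.exp ((c - r) * X ω))
      = ∑' n, ENNReal.ofReal (F n ω) := by
    filter_upwards [ae_all_iff.2 hF0] with ω hω
    have h1 : HasSum (fun n ↦ F n ω) (Real.exp ((c - r) * X ω)) := by
      have h2 := (NormedSpace.expSeries_div_hasSum_exp (-r * X ω)).mul_right (Real.exp (c * X ω))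
      rw [← Real.exp_eq_exp_ℝ, ← Real.exp_add] at h2
      convert! h2 using 1
      · funext n; simp only [hF]; ring
      · ring_nf
    rw [← h1.tsum_eq, ENNReal.ofReal_tsum_of_nonneg hω h1.summable]
  refine ⟨by fun_prop, ?_⟩
  rw [hasFiniteIntegral_iff_ofReal (Eventually.of_forall fun ω ↦ (Real.exp_pos _).le),
    lintegral_congr_ae hpt, lintegral_tsum fun n ↦ (hFint n).aemeasurable.ennreal_ofReal]
  simp_rw [← fun n ↦ ofReal_integral_eq_lintegral_ofReal (hFint n) (hF0 n)]
  rw [← ENNReal.ofReal_tsum_of_nonneg (fun n ↦ integral_nonneg_of_ae (hF0 n)) hsum']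
  exact ENNReal.ofReal_lt_top

theorem differentiableOn_complexMGF_of_integrable {σ : ℝ}
    (hint : ∀ t > σ, Integrable (fun ω ↦ Real.exp (t * X ω)) μ) :
    DifferentiableOn ℂ (complexMGF X μ) {z | σ < z.re} :=
  differentiableOn_complexMGF.mono fun _ hz ↦ Ioi_subset_interior_integrableExpSet hint hz

theorem isOpen_re_gt (σ : ℝ) : IsOpen {z : ℂ | σ < z.re} :=
  isOpen_lt continuous_const Complex.continuous_re

theorem isPreconnected_re_gt (σ : ℝ) : IsPreconnected {z : ℂ | σ < z.re} :=
  (convex_halfSpace_re_gt σ).isPreconnected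

/-- Two functions with equal second derivatives on an open preconnected set differ by an affine
function. -/
theorem exists_eqOn_add_affine {U : Set ℂ} (hU : IsOpen U) (hUc : Convex ℝ U) {f g : ℂ → ℂ}
    (hf : DifferentiableOn ℂ f U) (hg : DifferentiableOn ℂ g U)
    (h : Set.EqOn (deriv (deriv f)) (deriv (deriv g)) U) :
    ∃ a b : ℂ, ∀ z ∈ U, f z = g z + (a * z + b) := by
  obtain rfl | ⟨x, hx⟩ := U.eq_empty_or_nonempty
  · exact ⟨0, 0, by simp⟩
  obtain ⟨a, ha⟩ := hU.exists_eq_add_of_deriv_eq hUc.isPreconnected (hf.deriv hU) (hg.deriv hU) h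
  have hlin : DifferentiableOn ℂ (fun z ↦ g z + a * z) U := by fun_prop
  obtain ⟨b, hb⟩ := hU.exists_eq_add_of_deriv_eq hUc.isPreconnected hf hlin fun z hz ↦ by
    have hgz := (hg.differentiableAt (hU.mem_nhds hz)).hasDerivAt
    have h2 : HasDerivAt (fun z ↦ g z + a * z) (deriv g z + a * 1) z :=
      hgz.add ((hasDerivAt_id z).const_mul a)
    rw [ha hz, h2.deriv, mul_one]
  exact ⟨a, b, fun z hz ↦ by rw [hb hz]; ring⟩

/-- Landau's lemma when only the second derivative of `s * complexMGF X μ s` is known to continue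
meromorphically, without real poles. -/
theorem integrable_exp_of_mul_deriv_deriv_eq (hX : AEMeasurable X μ)
    (hX0 : ∀ᵐ ω ∂μ, X ω ≤ 0) {α β : ℝ} (hα : 0 < α)
    (hint : ∀ t > β, Integrable (fun ω ↦ Real.exp (t * X ω)) μ) {P Q : ℂ → ℂ}
    (hP : DifferentiableOn ℂ P {z | α < z.re}) (hQ : DifferentiableOn ℂ Q {z | α < z.re})
    (hQ0 : ∀ t : ℝ, α < t → Q t ≠ 0)
    (hPQ : ∀ z : ℂ, β < z.re → Q z * deriv (deriv fun s ↦ s * complexMGF X μ s) z = P z) :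
    ∀ t > α, Integrable (fun ω ↦ Real.exp (t * X ω)) μ := by
  by_contra! hcon
  obtain ⟨t₀, ht₀, hnot⟩ := hcon
  have hup : ∀ t t' : ℝ, t ≤ t' → Integrable (fun ω ↦ Real.exp (t * X ω)) μ →
      Integrable (fun ω ↦ Real.exp (t' * X ω)) μ := by
    intro t t' htt h
    refine h.mono' (by fun_prop) ?_
    filter_upwards [hX0] with ω hω
    rw [Real.norm_eq_abs, abs_of_pos (Real.exp_pos _)]
    exact Real.exp_le_exp.2 (by nlinarith)
  set S : Set ℝ := {t | Integrable (fun ω ↦ Real.exp (t * X ω)) μ} with hS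
  have hSlb : ∀ t ∈ S, t₀ ≤ t := fun t ht ↦ by
    by_contra! hlt
    exact hnot (hup t t₀ hlt.le ht)
  have hSne : S.Nonempty := ⟨β + 1, hint _ (by linarith)⟩
  have hSbdd : BddBelow S := ⟨t₀, hSlb⟩
  set σ := sInf S with hσ
  have hσt₀ : t₀ ≤ σ := le_csInf hSne hSlb
  have hσα : α < σ := ht₀.trans_le hσt₀
  have hσint : ∀ t > σ, Integrable (fun ω ↦ Real.exp (t * X ω)) μ := by
    intro t ht
    obtain ⟨t', ht', hlt⟩ := exists_lt_of_csInf_lt hSne ht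
    exact hup t' t hlt.le ht'
  suffices ∃ t < σ, Integrable (fun ω ↦ Real.exp (t * X ω)) μ by
    obtain ⟨t, ht, hti⟩ := this
    exact (csInf_le hSbdd hti).not_gt ht
  have hQσ : ∀ᶠ z in nhds (σ : ℂ), Q z ≠ 0 ∧ α < z.re := by
    have hmem : {z : ℂ | α < z.re} ∈ nhds (σ : ℂ) := (isOpen_re_gt α).mem_nhds (by simpa using hσα)
    exact ((hQ.differentiableAt hmem).continuousAt.eventually_ne (hQ0 σ hσα)).and hmem
  obtain ⟨R, hR, hball⟩ := Metric.eventually_nhds_iff_ball.1 hQσ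
  have hDdiff : DifferentiableOn ℂ (fun z ↦ P z / Q z) (ball (σ : ℂ) R) :=
    (hP.mono fun z hz ↦ (hball z hz).2).div (hQ.mono fun z hz ↦ (hball z hz).2)
      fun z hz ↦ (hball z hz).1
  obtain ⟨D₁, hD₁⟩ := hDdiff.isExactOn_ball
  obtain ⟨D₂, hD₂⟩ := (DifferentiableOn.isExactOn_ball (f := D₁) (c := (σ : ℂ)) (r := R)
    fun z hz ↦ (hD₁ z hz).differentiableAt.differentiableWithinAt)
  have hMdiff := differentiableOn_complexMGF_of_integrable hσint
  set H : ℂ → ℂ := fun s ↦ s * complexMGF X μ s with hH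
  have hHdiff : DifferentiableOn ℂ H {z | σ < z.re} := differentiableOn_id.mul hMdiff
  have hHext : ∀ z : ℂ, σ < z.re → Q z * deriv (deriv H) z = P z := by
    have hsub : {z : ℂ | σ < z.re} ⊆ {z | α < z.re} := fun z hz ↦ hσα.trans hz
    have hopen := isOpen_re_gt σ
    have h1 : AnalyticOnNhd ℂ (fun z ↦ Q z * deriv (deriv H) z) {z | σ < z.re} :=
      ((hQ.mono hsub).mul ((hHdiff.deriv hopen).deriv hopen)).analyticOnNhd hopen
    have h2 : AnalyticOnNhd ℂ P {z | σ < z.re} := (hP.mono hsub).analyticOnNhd hopen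
    have hw : ((max σ β + 1 : ℝ) : ℂ) ∈ {z : ℂ | σ < z.re} := by
      simp only [Set.mem_ofPred_eq, Complex.ofReal_re]
      linarith [le_max_left σ β]
    refine fun z hz ↦ h1.eqOn_of_preconnected_of_eventuallyEq h2 (isPreconnected_re_gt σ) hw ?_ hz
    have : {z : ℂ | β < z.re} ∈ nhds ((max σ β + 1 : ℝ) : ℂ) :=
      (isOpen_re_gt β).mem_nhds (by
        simp only [Set.mem_ofPred_eq, Complex.ofReal_re]
        linarith [le_max_right σ β])
    filter_upwards [this] with z hz using hPQ z hz
  have hUopen : IsOpen (ball (σ : ℂ) R ∩ {z | σ < z.re}) := isOpen_ball.inter (isOpen_re_gt σ)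
  obtain ⟨a, b, hab⟩ := exists_eqOn_add_affine hUopen
    ((convex_ball _ _).inter (convex_halfSpace_re_gt σ)) (f := H) (g := D₂)
    (hHdiff.mono Set.inter_subset_right)
    (fun z hz ↦ (hD₂ z hz.1).differentiableAt.differentiableWithinAt) (by
      intro z hz
      have h1 : deriv D₂ =ᶠ[nhds z] D₁ := by
        filter_upwards [isOpen_ball.mem_nhds hz.1] with y hy using (hD₂ y hy).deriv
      rw [h1.deriv_eq, (hD₁ z hz.1).deriv, eq_div_iff (hball z hz.1).1, mul_comm]
      exact hHext z hz.2)
  have hne : ∀ z ∈ ball (σ : ℂ) R, z ≠ 0 := by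
    rintro z hz rfl
    have := (hball 0 hz).2
    simp only [Complex.zero_re] at this
    linarith
  refine exists_lt_integrable_exp_of_differentiableOn_ball hX hX0 (r := R / 2) (by positivity)
    hσint (G := fun z ↦ (D₂ z + (a * z + b)) / z) ?_ ?_
  · rw [mul_div_cancel₀ _ two_ne_zero]
    have : DifferentiableOn ℂ D₂ (ball (σ : ℂ) R) :=
      fun z hz ↦ (hD₂ z hz).differentiableAt.differentiableWithinAt
    exact (this.add (by fun_prop)).div differentiableOn_id hne
  · rw [mul_div_cancel₀ _ two_ne_zero]
    intro z hz hzσ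
    rw [← hab z ⟨hz, hzσ⟩, hH]
    rw [mul_div_cancel_left₀ _ (hne z hz)]

end Landau

section Fubini

open MeasureTheory Set

theorem integrableOn_and_mul_integral_cpow_mul_intervalIntegral {x₀ : ℝ} (hx₀ : 0 < x₀) {s : ℂ}
    (hs : 0 < s.re) {g : ℝ → ℂ} (hg : IntegrableOn (fun t : ℝ ↦ g t * (t : ℂ) ^ (-s)) (Ioi x₀)) :
    IntegrableOn (fun x : ℝ ↦ (x : ℂ) ^ (-s - 1) * ∫ t in x₀..x, g t) (Ioi x₀) ∧
    s * ∫ x in Ioi x₀, (x : ℂ) ^ (-s - 1) * ∫ t in x₀..x, g t =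
      ∫ t in Ioi x₀, g t * (t : ℂ) ^ (-s) := by
  set ν := volume.restrict (Ioi x₀) with hν
  have hs0 : s ≠ 0 := by rintro rfl; simp at hs
  have hgm : AEStronglyMeasurable g ν := by
    have h1 : AEStronglyMeasurable (fun t : ℝ ↦ (t : ℂ) ^ s) ν :=
      (Complex.measurable_ofReal.pow_const s).aestronglyMeasurable
    refine (hg.aestronglyMeasurable.mul h1).congr ?_
    filter_upwards [ae_restrict_mem measurableSet_Ioi] with t ht
    have ht0 : (t : ℂ) ≠ 0 := by exact_mod_cast (hx₀.trans ht).ne'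
    simp only [Pi.mul_apply]
    rw [mul_assoc, ← Complex.cpow_add _ _ ht0]
    simp
  set K : ℝ × ℝ → ℂ := fun p ↦ {q : ℝ × ℝ | q.2 < q.1}.indicator
    (fun q ↦ (q.1 : ℂ) ^ (-s - 1) * g q.2) p with hK
  have hmeas : MeasurableSet {q : ℝ × ℝ | q.2 < q.1} := measurableSet_lt measurable_snd measurable_fst
  have hKm : AEStronglyMeasurable K (ν.prod ν) := by
    refine AEStronglyMeasurable.indicator ?_ hmeas
    refine AEStronglyMeasurable.mul ?_ hgm.comp_snd
    have : Measurable fun q : ℝ × ℝ ↦ (q.1 : ℂ) ^ (-s - 1) := by fun_prop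
    exact this.aestronglyMeasurable
  have hre : (-s - 1).re < -1 := by simp; linarith
  have hKslice : ∀ t, (fun x ↦ K (x, t)) = (Ioi t).indicator fun x ↦ (x : ℂ) ^ (-s - 1) * g t := by
    intro t; ext x; simp [hK, indicator]
  have hinter : ∀ t ∈ Ioi x₀, Ioi t ∩ Ioi x₀ = Ioi t := fun t ht ↦
    inter_eq_left.2 (Ioi_subset_Ioi (le_of_lt ht))
  have hKint : Integrable K (ν.prod ν) := by
    rw [integrable_prod_iff' hKm]
    constructor
    · filter_upwards [ae_restrict_mem measurableSet_Ioi] with t ht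
      rw [hKslice, integrable_indicator_iff measurableSet_Ioi, IntegrableOn, hν,
        Measure.restrict_restrict measurableSet_Ioi, hinter t ht]
      exact (integrableOn_Ioi_cpow_of_lt hre (hx₀.trans ht)).mul_const _
    · have h1 : Integrable (fun t : ℝ ↦ ‖g t * (t : ℂ) ^ (-s)‖ / s.re) ν := hg.norm.div_const _
      refine h1.congr ?_
      filter_upwards [ae_restrict_mem measurableSet_Ioi] with t ht
      have ht0 : 0 < t := hx₀.trans ht
      have h2 : (fun x ↦ ‖K (x, t)‖) = (Ioi t).indicator fun x ↦ x ^ (-s.re - 1) * ‖g t‖ := by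
        ext x
        have := congrFun (hKslice t) x
        rw [this, norm_indicator_eq_indicator_norm]
        by_cases hx : x ∈ Ioi t
        · have hx0 : 0 < x := ht0.trans hx
          rw [indicator_of_mem hx, indicator_of_mem hx, norm_mul,
            Complex.norm_cpow_eq_rpow_re_of_pos hx0]
          simp
        · rw [indicator_of_notMem hx, indicator_of_notMem hx]
      rw [h2, integral_indicator measurableSet_Ioi, hν, Measure.restrict_restrict measurableSet_Ioi,
        hinter t ht, integral_mul_const, integral_Ioi_rpow_of_lt (by linarith) ht0, norm_mul,
        Complex.norm_cpow_eq_rpow_re_of_pos ht0]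
      simp only [Complex.neg_re, sub_add_cancel]
      field_simp
  have hinner : ∀ x ∈ Ioi x₀, ∫ t, K (x, t) ∂ν = (x : ℂ) ^ (-s - 1) * ∫ t in x₀..x, g t := by
    intro x hx
    have h1 : (fun t ↦ K (x, t)) = (Iio x).indicator fun t ↦ (x : ℂ) ^ (-s - 1) * g t := by
      ext t; simp [hK, indicator]
    rw [h1, integral_indicator measurableSet_Iio, hν, Measure.restrict_restrict measurableSet_Iio,
      integral_const_mul, intervalIntegral.integral_of_le (le_of_lt hx), Iio_inter_Ioi,
      integral_Ioc_eq_integral_Ioo]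
  constructor
  · refine hKint.integral_prod_left.congr ?_
    filter_upwards [ae_restrict_mem measurableSet_Ioi] with x hx using hinner x hx
  · have h1 : ∫ x, ∫ t, K (x, t) ∂ν ∂ν = ∫ t, ∫ x, K (x, t) ∂ν ∂ν := integral_integral_swap hKint
    calc s * ∫ x in Ioi x₀, (x : ℂ) ^ (-s - 1) * ∫ t in x₀..x, g t
        = s * ∫ x, ∫ t, K (x, t) ∂ν ∂ν := by
          congr 1
          exact setIntegral_congr_fun measurableSet_Ioi fun x hx ↦ (hinner x hx).symm
      _ = ∫ t in Ioi x₀, g t * (t : ℂ) ^ (-s) := by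
          rw [h1, ← integral_const_mul]
          refine setIntegral_congr_fun measurableSet_Ioi fun t ht ↦ ?_
          rw [hKslice, integral_indicator measurableSet_Ioi, hν,
            Measure.restrict_restrict measurableSet_Ioi, hinter t ht, integral_mul_const,
            integral_Ioi_cpow_of_lt hre (hx₀.trans ht)]
          simp only [sub_add_cancel]
          field_simp

end Fubini

section MellinTail

open MeasureTheory Set Asymptotics

theorem integrableOn_mul_cpow_and_hasDerivAt_integral {x₀ : ℝ} (hx₀ : 0 < x₀) {f : ℝ → ℂ}
    (hfm : AEStronglyMeasurable f (volume.restrict (Ioi x₀))) {a C : ℝ}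
    (hf : ∀ x > x₀, ‖f x‖ ≤ C * x ^ a) {s : ℂ} (hs : a < s.re) :
    IntegrableOn (fun x : ℝ ↦ f x * (x : ℂ) ^ (-s - 1)) (Ioi x₀) ∧
    HasDerivAt (fun z : ℂ ↦ ∫ x in Ioi x₀, f x * (x : ℂ) ^ (-z - 1))
      (∫ x in Ioi x₀, -(Real.log x * f x) * (x : ℂ) ^ (-s - 1)) s := by
  set F : ℝ → ℂ := (Ioi x₀).indicator f with hF
  have hsub : Ioi x₀ ⊆ Ioi 0 := Ioi_subset_Ioi hx₀.le
  have hb : ∀ x > 0, ‖F x‖ ≤ |C| * x ^ a := by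
    intro x hx
    by_cases h : x ∈ Ioi x₀
    · rw [hF, indicator_of_mem h]
      exact (hf x h).trans (mul_le_mul_of_nonneg_right (le_abs_self C) (Real.rpow_nonneg hx.le _))
    · rw [hF, indicator_of_notMem h, norm_zero]
      positivity
  have hFm : AEStronglyMeasurable F volume := (aestronglyMeasurable_indicator_iff
    measurableSet_Ioi).2 hfm
  have hloc : LocallyIntegrableOn F (Ioi 0) := by
    have hg : LocallyIntegrableOn (fun x : ℝ ↦ |C| * x ^ a) (Ioi 0) :=
      ContinuousOn.locallyIntegrableOn (continuousOn_const.mul (ContinuousOn.rpow_const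
        continuousOn_id fun x hx ↦ Or.inl (ne_of_gt hx))) measurableSet_Ioi
    refine hg.mono hFm (Eventually.of_forall fun x ↦ ?_)
    by_cases hx : x ∈ Ioi x₀
    · exact (hb x (hsub hx)).trans (le_abs_self _)
    · rw [hF, indicator_of_notMem hx, norm_zero]
      positivity
  have htop : F =O[atTop] (· ^ (-(-a))) := by
    refine IsBigO.of_bound |C| ?_
    filter_upwards [eventually_gt_atTop 0] with x hx
    rw [neg_neg, Real.norm_of_nonneg (Real.rpow_nonneg hx.le _)]
    exact hb x hx
  have hbot : F =O[nhdsWithin 0 (Ioi 0)] (· ^ (-(-s.re - 1))) := by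
    refine IsBigO.of_bound 1 ?_
    filter_upwards [mem_nhdsWithin_of_mem_nhds (Iio_mem_nhds hx₀)] with x hx
    have : x ∉ Ioi x₀ := fun h ↦ lt_asymm (mem_Ioi.1 h) hx
    rw [hF, indicator_of_notMem this, norm_zero]
    positivity
  have h1 := mellinConvergent_of_isBigO_rpow hloc htop (s := -s) (by simpa using hs) hbot (by simp)
  obtain ⟨-, h2⟩ := mellin_hasDerivAt_of_isBigO_rpow hloc htop (s := -s) (by simpa using hs) hbot
    (by simp)
  have key : ∀ (g : ℝ → ℂ) (z : ℂ), mellin ((Ioi x₀).indicator g) z =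
      ∫ x in Ioi x₀, g x * (x : ℂ) ^ (z - 1) := by
    intro g z
    have : (fun t : ℝ ↦ (t : ℂ) ^ (z - 1) • (Ioi x₀).indicator g t) =
        (Ioi x₀).indicator fun t ↦ g t * (t : ℂ) ^ (z - 1) := by
      ext t; simp [indicator, mul_comm]
    rw [mellin, this, integral_indicator measurableSet_Ioi,
      Measure.restrict_restrict measurableSet_Ioi, inter_eq_left.2 hsub]
  constructor
  · have : (fun t : ℝ ↦ (t : ℂ) ^ (-s - 1) • F t) =
        (Ioi x₀).indicator fun t ↦ f t * (t : ℂ) ^ (-s - 1) := by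
      ext t; simp [hF, indicator, mul_comm]
    rw [MellinConvergent, this, IntegrableOn, integrable_indicator_iff measurableSet_Ioi,
      IntegrableOn, Measure.restrict_restrict measurableSet_Ioi, inter_eq_left.2 hsub] at h1
    exact h1
  · have h3 := h2.scomp s (hasDerivAt_neg s)
    have h4 : (fun t : ℝ ↦ Real.log t • F t) = (Ioi x₀).indicator fun t ↦ Real.log t * f t := by
      ext t; simp [hF, indicator]
    rw [h4, key] at h3
    have h5 : (fun z : ℂ ↦ ∫ x in Ioi x₀, f x * (x : ℂ) ^ (-z - 1)) = mellin F ∘ Neg.neg := by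
      ext z
      exact (key f (-z)).symm
    rw [h5]
    refine h3.congr_deriv ?_
    simp only [neg_mul, integral_neg, neg_smul, one_smul]

end MellinTail

section Zeta

open MeasureTheory Set Asymptotics

theorem integral_Ioi_one_mul_cpow {s : ℂ} (hs : 1 < s.re) :
    IntegrableOn (fun x : ℝ ↦ (x : ℂ) * (x : ℂ) ^ (-s - 1)) (Ioi 1) ∧
    ∫ x in Ioi (1 : ℝ), (x : ℂ) * (x : ℂ) ^ (-s - 1) = 1 / (s - 1) := by
  have h : ∀ x ∈ Ioi (1 : ℝ), (x : ℂ) ^ (-s) = (x : ℂ) * (x : ℂ) ^ (-s - 1) := by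
    intro x hx
    have hx0 : (x : ℂ) ≠ 0 := by exact_mod_cast (zero_lt_one.trans hx).ne'
    conv_rhs => rw [← Complex.cpow_one (x : ℂ), Complex.cpow_one (x : ℂ)]
    rw [Complex.cpow_sub _ _ hx0, Complex.cpow_one]
    field_simp
  have hre : (-s).re < -1 := by simpa using hs
  constructor
  · exact (integrableOn_Ioi_cpow_of_lt hre one_pos).congr_fun h measurableSet_Ioi
  · rw [← setIntegral_congr_fun measurableSet_Ioi h, integral_Ioi_cpow_of_lt hre one_pos]
    rw [show -s + 1 = -(s - 1) by ring]
    rw [Complex.ofReal_one, Complex.one_cpow, neg_div_neg_eq]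

theorem integrableOn_fract_mul_cpow_and_differentiableAt {s : ℂ} (hs : 0 < s.re) :
    IntegrableOn (fun x : ℝ ↦ ((Int.fract x : ℝ) : ℂ) * (x : ℂ) ^ (-s - 1)) (Ioi 1) ∧
    DifferentiableAt ℂ
      (fun z : ℂ ↦ ∫ x in Ioi (1 : ℝ), ((Int.fract x : ℝ) : ℂ) * (x : ℂ) ^ (-z - 1)) s := by
  have hm : Measurable fun x : ℝ ↦ ((Int.fract x : ℝ) : ℂ) :=
    Complex.measurable_ofReal.comp measurable_fract
  obtain ⟨h1, h2⟩ := integrableOn_mul_cpow_and_hasDerivAt_integral (x₀ := 1) one_pos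
    hm.aestronglyMeasurable (a := 0) (C := 1) (fun x _ ↦ by
      rw [Complex.norm_of_nonneg (Int.fract_nonneg x)]
      simpa using (Int.fract_lt_one x).le) hs
  exact ⟨h1, h2.differentiableAt⟩

theorem riemannZeta₁_eq_sub_integral_fract {s : ℂ} (hs : 0 < s.re) :
    riemannZeta₁ s =
      s - s * (s - 1) * ∫ x in Ioi (1 : ℝ), ((Int.fract x : ℝ) : ℂ) * (x : ℂ) ^ (-s - 1) := by
  have hU : IsOpen {z : ℂ | 0 < z.re} := isOpen_re_gt 0
  have hana : AnalyticOnNhd ℂ (fun s : ℂ ↦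
      s - s * (s - 1) * ∫ x in Ioi (1 : ℝ), ((Int.fract x : ℝ) : ℂ) * (x : ℂ) ^ (-s - 1))
      {z : ℂ | 0 < z.re} := by
    refine DifferentiableOn.analyticOnNhd (fun z hz ↦ ?_) hU
    have := (integrableOn_fract_mul_cpow_and_differentiableAt hz).2
    exact ((differentiableAt_id.sub ((differentiableAt_id.mul
      (differentiableAt_id.sub_const 1)).mul this))).differentiableWithinAt
  refine AnalyticOnNhd.eqOn_of_preconnected_of_eventuallyEq (z₀ := 2)
    (differentiable_riemannZeta₁.differentiableOn.analyticOnNhd hU) hana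
    (isPreconnected_re_gt 0) (by simp) ?_ hs
  filter_upwards [(isOpen_re_gt 1).mem_nhds (show (2 : ℂ) ∈ {z : ℂ | 1 < z.re} by simp)] with z hz
  have hz1 : 1 < z.re := hz
  have hz1' : z ≠ 1 := by rintro rfl; simp at hz1
  have hz0 : z ≠ 0 := by rintro rfl; norm_num at hz1
  have hO : (fun n : ℕ ↦ ∑ k ∈ Finset.Icc 1 n, (1 : ℝ)) =O[atTop] fun n ↦ (n : ℝ) ^ (1 : ℝ) := by
    simpa using isBigO_refl _ _
  have h1 := LSeries_eq_mul_integral_of_nonneg (fun _ ↦ 1) zero_le_one hz1 hO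
    (fun _ ↦ zero_le_one)
  have h2 : LSeries (fun _ ↦ ((1 : ℝ) : ℂ)) z = riemannZeta z := by
    rw [← LSeries_one_eq_riemannZeta hz1]; congr 1
  obtain ⟨i1, e1⟩ := integral_Ioi_one_mul_cpow hz1
  have i2 := (integrableOn_fract_mul_cpow_and_differentiableAt (zero_lt_one.trans hz1)).1
  have h3 : ∫ t in Ioi (1 : ℝ), (∑ k ∈ Finset.Icc 1 ⌊t⌋₊, ((1 : ℝ) : ℂ)) * t ^ (-(z + 1)) =
      1 / (z - 1) - ∫ x in Ioi (1 : ℝ), ((Int.fract x : ℝ) : ℂ) * (x : ℂ) ^ (-z - 1) := by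
    rw [← e1, ← integral_sub i1 i2]
    refine setIntegral_congr_fun measurableSet_Ioi fun x hx ↦ ?_
    have hx0 : 0 ≤ x := zero_le_one.trans (le_of_lt hx)
    have : (⌊x⌋₊ : ℂ) = x - Int.fract x := by
      rw [← Complex.ofReal_sub, Int.self_sub_fract, ← natCast_floor_eq_intCast_floor hx0]
      simp
    simp [this]
    ring_nf
  have hz' : z - 1 ≠ 0 := sub_ne_zero.2 hz1'
  have h4 := riemannZeta_eq_inv_sub_mul hz1'
  rw [h2, h3] at h1
  rw [h1] at h4
  field_simp at h4
  rw [← h4]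
  ring

theorem riemannZeta₁_ofReal_ne_zero {σ : ℝ} (hσ : 0 < σ) : riemannZeta₁ σ ≠ 0 := by
  rcases le_or_gt 1 σ with h | h
  · rcases h.eq_or_lt with rfl | h1
    · simp
    · have hne : (σ : ℂ) ≠ 1 := by exact_mod_cast h1.ne'
      have h2 := riemannZeta_ne_zero_of_one_le_re (s := σ) (by simpa using h)
      rw [riemannZeta_eq_inv_sub_mul hne] at h2
      exact right_ne_zero_of_mul h2
  · rw [riemannZeta₁_eq_sub_integral_fract (by simpa using hσ)]
    have h1 : ∫ x in Ioi (1 : ℝ), ((Int.fract x : ℝ) : ℂ) * (x : ℂ) ^ (-(σ : ℂ) - 1) =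
        ((∫ x in Ioi (1 : ℝ), Int.fract x * x ^ (-σ - 1) : ℝ) : ℂ) := by
      rw [← integral_complex_ofReal]
      refine setIntegral_congr_fun measurableSet_Ioi fun x hx ↦ ?_
      have hx0 : 0 ≤ x := zero_le_one.trans (le_of_lt hx)
      simp only [Complex.ofReal_mul]
      rw [Complex.ofReal_cpow hx0]
      simp
    have h2 : 0 ≤ ∫ x in Ioi (1 : ℝ), Int.fract x * x ^ (-σ - 1) :=
      setIntegral_nonneg measurableSet_Ioi fun x hx ↦
        mul_nonneg (Int.fract_nonneg x) (Real.rpow_nonneg (zero_le_one.trans (le_of_lt hx)) _)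
    rw [h1]
    have h3 : 0 < σ - σ * (σ - 1) * ∫ x in Ioi (1 : ℝ), Int.fract x * x ^ (-σ - 1) := by
      nlinarith [mul_nonneg (mul_nonneg hσ.le (sub_nonneg.2 h.le)) h2]
    exact_mod_cast h3.ne'

theorem mul_integral_psi_mul_cpow {s : ℂ} (hs : 1 < s.re) :
    s * ∫ x in Ioi (1 : ℝ), (Chebyshev.psi x : ℂ) * (x : ℂ) ^ (-s - 1) =
      -deriv riemannZeta s / riemannZeta s := by
  have hpsi : ∀ n : ℕ, ∑ k ∈ Finset.Icc 1 n, ArithmeticFunction.vonMangoldt k = Chebyshev.psi n := by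
    intro n
    rw [Chebyshev.psi_eq_sum_Icc, Nat.floor_natCast, ← Finset.sum_subset
      (Finset.Icc_subset_Icc_left zero_le_one)]
    intro k _ hk
    have : k = 0 := by simp at *; omega
    simp [this]
  have hO : (fun n : ℕ ↦ ∑ k ∈ Finset.Icc 1 n, ArithmeticFunction.vonMangoldt k) =O[atTop]
      fun n ↦ (n : ℝ) ^ (1 : ℝ) := by
    refine IsBigO.of_bound (Real.log 4 + 4) (Eventually.of_forall fun n ↦ ?_)
    rw [hpsi, Real.rpow_one, Real.norm_of_nonneg (Chebyshev.psi_nonneg _), Real.norm_natCast]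
    exact Chebyshev.psi_le_const_mul_self n.cast_nonneg
  rw [← ArithmeticFunction.LSeries_vonMangoldt_eq_deriv_riemannZeta_div hs,
    LSeries_eq_mul_integral_of_nonneg _ zero_le_one hs hO
      (fun _ ↦ ArithmeticFunction.vonMangoldt_nonneg)]
  congr 1
  refine setIntegral_congr_fun measurableSet_Ioi fun x hx ↦ ?_
  rw [Chebyshev.psi_eq_psi_coe_floor, ← hpsi]
  push_cast
  ring_nf

theorem neg_deriv_riemannZeta_div {s : ℂ} (hs : 1 < s.re) :
    -deriv riemannZeta s / riemannZeta s =
      1 / (s - 1) - deriv riemannZeta₁ s / riemannZeta₁ s := by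
  have hs1 : s ≠ 1 := by rintro rfl; simp at hs
  have hs1' : s - 1 ≠ 0 := sub_ne_zero.2 hs1
  have h0 : riemannZeta₁ s ≠ 0 := by
    have h2 := riemannZeta_ne_zero_of_one_le_re hs.le
    rw [riemannZeta_eq_inv_sub_mul hs1] at h2
    exact right_ne_zero_of_mul h2
  have h1 : deriv riemannZeta s =
      -(1 / (s - 1) ^ 2) * riemannZeta₁ s + (s - 1)⁻¹ * deriv riemannZeta₁ s := by
    have h2 : riemannZeta =ᶠ[nhds s] fun z ↦ (z - 1)⁻¹ * riemannZeta₁ z := by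
      filter_upwards [isOpen_ne.mem_nhds hs1] with z hz using riemannZeta_eq_inv_sub_mul hz
    rw [h2.deriv_eq]
    have h3 : HasDerivAt (fun z : ℂ ↦ (z - 1)⁻¹) (-1 / (s - 1) ^ 2) s :=
      ((hasDerivAt_id s).sub_const 1).inv hs1'
    refine (h3.mul (differentiable_riemannZeta₁ s).hasDerivAt).deriv.trans ?_
    ring
  rw [h1, riemannZeta_eq_inv_sub_mul hs1]
  field_simp
  ring

end Zeta

section Positivity

open MeasureTheory ProbabilityTheory Set

theorem exists_differentiableOn_eqOn_integral_of_forall_nonneg {x₀ : ℝ} (hx₀ : 1 < x₀) {E : ℝ → ℝ}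
    (hEm : Measurable E) {C : ℝ} (hE : ∀ x > x₀, |E x| ≤ C * x) {c : ℝ}
    (hpos : ∀ x ≥ x₀, 0 ≤ c - ∫ t in x₀..x, E t / (t * Real.log t ^ 2)) {P Q : ℂ → ℂ}
    (hP : DifferentiableOn ℂ P {z | 1 / 2 < z.re}) (hQ : DifferentiableOn ℂ Q {z | 1 / 2 < z.re})
    (hQ0 : ∀ t : ℝ, 1 / 2 < t → Q t ≠ 0)
    (hPQ : ∀ z : ℂ, 1 < z.re →
      Q z * ∫ x in Ioi x₀, (E x : ℂ) * (x : ℂ) ^ (-z - 1) = P z) :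
    ∃ F : ℂ → ℂ, DifferentiableOn ℂ F {z | 1 / 2 < z.re} ∧
      ∀ z : ℂ, 1 < z.re → F z = ∫ x in Ioi x₀, (E x : ℂ) * (x : ℂ) ^ (-z - 1) := by
  have hx₀' : 0 < x₀ := one_pos.trans hx₀
  have hL : 0 < Real.log x₀ := Real.log_pos hx₀
  have hC : 0 ≤ C := by
    have := (abs_nonneg _).trans (hE (x₀ + 1) (by simp))
    exact nonneg_of_mul_nonneg_left this (by linarith)
  have hlog : ∀ x > x₀, Real.log x₀ ≤ Real.log x := fun x hx ↦ Real.log_le_log hx₀' hx.le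
  set g : ℝ → ℝ := (Ioi x₀).indicator fun t ↦ E t / (t * Real.log t ^ 2) with hg
  have hgm : Measurable g := by
    refine Measurable.indicator ?_ measurableSet_Ioi
    fun_prop
  have hgb : ∀ t, |g t| ≤ C / Real.log x₀ ^ 2 := by
    intro t
    by_cases ht : t ∈ Ioi x₀
    · have ht0 : 0 < t := hx₀'.trans ht
      have hl := hlog t ht
      rw [hg, indicator_of_mem ht, abs_div, abs_of_nonneg (by positivity : 0 ≤ t * Real.log t ^ 2),
        div_le_div_iff₀ (by have := hL.trans_le hl; positivity) (by positivity)]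
      calc |E t| * Real.log x₀ ^ 2 ≤ (C * t) * Real.log t ^ 2 :=
            mul_le_mul (hE t ht) (by gcongr) (by positivity) (by positivity)
        _ = _ := by ring
    · rw [hg, indicator_of_notMem ht, abs_zero]
      positivity
  have hgi : ∀ a b, IntervalIntegrable g volume a b := fun a b ↦
    (intervalIntegrable_const (c := C / Real.log x₀ ^ 2)).mono_fun hgm.aestronglyMeasurable
      (Eventually.of_forall fun t ↦ by
        exact (hgb t).trans (le_abs_self _))
  set V : ℝ → ℝ := fun x ↦ c - ∫ t in x₀..x, g t with hV
  have hVc : Continuous V := continuous_const.sub (intervalIntegral.continuous_primitive hgi x₀)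
  have hVpos : ∀ x ≥ x₀, 0 ≤ V x := by
    intro x hx
    refine (hpos x hx).trans_eq ?_
    simp only [hV]
    congr 1
    rw [intervalIntegral.integral_of_le hx, intervalIntegral.integral_of_le hx]
    refine setIntegral_congr_fun measurableSet_Ioc fun t ht ↦ ?_
    rw [hg, indicator_of_mem (show t ∈ Ioi x₀ from ht.1)]
  have hVb : ∀ x > x₀, ‖(V x : ℂ)‖ ≤ (|c| + C / Real.log x₀ ^ 2) * x ^ (1 : ℝ) := by
    intro x hx
    rw [Complex.norm_real, Real.norm_eq_abs, Real.rpow_one]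
    have h1 := intervalIntegral.norm_integral_le_of_norm_le_const (a := x₀) (b := x)
      (f := g) (C := C / Real.log x₀ ^ 2) fun t _ ↦ hgb t
    rw [Real.norm_eq_abs, abs_of_pos (sub_pos.2 hx)] at h1
    have h2 : C / Real.log x₀ ^ 2 * (x - x₀) ≤ C / Real.log x₀ ^ 2 * x := by gcongr; linarith
    have h3 : |c| ≤ |c| * x := le_mul_of_one_le_right (abs_nonneg _) (hx₀.trans hx).le
    calc |V x| ≤ |c| + |∫ t in x₀..x, g t| := abs_sub _ _
      _ ≤ _ := by linarith
  have hVint := fun (s : ℂ) (hs : 1 < s.re) ↦ (integrableOn_mul_cpow_and_hasDerivAt_integral hx₀'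
    (f := fun x ↦ (V x : ℂ)) (Complex.measurable_ofReal.comp hVc.measurable).aestronglyMeasurable
    hVb hs).1
  set w : ℝ → NNReal := fun x ↦ (V x / x).toNNReal with hw
  have hwm : Measurable w := (hVc.measurable.div measurable_id).real_toNNReal
  have hwv : ∀ x ∈ Ioi x₀, (w x : ℝ) = V x / x := fun x hx ↦
    Real.coe_toNNReal _ (div_nonneg (hVpos x (le_of_lt hx)) (hx₀'.trans hx).le)
  set μ : Measure ℝ := (volume.restrict (Ioi x₀)).withDensity fun x ↦ (w x : ENNReal) with hμ
  set X : ℝ → ℝ := fun x ↦ -Real.log x with hX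
  have hXm : Measurable X := Real.measurable_log.neg
  have hX0 : ∀ᵐ x ∂μ, X x ≤ 0 := by
    refine (withDensity_absolutelyContinuous _ _).ae_le ?_
    filter_upwards [ae_restrict_mem measurableSet_Ioi] with x hx
    exact neg_nonpos.2 (Real.log_nonneg (hx₀.trans hx).le)
  have hcongr : ∀ s : ℂ, ∀ x ∈ Ioi x₀, w x • Complex.exp (s * X x) =
      (V x : ℂ) * (x : ℂ) ^ (-s - 1) := by
    intro s x hx
    have hx0 : 0 < x := hx₀'.trans hx
    have hx0' : (x : ℂ) ≠ 0 := by exact_mod_cast hx0.ne'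
    rw [NNReal.smul_def, hwv x hx, Complex.real_smul, Complex.cpow_sub _ _ hx0', Complex.cpow_one,
      Complex.cpow_def_of_ne_zero hx0', hX, Complex.ofReal_div, Complex.ofReal_neg,
      Complex.ofReal_log hx0.le, mul_neg, mul_neg, mul_comm s]
    ring
  have hmgf : ∀ s, complexMGF X μ s = ∫ x in Ioi x₀, (V x : ℂ) * (x : ℂ) ^ (-s - 1) := by
    intro s
    rw [complexMGF, hμ, integral_withDensity_eq_integral_smul hwm]
    exact setIntegral_congr_fun measurableSet_Ioi (hcongr s)
  have hint : ∀ t > 1, Integrable (fun x ↦ Real.exp (t * X x)) μ := by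
    intro t ht
    have h1 : Integrable (fun x ↦ Complex.exp (t * X x)) μ := by
      rw [hμ, integrable_withDensity_iff_integrable_smul hwm]
      exact (hVint t (by simpa using ht)).congr_fun (fun x hx ↦ (hcongr t x hx).symm)
        measurableSet_Ioi
    refine h1.re.congr (Eventually.of_forall fun x ↦ ?_)
    simp only [RCLike.re_eq_complex_re]
    rw [← Complex.ofReal_mul, ← Complex.ofReal_exp, Complex.ofReal_re]
  have hk : ∀ k : ℕ, ∀ s : ℂ, 1 < s.re → IntegrableOn (fun x : ℝ ↦
        ((E x / Real.log x ^ k : ℝ) : ℂ) * (x : ℂ) ^ (-s - 1)) (Ioi x₀) ∧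
      HasDerivAt (fun z : ℂ ↦ ∫ x in Ioi x₀,
        ((E x / Real.log x ^ k : ℝ) : ℂ) * (x : ℂ) ^ (-z - 1))
        (∫ x in Ioi x₀, -(Real.log x * ((E x / Real.log x ^ k : ℝ) : ℂ)) *
          (x : ℂ) ^ (-s - 1)) s := by
    intro k s hs
    refine integrableOn_mul_cpow_and_hasDerivAt_integral hx₀' ?_ (a := 1)
      (C := C / Real.log x₀ ^ k) (fun x hx ↦ ?_) hs
    · exact (Complex.measurable_ofReal.comp (by fun_prop)).aestronglyMeasurable
    · have hl := hlog x hx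
      have hl0 := hL.trans_le hl
      have hx0 : 0 < x := hx₀'.trans hx
      rw [Complex.norm_real, Real.norm_eq_abs, Real.rpow_one, abs_div, abs_of_pos (pow_pos hl0 k),
        div_mul_eq_mul_div]
      exact div_le_div₀ (by positivity) (hE x hx) (by positivity) (by gcongr)
  have hshift : ∀ k : ℕ, ∀ s : ℂ, (∫ x in Ioi x₀, -(Real.log x *
      ((E x / Real.log x ^ (k + 1) : ℝ) : ℂ)) * (x : ℂ) ^ (-s - 1)) =
      -∫ x in Ioi x₀, ((E x / Real.log x ^ k : ℝ) : ℂ) * (x : ℂ) ^ (-s - 1) := by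
    intro k s
    rw [← integral_neg]
    refine setIntegral_congr_fun measurableSet_Ioi fun x hx ↦ ?_
    have hl0 : (Real.log x : ℂ) ≠ 0 := by exact_mod_cast (hL.trans_le (hlog x hx)).ne'
    push_cast
    field_simp
    ring
  have hpow : ∀ s : ℂ, HasDerivAt (fun z : ℂ ↦ (x₀ : ℂ) ^ (-z))
      (-(Real.log x₀ * (x₀ : ℂ) ^ (-s))) s := by
    intro s
    have := (hasDerivAt_neg s).const_cpow (c := (x₀ : ℂ)) (Or.inl (by exact_mod_cast hx₀'.ne'))
    refine this.congr_deriv ?_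
    rw [Complex.ofReal_log hx₀'.le]
    ring
  have hH : ∀ s : ℂ, 1 < s.re → s * complexMGF X μ s = c * (x₀ : ℂ) ^ (-s) -
      ∫ x in Ioi x₀, ((E x / Real.log x ^ 2 : ℝ) : ℂ) * (x : ℂ) ^ (-s - 1) := by
    intro s hs
    have hs0 : s ≠ 0 := by rintro rfl; norm_num at hs
    have hgs : ∀ t ∈ Ioi x₀, ((E t / Real.log t ^ 2 : ℝ) : ℂ) * (t : ℂ) ^ (-s - 1) =
        (g t : ℂ) * (t : ℂ) ^ (-s) := by
      intro t ht
      have ht0 : (t : ℂ) ≠ 0 := by exact_mod_cast (hx₀'.trans ht).ne'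
      rw [hg, indicator_of_mem ht, Complex.cpow_sub _ _ ht0, Complex.cpow_one]
      push_cast
      field_simp
    obtain ⟨f1, f2⟩ := integrableOn_and_mul_integral_cpow_mul_intervalIntegral hx₀'
      (zero_lt_one.trans hs) (g := fun t ↦ (g t : ℂ))
      ((hk 2 s hs).1.congr_fun hgs measurableSet_Ioi)
    have hre : (-s - 1).re < -1 := by simp; linarith
    rw [hmgf, setIntegral_congr_fun measurableSet_Ioi hgs, ← f2]
    have h1 : ∫ x in Ioi x₀, (V x : ℂ) * (x : ℂ) ^ (-s - 1) =
        (c * ∫ x in Ioi x₀, (x : ℂ) ^ (-s - 1)) -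
        ∫ x in Ioi x₀, (x : ℂ) ^ (-s - 1) * ∫ t in x₀..x, (g t : ℂ) := by
      rw [← integral_const_mul, ← integral_sub
        ((integrableOn_Ioi_cpow_of_lt hre hx₀').const_mul _) f1]
      refine integral_congr_ae (Eventually.of_forall fun x ↦ ?_)
      simp only [hV]
      rw [intervalIntegral.integral_ofReal]
      push_cast
      ring
    rw [h1, integral_Ioi_cpow_of_lt hre hx₀', sub_add_cancel]
    field_simp
  have hH1 : ∀ s : ℂ, 1 < s.re → deriv (fun s ↦ s * complexMGF X μ s) s =
      -(c * Real.log x₀) * (x₀ : ℂ) ^ (-s) +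
      ∫ x in Ioi x₀, ((E x / Real.log x ^ 1 : ℝ) : ℂ) * (x : ℂ) ^ (-s - 1) := by
    intro s hs
    have hev : (fun s ↦ s * complexMGF X μ s) =ᶠ[nhds s] fun s ↦ c * (x₀ : ℂ) ^ (-s) -
        ∫ x in Ioi x₀, ((E x / Real.log x ^ 2 : ℝ) : ℂ) * (x : ℂ) ^ (-s - 1) := by
      filter_upwards [(isOpen_re_gt 1).mem_nhds hs] with z hz using hH z hz
    rw [hev.deriv_eq]
    refine (((hpow s).const_mul (c : ℂ)).sub (hk 2 s hs).2).deriv.trans ?_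
    rw [hshift 1 s]
    ring
  have hH2 : ∀ s : ℂ, 1 < s.re → deriv (deriv (fun s ↦ s * complexMGF X μ s)) s =
      c * Real.log x₀ ^ 2 * (x₀ : ℂ) ^ (-s) -
      ∫ x in Ioi x₀, (E x : ℂ) * (x : ℂ) ^ (-s - 1) := by
    intro s hs
    have hev : deriv (fun s ↦ s * complexMGF X μ s) =ᶠ[nhds s] fun s ↦
        -(c * Real.log x₀) * (x₀ : ℂ) ^ (-s) +
        ∫ x in Ioi x₀, ((E x / Real.log x ^ 1 : ℝ) : ℂ) * (x : ℂ) ^ (-s - 1) := by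
      filter_upwards [(isOpen_re_gt 1).mem_nhds hs] with z hz using hH1 z hz
    rw [hev.deriv_eq]
    refine (((hpow s).const_mul (-(c * Real.log x₀) : ℂ)).add (hk 1 s hs).2).deriv.trans ?_
    rw [hshift 0 s]
    simp only [pow_zero, div_one]
    ring
  have hent : Differentiable ℂ fun s : ℂ ↦ c * Real.log x₀ ^ 2 * (x₀ : ℂ) ^ (-s) :=
    fun s ↦ (hpow s).differentiableAt.const_mul _
  have hall := integrable_exp_of_mul_deriv_deriv_eq hXm.aemeasurable hX0
    (α := 1 / 2) (β := 1) (by norm_num) hint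
    (P := fun z ↦ Q z * (c * Real.log x₀ ^ 2 * (x₀ : ℂ) ^ (-z)) - P z) (Q := Q)
    ((hQ.mul hent.differentiableOn).sub hP) hQ hQ0 (fun z hz ↦ by
      rw [hH2 z hz, mul_sub, hPQ z hz])
  have hdiff : DifferentiableOn ℂ (fun s ↦ s * complexMGF X μ s) {z | 1 / 2 < z.re} :=
    differentiableOn_id.mul (differentiableOn_complexMGF_of_integrable hall)
  have hopen := isOpen_re_gt (1 / 2)
  refine ⟨fun z ↦ c * Real.log x₀ ^ 2 * (x₀ : ℂ) ^ (-z) -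
    deriv (deriv (fun s ↦ s * complexMGF X μ s)) z,
    hent.differentiableOn.sub ((hdiff.deriv hopen).deriv hopen), fun z hz ↦ ?_⟩
  simp only
  rw [hH2 z hz, sub_sub_cancel]

end Positivity

section ZeroFree

open MeasureTheory Set Metric

theorem ne_zero_of_deriv_eq_mul {U : Set ℂ} (hU : IsOpen U) (hUc : IsPreconnected U) {f G : ℂ → ℂ}
    (hf : DifferentiableOn ℂ f U) (hG : DifferentiableOn ℂ G U)
    (h : ∀ z ∈ U, deriv f z = f z * G z) {a : ℂ} (ha : a ∈ U) (hfa : f a ≠ 0) :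
    ∀ z ∈ U, f z ≠ 0 := by
  intro z hz hfz
  obtain ⟨r, hr, hball⟩ := Metric.isOpen_iff.1 hU z hz
  obtain ⟨Φ, hΦ⟩ := (hG.mono hball).isExactOn_ball
  have hd : ∀ w ∈ ball z r, HasDerivAt (fun w ↦ f w * Complex.exp (-Φ w)) 0 w := by
    intro w hw
    have h1 := (hf.differentiableAt (hU.mem_nhds (hball hw))).hasDerivAt
    refine (h1.mul (hΦ w hw).neg.cexp).congr_deriv ?_
    rw [h w (hball hw)]
    ring
  have hconst : ∀ w ∈ ball z r, f w = 0 := by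
    intro w hw
    have := (convex_ball z r).is_const_of_fderivWithin_eq_zero (𝕜 := ℂ)
      (f := fun w ↦ f w * Complex.exp (-Φ w))
      (fun w hw ↦ (hd w hw).differentiableAt.differentiableWithinAt)
      (fun w hw ↦ by
        rw [fderivWithin_of_isOpen isOpen_ball hw]
        ext
        simpa using (hd w hw).deriv) hw (mem_ball_self hr)
    simpa [hfz, Complex.exp_ne_zero] using this
  refine hfa ((hf.analyticOnNhd hU).eqOn_zero_of_preconnected_of_eventuallyEq_zero hUc hz ?_ ha)
  filter_upwards [ball_mem_nhds z hr] with w hw using hconst w hw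

theorem abs_theta_sub_id_le {x : ℝ} (hx : 0 ≤ x) : |Chebyshev.theta x - x| ≤ 1 * x := by
  have h1 := Chebyshev.theta_le_log4_mul_x hx
  have h2 := Chebyshev.theta_nonneg x
  have h3 : Real.log 4 ≤ 2 := by
    rw [show (4 : ℝ) = 2 ^ 2 by norm_num, Real.log_pow]
    have := Real.log_two_lt_d9
    push_cast
    linarith
  rw [abs_le]
  constructor <;> nlinarith

theorem riemannZeta₁_ne_zero_of_forall_nonneg {x₀ c : ℝ} (hx₀ : 1 < x₀)
    (hpos : ∀ x ≥ x₀, 0 ≤ c - ∫ t in x₀..x, (Chebyshev.theta t - t) / (t * Real.log t ^ 2)) {z : ℂ}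
    (hz : 1 / 2 < z.re) : riemannZeta₁ z ≠ 0 := by
  have hthm : Measurable Chebyshev.theta := Chebyshev.theta_mono.measurable
  have hpsm : Measurable Chebyshev.psi := Chebyshev.psi_mono.measurable
  set E : ℝ → ℝ := fun t ↦ Chebyshev.theta t - t with hE
  have hEm : Measurable E := hthm.sub measurable_id
  obtain ⟨K, hK⟩ := Chebyshev.psi_sub_theta_le_mul_sqrt
  have hopen := isOpen_re_gt (1 / 2)
  have hD : ∀ s : ℂ, 1 / 2 < s.re →
      IntegrableOn (fun x : ℝ ↦ ((Chebyshev.psi x - Chebyshev.theta x : ℝ) : ℂ) *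
        (x : ℂ) ^ (-s - 1)) (Ioi 1) ∧
      DifferentiableAt ℂ (fun s : ℂ ↦ ∫ x in Ioi (1 : ℝ),
        ((Chebyshev.psi x - Chebyshev.theta x : ℝ) : ℂ) * (x : ℂ) ^ (-s - 1)) s := by
    intro s hs
    have := integrableOn_mul_cpow_and_hasDerivAt_integral one_pos (a := 1 / 2) (C := K)
      (f := fun x ↦ ((Chebyshev.psi x - Chebyshev.theta x : ℝ) : ℂ))
      (Complex.measurable_ofReal.comp (hpsm.sub hthm)).aestronglyMeasurable (fun x _ ↦ by
        rw [Complex.norm_real, Real.norm_of_nonneg (sub_nonneg.2 (Chebyshev.theta_le_psi x)),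
          ← Real.sqrt_eq_rpow]
        exact hK x) hs
    exact ⟨this.1, this.2.differentiableAt⟩
  have hI : ∀ s : ℂ, 1 / 2 < s.re →
      IntegrableOn (fun x : ℝ ↦ (((Iic x₀).indicator E x : ℝ) : ℂ) * (x : ℂ) ^ (-s - 1)) (Ioi 1) ∧
      DifferentiableAt ℂ (fun s : ℂ ↦ ∫ x in Ioi (1 : ℝ),
        (((Iic x₀).indicator E x : ℝ) : ℂ) * (x : ℂ) ^ (-s - 1)) s := by
    intro s hs
    have := integrableOn_mul_cpow_and_hasDerivAt_integral one_pos (a := 0) (C := x₀)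
      (f := fun x ↦ (((Iic x₀).indicator E x : ℝ) : ℂ))
      (Complex.measurable_ofReal.comp (hEm.indicator measurableSet_Iic)).aestronglyMeasurable
      (fun x hx ↦ by
        rw [Complex.norm_real, Real.norm_eq_abs, Real.rpow_zero, mul_one]
        by_cases h : x ∈ Iic x₀
        · rw [indicator_of_mem h]
          have := abs_theta_sub_id_le (zero_le_one.trans (le_of_lt hx))
          rw [one_mul] at this
          exact this.trans h
        · rw [indicator_of_notMem h, abs_zero]
          linarith) (by linarith : (0 : ℝ) < s.re)
    exact ⟨this.1, this.2.differentiableAt⟩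
  set D := fun s : ℂ ↦ ∫ x in Ioi (1 : ℝ),
    ((Chebyshev.psi x - Chebyshev.theta x : ℝ) : ℂ) * (x : ℂ) ^ (-s - 1) with hDdef
  set I := fun s : ℂ ↦ ∫ x in Ioi (1 : ℝ),
    (((Iic x₀).indicator E x : ℝ) : ℂ) * (x : ℂ) ^ (-s - 1) with hIdef
  have hEb : ∀ x > (1 : ℝ), |E x| ≤ 1 * x := fun x hx ↦
    abs_theta_sub_id_le (zero_le_one.trans (le_of_lt hx))
  have hsplit : ∀ s : ℂ, 1 < s.re → ∫ x in Ioi (1 : ℝ), (E x : ℂ) * (x : ℂ) ^ (-s - 1) =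
      I s + ∫ x in Ioi x₀, (E x : ℂ) * (x : ℂ) ^ (-s - 1) := by
    intro s hs
    have hint := (integrableOn_mul_cpow_and_hasDerivAt_integral one_pos (a := 1) (C := 1)
      (f := fun x ↦ (E x : ℂ)) (Complex.measurable_ofReal.comp hEm).aestronglyMeasurable
      (fun x hx ↦ by
        rw [Complex.norm_real, Real.norm_eq_abs, Real.rpow_one]; exact hEb x hx) hs).1
    rw [← Ioc_union_Ioi_eq_Ioi hx₀.le, setIntegral_union (Ioc_disjoint_Ioi le_rfl)
      measurableSet_Ioi (hint.mono_set Ioc_subset_Ioi_self)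
      (hint.mono_set (Ioi_subset_Ioi hx₀.le))]
    congr 1
    simp only [hIdef]
    rw [← Ioi_inter_Iic, ← setIntegral_indicator measurableSet_Iic]
    refine setIntegral_congr_fun measurableSet_Ioi fun x _ ↦ ?_
    by_cases h : x ∈ Iic x₀ <;> simp [indicator, h]
  have hmain : ∀ s : ℂ, 1 < s.re →
      riemannZeta₁ s * s * ∫ x in Ioi x₀, (E x : ℂ) * (x : ℂ) ^ (-s - 1) =
      -(riemannZeta₁ s * (1 + s * D s + s * I s) + deriv riemannZeta₁ s) := by
    intro s hs
    have hs1 : s ≠ 1 := by rintro rfl; simp at hs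
    have hs1' : s - 1 ≠ 0 := sub_ne_zero.2 hs1
    have hZ0 : riemannZeta₁ s ≠ 0 := by
      have h2 := riemannZeta_ne_zero_of_one_le_re hs.le
      rw [riemannZeta_eq_inv_sub_mul hs1] at h2
      exact right_ne_zero_of_mul h2
    have h1 := mul_integral_psi_mul_cpow hs
    rw [neg_deriv_riemannZeta_div hs] at h1
    obtain ⟨i2, e2⟩ := integral_Ioi_one_mul_cpow hs
    have i1 : IntegrableOn (fun x : ℝ ↦ (Chebyshev.psi x : ℂ) * (x : ℂ) ^ (-s - 1)) (Ioi 1) := by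
      refine (integrableOn_mul_cpow_and_hasDerivAt_integral one_pos (a := 1) (C := Real.log 4 + 4)
        (f := fun x ↦ (Chebyshev.psi x : ℂ))
        (Complex.measurable_ofReal.comp hpsm).aestronglyMeasurable (fun x hx ↦ ?_) hs).1
      rw [Complex.norm_real, Real.norm_of_nonneg (Chebyshev.psi_nonneg x), Real.rpow_one]
      exact Chebyshev.psi_le_const_mul_self (zero_le_one.trans (le_of_lt hx))
    have i3 := (hD s (by linarith)).1
    have h2 : ∫ x in Ioi (1 : ℝ), (E x : ℂ) * (x : ℂ) ^ (-s - 1) =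
        (∫ x in Ioi (1 : ℝ), (Chebyshev.psi x : ℂ) * (x : ℂ) ^ (-s - 1)) - 1 / (s - 1) - D s := by
      have i12 := i1.sub i2
      rw [← e2, ← integral_sub i1 i2]
      refine Eq.trans ?_ (integral_sub i12 i3)
      refine setIntegral_congr_fun measurableSet_Ioi fun x _ ↦ ?_
      simp only [hE]
      push_cast
      ring
    have h3 := hsplit s hs
    rw [h2] at h3
    have h4 : ∫ x in Ioi x₀, (E x : ℂ) * (x : ℂ) ^ (-s - 1) =
        (∫ x in Ioi (1 : ℝ), (Chebyshev.psi x : ℂ) * (x : ℂ) ^ (-s - 1)) - 1 / (s - 1) - D s -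
          I s := by rw [h3]; ring
    have h5 : s * ∫ x in Ioi x₀, (E x : ℂ) * (x : ℂ) ^ (-s - 1) =
        -1 - deriv riemannZeta₁ s / riemannZeta₁ s - s * D s - s * I s := by
      rw [h4, mul_sub, mul_sub, mul_sub, h1]
      field_simp
      ring
    rw [mul_assoc, h5]
    field_simp
    ring
  have hDd : DifferentiableOn ℂ D {z | 1 / 2 < z.re} :=
    fun s hs ↦ (hD s hs).2.differentiableWithinAt
  have hId : DifferentiableOn ℂ I {z | 1 / 2 < z.re} :=
    fun s hs ↦ (hI s hs).2.differentiableWithinAt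
  have hZd := differentiable_riemannZeta₁.differentiableOn (s := {z : ℂ | 1 / 2 < z.re})
  have hpre : DifferentiableOn ℂ (fun s ↦ 1 + s * D s + s * I s) {z | 1 / 2 < z.re} :=
    ((differentiableOn_const 1).add (differentiableOn_id.mul hDd)).add (differentiableOn_id.mul hId)
  obtain ⟨F, hF, hFeq⟩ := exists_differentiableOn_eqOn_integral_of_forall_nonneg hx₀ hEm
    (fun x hx ↦ hEb x (hx₀.trans hx)) hpos (((hZd.mul hpre).add (hZd.deriv hopen)).neg)
    (hZd.mul differentiableOn_id)
    (fun t ht ↦ mul_ne_zero (riemannZeta₁_ofReal_ne_zero (by linarith))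
      (Complex.ofReal_ne_zero.2 (by linarith))) hmain
  have hG : DifferentiableOn ℂ (fun s ↦ -(1 + s * D s + s * I s + s * F s)) {z | 1 / 2 < z.re} :=
    (hpre.add (differentiableOn_id.mul hF)).neg
  have hext : EqOn (deriv riemannZeta₁)
      (fun s ↦ riemannZeta₁ s * -(1 + s * D s + s * I s + s * F s)) {z | 1 / 2 < z.re} := by
    refine AnalyticOnNhd.eqOn_of_preconnected_of_eventuallyEq (z₀ := 2)
      ((hZd.deriv hopen).analyticOnNhd hopen) ((hZd.mul hG).analyticOnNhd hopen)
      (isPreconnected_re_gt _) (by norm_num) ?_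
    filter_upwards [(isOpen_re_gt 1).mem_nhds (show (2 : ℂ) ∈ {z : ℂ | 1 < z.re} by simp)]
      with s hs
    have := hmain s hs
    rw [← hFeq s hs] at this
    linear_combination this
  exact ne_zero_of_deriv_eq_mul hopen (isPreconnected_re_gt _) hZd hG hext (a := 1)
    (by norm_num) (by simp) z hz

end ZeroFree

section ZeroSum

open Set Metric Topology

/-- A holomorphic function without zeros on a disc is a constant times an exponential. -/
theorem exists_exp_eq_div_of_ne_zero {f : ℂ → ℂ} {c : ℂ} {r : ℝ} (hr : 0 < r)
    (hf : DifferentiableOn ℂ f (ball c r)) (h0 : ∀ z ∈ ball c r, f z ≠ 0) :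
    ∃ l : ℂ → ℂ, l c = 0 ∧ ∀ z ∈ ball c r,
      HasDerivAt l (logDeriv f z) z ∧ f z = f c * Complex.exp (l z) := by
  have hG : DifferentiableOn ℂ (logDeriv f) (ball c r) := (hf.deriv isOpen_ball).div hf h0
  obtain ⟨Φ, hΦ⟩ := hG.isExactOn_ball
  have hd : ∀ w ∈ ball c r, HasDerivAt (fun w ↦ f w * Complex.exp (-Φ w)) 0 w := by
    intro w hw
    have h1 := (hf.differentiableAt (isOpen_ball.mem_nhds hw)).hasDerivAt
    refine (h1.mul (hΦ w hw).neg.cexp).congr_deriv ?_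
    rw [logDeriv_apply]
    have := h0 w hw
    field_simp
    ring
  refine ⟨fun z ↦ Φ z - Φ c, sub_self _, fun z hz ↦ ⟨(hΦ z hz).sub_const _, ?_⟩⟩
  have := (convex_ball c r).is_const_of_fderivWithin_eq_zero (𝕜 := ℂ)
    (f := fun w ↦ f w * Complex.exp (-Φ w))
    (fun w hw ↦ (hd w hw).differentiableAt.differentiableWithinAt)
    (fun w hw ↦ by
      rw [fderivWithin_of_isOpen isOpen_ball hw]
      ext
      simpa using (hd w hw).deriv) hz (mem_ball_self hr)
  beta_reduce at this ⊢
  rw [sub_eq_add_neg, add_comm, Complex.exp_add, ← mul_assoc, ← this, mul_assoc, ← Complex.exp_add]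
  simp

theorem norm_logDeriv_sub_logDeriv_le {f : ℂ → ℂ} {c : ℂ} {r M : ℝ} (hr : 0 < r) (hM : 0 < M)
    (hf : DifferentiableOn ℂ f (ball c r)) (h0 : ∀ z ∈ ball c r, f z ≠ 0)
    (hb : ∀ z ∈ ball c r, ‖f z‖ ≤ ‖f c‖ * Real.exp M) {z w : ℂ} (hz : z ∈ ball c (r / 4))
    (hw : w ∈ ball c (r / 4)) :
    ‖logDeriv f z - logDeriv f w‖ ≤ 64 * M / r ^ 2 * ‖z - w‖ := by
  obtain ⟨l, hlc, hl⟩ := exists_exp_eq_div_of_ne_zero hr hf h0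
  have hre : ∀ z ∈ ball c r, (l z).re ≤ M := by
    intro z hz
    have h1 := hb z hz
    rw [(hl z hz).2, norm_mul, Complex.norm_exp] at h1
    have h2 : 0 < ‖f c‖ := norm_pos_iff.2 (h0 c (mem_ball_self hr))
    exact Real.exp_le_exp.1 (le_of_mul_le_mul_left h1 h2)
  have hld : DifferentiableOn ℂ l (ball c r) :=
    fun z hz ↦ (hl z hz).1.differentiableAt.differentiableWithinAt
  have hlb : ∀ z ∈ closedBall c (r / 2), ‖l z‖ ≤ 2 * M := by
    intro z hz
    have hz' : ‖z - c‖ ≤ r / 2 := mem_closedBall_iff_norm.1 hz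
    have := Complex.borelCaratheodory_zero (f := fun z ↦ l (c + z)) (z := z - c) (R := r) hM ?_ ?_ hr
      ?_ ?_
    · rw [add_sub_cancel] at this
      refine this.trans ?_
      rw [div_le_iff₀ (by linarith)]
      nlinarith
    · refine hld.comp (by fun_prop) fun z hz ↦ ?_
      simpa using hz
    · intro z hz
      exact hre _ (by simpa using hz)
    · simp only [mem_ball, dist_zero_right]; linarith
    · simpa using hlc
  have hLd : ∀ z ∈ ball c r, deriv l z = logDeriv f z := fun z hz ↦ (hl z hz).1.deriv
  have hderiv : ∀ z ∈ ball c (r / 4), ‖deriv (logDeriv f) z‖ ≤ 64 * M / r ^ 2 := by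
    intro z hz
    rw [mem_ball] at hz
    have hsub : closedBall z (r / 4) ⊆ closedBall c (r / 2) := by
      apply closedBall_subset_closedBall'
      linarith
    have hsub' : closedBall c (r / 2) ⊆ ball c r := closedBall_subset_ball (by linarith)
    have h1 := Complex.norm_iteratedDeriv_le_of_forall_mem_sphere_norm_le (f := l) (c := z) 2
      (R := r / 4) (C := 2 * M) (by linarith)
      ((hld.mono (hsub.trans hsub')).diffContOnCl_ball subset_rfl)
      fun w hw ↦ hlb w (hsub (sphere_subset_closedBall hw))
    have h2 : iteratedDeriv 2 l z = deriv (logDeriv f) z := by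
      rw [iteratedDeriv_succ, iteratedDeriv_one]
      apply EventuallyEq.deriv_eq
      filter_upwards [isOpen_ball.mem_nhds (hsub' (hsub (mem_closedBall_self (by linarith))))] with w hw
      exact hLd w hw
    rw [h2] at h1
    refine h1.trans (le_of_eq ?_)
    norm_num [Nat.factorial]
    field_simp
    norm_num
  have hG : DifferentiableOn ℂ (logDeriv f) (ball c r) := (hf.deriv isOpen_ball).div hf h0
  exact (convex_ball c (r / 4)).norm_image_sub_le_of_norm_deriv_le
    (fun x hx ↦ hG.differentiableAt (isOpen_ball.mem_nhds (ball_subset_ball (by linarith) hx)))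
    hderiv hw hz

/-- Splitting off finitely many zeros of an entire function. -/
theorem exists_eq_prod_mul_of_finset {f : ℂ → ℂ} (hf : Differentiable ℂ f)
    (hord : ∀ z, analyticOrderAt f z ≠ ⊤) (S : Finset ℂ) :
    ∃ h : ℂ → ℂ, Differentiable ℂ h ∧
      (∀ z, f z = (∏ ρ ∈ S, (z - ρ) ^ analyticOrderNatAt f ρ) * h z) ∧ ∀ ρ ∈ S, h ρ ≠ 0 := by
  induction S using Finset.induction_on with
  | empty => exact ⟨f, hf, by simp, by simp⟩
  | insert a S ha ih =>
    obtain ⟨h, hd, hfac, hne⟩ := ih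
    set P : ℂ → ℂ := fun z ↦ ∏ ρ ∈ S, (z - ρ) ^ analyticOrderNatAt f ρ with hP
    have hPd : Differentiable ℂ P := by fun_prop
    have hPa : P a ≠ 0 := by
      simp only [hP, Finset.prod_ne_zero_iff]
      intro ρ hρ
      exact pow_ne_zero _ (sub_ne_zero.2 fun h ↦ ha (h ▸ hρ))
    have hoa : analyticOrderAt h a = analyticOrderNatAt f a := by
      rw [Nat.cast_analyticOrderNatAt (hord a)]
      have : f = P * h := funext hfac
      rw [this, analyticOrderAt_mul (hPd.analyticAt a) (hd.analyticAt a),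
        (hPd.analyticAt a).analyticOrderAt_eq_zero.2 hPa, zero_add]
    set n := analyticOrderNatAt f a with hn
    obtain ⟨g, hg, hga, hhg⟩ := ((hd.analyticAt a).analyticOrderAt_eq_natCast).1 hoa
    set h' : ℂ → ℂ := fun z ↦ if z = a then g a else h z / (z - a) ^ n with hh'
    have heq : ∀ z, h z = (z - a) ^ n * h' z := by
      intro z
      by_cases hz : z = a
      · subst hz
        simpa [hh'] using hhg.self_of_nhds
      · have := pow_ne_zero n (sub_ne_zero.2 hz)
        simp only [hh', if_neg hz]
        field_simp
    refine ⟨h', fun z ↦ ?_, fun z ↦ ?_, ?_⟩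
    · by_cases hz : z = a
      · subst hz
        refine hg.differentiableAt.congr_of_eventuallyEq ?_
        filter_upwards [hhg] with w hw
        by_cases hwz : w = z
        · simp [hh', hwz]
        · have := pow_ne_zero n (sub_ne_zero.2 hwz)
          simp only [hh', if_neg hwz, hw, smul_eq_mul]
          field_simp
      · have h1 : DifferentiableAt ℂ (fun z ↦ h z / (z - a) ^ n) z :=
          (hd z).div (by fun_prop) (pow_ne_zero n (sub_ne_zero.2 hz))
        refine h1.congr_of_eventuallyEq ?_
        filter_upwards [isOpen_ne.mem_nhds hz] with w hw
        simp only [hh', if_neg hw]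
    · rw [Finset.prod_insert ha, hfac, heq]
      ring
    · intro ρ hρ
      rcases Finset.mem_insert.1 hρ with rfl | hρ
      · simpa [hh'] using hga
      · have := hne ρ hρ
        rw [heq] at this
        exact right_ne_zero_of_mul this

end ZeroSum

section ZeroSum

open Set Metric Topology

theorem finite_zeros_inter_closedBall {f : ℂ → ℂ} (hf : Differentiable ℂ f) {a : ℂ} (ha : f a ≠ 0)
    (R : ℝ) : (closedBall 0 R ∩ {z | f z = 0}).Finite := by
  have h := (hf.differentiableOn.analyticOnNhd isOpen_univ).preimage_zero_mem_codiscreteWithin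
    (x := a) ha (mem_univ _) isConnected_univ
  have h2 := mem_codiscrete'.1 (show _ ∈ codiscrete ℂ from h)
  have h3 : {z | f z = 0} = (f ⁻¹' {0}ᶜ)ᶜ := by ext; simp
  rw [h3]
  refine ((isCompact_closedBall 0 R).inter_right h2.1.isClosed_compl).finite ?_
  exact h2.2.mono inter_subset_right

theorem analyticOrderAt_ne_top_of_differentiable {f : ℂ → ℂ} (hf : Differentiable ℂ f) {a : ℂ}
    (ha : f a ≠ 0) (z : ℂ) : analyticOrderAt f z ≠ ⊤ := by
  intro h
  rw [analyticOrderAt_eq_top] at h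
  exact ha ((hf.differentiableOn.analyticOnNhd isOpen_univ).eqOn_zero_of_preconnected_of_eventuallyEq_zero
    isPreconnected_univ (mem_univ z) h (mem_univ a))

theorem analyticOrderNatAt_eq_zero_of_ne_zero {f : ℂ → ℂ} {z : ℂ} (hz : f z ≠ 0) :
    analyticOrderNatAt f z = 0 := by
  by_contra h
  exact hz (apply_eq_zero_of_analyticOrderNatAt_ne_zero h)

theorem logDeriv_prod_pow_mul {S : Finset ℂ} {n : ℂ → ℕ} {h : ℂ → ℂ} {z : ℂ}
    (hS : ∀ ρ ∈ S, z ≠ ρ) (hz : h z ≠ 0) (hd : DifferentiableAt ℂ h z) :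
    logDeriv (fun z ↦ (∏ ρ ∈ S, (z - ρ) ^ n ρ) * h z) z
      = ∑ ρ ∈ S, n ρ / (z - ρ) + logDeriv h z := by
  have hne : ∀ ρ ∈ S, (z - ρ) ^ n ρ ≠ 0 := fun ρ hρ ↦ pow_ne_zero _ (sub_ne_zero.2 (hS ρ hρ))
  rw [logDeriv_mul (f := fun z ↦ ∏ ρ ∈ S, (z - ρ) ^ n ρ) z (Finset.prod_ne_zero_iff.2 hne) hz
      (by fun_prop) hd,
    logDeriv_prod hne (by fun_prop)]
  congr 1
  refine Finset.sum_congr rfl fun ρ hρ ↦ ?_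
  have h1 : logDeriv (fun z ↦ (z - ρ) ^ n ρ) z = n ρ * logDeriv (fun z ↦ z - ρ) z :=
    logDeriv_fun_pow (by fun_prop) _
  rw [h1, logDeriv_apply]
  simp [div_eq_mul_inv]

theorem abs_re_logDeriv_sub_sum_le {f : ℂ → ℂ} (hf : Differentiable ℂ f) (heven : ∀ z, f (-z) = f z)
    {C : ℝ} (hC0 : 0 < C)
    (hC : ∀ R ≥ 1, ∀ z, ‖z‖ ≤ R → ‖f z‖ ≤ Real.exp (C * R ^ (3 / 2 : ℝ)))
    (hhalf : f (1 / 2) = 1) (hre : ∀ z, f z = 0 → z.re = 0) {w : ℝ} (hw : 0 < w) {R : ℝ}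
    (hR : 8 * (w + 1) ≤ R) {S : Finset ℂ} (hS : ∀ ρ, ρ ∈ S ↔ ‖ρ‖ ≤ R ∧ f ρ = 0) :
    |(logDeriv f w).re - ∑ ρ ∈ S, analyticOrderNatAt f ρ * (w / (w ^ 2 + ρ.im ^ 2))|
      ≤ 2048 * w * C * R ^ (-(1 / 2) : ℝ) := by
  have hR0 : 0 < R := by linarith
  have hhalf' : f (1 / 2) ≠ 0 := by rw [hhalf]; exact one_ne_zero
  obtain ⟨h, hd, hfac, hne⟩ := exists_eq_prod_mul_of_finset hf
    (analyticOrderAt_ne_top_of_differentiable hf hhalf') S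
  set M : ℝ := C * (4 * R) ^ (3 / 2 : ℝ) with hM
  have hMpos : 0 < M := by positivity
  have hfacn : ∀ z, ‖f z‖ = (∏ ρ ∈ S, ‖z - ρ‖ ^ analyticOrderNatAt f ρ) * ‖h z‖ := by
    intro z
    rw [hfac z]
    simp [norm_prod]
  have hbs : ∀ z ∈ sphere (0 : ℂ) (4 * R), ‖h z‖ ≤ ‖h (1 / 2)‖ * Real.exp M := by
    intro z hz
    have hz' : ‖z‖ = 4 * R := by simpa using hz
    have h1 := hC (4 * R) (by linarith) z hz'.le
    have h2 := hfacn (1 / 2)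
    rw [hhalf, norm_one] at h2
    rw [hfacn] at h1
    have h3 : ∏ ρ ∈ S, ‖1 / 2 - ρ‖ ^ analyticOrderNatAt f ρ
        ≤ ∏ ρ ∈ S, ‖z - ρ‖ ^ analyticOrderNatAt f ρ := by
      refine Finset.prod_le_prod (fun _ _ ↦ by positivity) fun ρ hρ ↦ ?_
      have h4 := ((hS ρ).1 hρ).1
      have h5 : ‖1 / 2 - ρ‖ ≤ 1 / 2 + ‖ρ‖ := by
        refine (norm_sub_le _ _).trans ?_
        norm_num
      have h6 : ‖z‖ - ‖ρ‖ ≤ ‖z - ρ‖ := norm_sub_norm_le _ _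
      gcongr
      linarith
    calc ‖h z‖ = ‖h (1 / 2)‖ * ((∏ ρ ∈ S, ‖1 / 2 - ρ‖ ^ analyticOrderNatAt f ρ) * ‖h z‖) := by
          linear_combination ‖h z‖ * h2
      _ ≤ ‖h (1 / 2)‖ * ((∏ ρ ∈ S, ‖z - ρ‖ ^ analyticOrderNatAt f ρ) * ‖h z‖) := by gcongr
      _ ≤ ‖h (1 / 2)‖ * Real.exp M := by gcongr
  have hbb : ∀ z ∈ ball (1 / 2 : ℂ) (R / 2), ‖h z‖ ≤ ‖h (1 / 2)‖ * Real.exp M := by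
    intro z hz
    refine Complex.norm_le_of_forall_mem_frontier_norm_le (isBounded_ball (x := (0 : ℂ)) (r := 4 * R))
      (hd.differentiableOn.diffContOnCl_ball (subset_univ _)) (fun z hz ↦ ?_) (subset_closure ?_)
    · exact hbs z (frontier_ball_subset_sphere hz)
    · rw [mem_ball_iff_norm] at hz
      have h1 : ‖z‖ ≤ ‖z - 1 / 2‖ + ‖(1 / 2 : ℂ)‖ := by simpa using norm_add_le (z - 1 / 2) (1 / 2)
      norm_num at h1
      rw [mem_ball_zero_iff]
      norm_num at hz
      linarith
  have hn0 : ∀ z ∈ ball (1 / 2 : ℂ) (R / 2), h z ≠ 0 := by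
    intro z hz hz0
    have h2 : f z = 0 := by rw [hfac, hz0, mul_zero]
    refine hne z ((hS z).2 ⟨?_, h2⟩) hz0
    rw [mem_ball_iff_norm] at hz
    have h1 : ‖z‖ ≤ ‖z - 1 / 2‖ + ‖(1 / 2 : ℂ)‖ := by simpa using norm_add_le (z - 1 / 2) (1 / 2)
    norm_num at h1 hz
    linarith
  have hm1 : (w : ℂ) ∈ ball (1 / 2 : ℂ) (R / 2 / 4) := by
    rw [mem_ball_iff_norm, show (w : ℂ) - 1 / 2 = ((w - 1 / 2 : ℝ) : ℂ) by push_cast; ring,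
      Complex.norm_real, Real.norm_eq_abs, abs_lt]
    constructor <;> linarith
  have hm2 : (-w : ℂ) ∈ ball (1 / 2 : ℂ) (R / 2 / 4) := by
    rw [mem_ball_iff_norm, show (-w : ℂ) - 1 / 2 = ((-w - 1 / 2 : ℝ) : ℂ) by push_cast; ring,
      Complex.norm_real, Real.norm_eq_abs, abs_lt]
    constructor <;> linarith
  have hL := norm_logDeriv_sub_logDeriv_le (by positivity) hMpos hd.differentiableOn hn0 hbb hm1 hm2
  have hsub : ball (1 / 2 : ℂ) (R / 2 / 4) ⊆ ball (1 / 2 : ℂ) (R / 2) :=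
    ball_subset_ball (by linarith)
  have hSre : ∀ ρ ∈ S, ρ.re = 0 := fun ρ hρ ↦ hre ρ ((hS ρ).1 hρ).2
  have hwn : ∀ ρ ∈ S, (w : ℂ) ≠ ρ := by
    rintro ρ hρ rfl
    have := hSre _ hρ
    simp only [Complex.ofReal_re] at this
    linarith
  have hwn' : ∀ ρ ∈ S, (-w : ℂ) ≠ ρ := by
    rintro ρ hρ rfl
    have := hSre _ hρ
    simp only [Complex.neg_re, Complex.ofReal_re] at this
    linarith
  have hl1 : logDeriv f w = ∑ ρ ∈ S, analyticOrderNatAt f ρ / (w - ρ) + logDeriv h w := by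
    conv_lhs => rw [funext hfac]
    exact logDeriv_prod_pow_mul hwn (hn0 _ (hsub hm1)) (hd _)
  have hl2 : logDeriv f (-w) = ∑ ρ ∈ S, analyticOrderNatAt f ρ / (-w - ρ) + logDeriv h (-w) := by
    conv_lhs => rw [funext hfac]
    exact logDeriv_prod_pow_mul hwn' (hn0 _ (hsub hm2)) (hd _)
  have hodd : logDeriv f (-w) = -logDeriv f w := by
    rw [logDeriv_apply, logDeriv_apply, heven]
    have : deriv f (-w) = -deriv f w := by
      have h1 := deriv_comp_neg f (-(w : ℂ))
      rw [neg_neg, show (fun x ↦ f (-x)) = f from funext heven] at h1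
      exact h1
    rw [this, neg_div]
  have hr1 : (∑ ρ ∈ S, (analyticOrderNatAt f ρ : ℂ) / (w - ρ)).re
      = ∑ ρ ∈ S, analyticOrderNatAt f ρ * (w / (w ^ 2 + ρ.im ^ 2)) := by
    rw [Complex.re_sum]
    refine Finset.sum_congr rfl fun ρ hρ ↦ ?_
    rw [div_eq_mul_inv, ← Complex.ofReal_natCast, Complex.re_ofReal_mul, Complex.inv_re, Complex.normSq_apply]
    simp [hSre ρ hρ, sq]
  have hr2 : (∑ ρ ∈ S, (analyticOrderNatAt f ρ : ℂ) / (-w - ρ)).re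
      = -∑ ρ ∈ S, analyticOrderNatAt f ρ * (w / (w ^ 2 + ρ.im ^ 2)) := by
    rw [Complex.re_sum, ← Finset.sum_neg_distrib]
    refine Finset.sum_congr rfl fun ρ hρ ↦ ?_
    rw [div_eq_mul_inv, ← Complex.ofReal_natCast, Complex.re_ofReal_mul, Complex.inv_re, Complex.normSq_apply]
    simp [hSre ρ hρ, sq, neg_div]
  have hkey : (logDeriv f w).re - ∑ ρ ∈ S, analyticOrderNatAt f ρ * (w / (w ^ 2 + ρ.im ^ 2))
      = (logDeriv h w - logDeriv h (-w)).re / 2 := by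
    have h1 := congrArg Complex.re hl1
    have h2 := congrArg Complex.re (hodd.symm.trans hl2)
    rw [Complex.add_re, hr1] at h1
    rw [Complex.add_re, hr2, Complex.neg_re] at h2
    rw [Complex.sub_re]
    linarith
  rw [hkey, abs_div, abs_of_pos (two_pos : (0 : ℝ) < 2), div_le_iff₀ two_pos]
  refine (Complex.abs_re_le_norm _).trans (hL.trans (le_of_eq ?_))
  have h1 : ‖(w : ℂ) - -w‖ = 2 * w := by
    rw [show (w : ℂ) - -w = ((2 * w : ℝ) : ℂ) by push_cast; ring, Complex.norm_real,
      Real.norm_eq_abs, abs_of_pos (by linarith)]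
  have h2 : (4 * R) ^ (3 / 2 : ℝ) = 8 * (R ^ (-(1 / 2) : ℝ) * R ^ 2) := by
    rw [Real.mul_rpow (by norm_num) hR0.le, ← Real.rpow_natCast R 2, ← Real.rpow_add hR0,
      show (4 : ℝ) = 2 ^ (2 : ℝ) by norm_num, ← Real.rpow_mul (by norm_num)]
    norm_num
  rw [h1, hM, h2]
  field_simp
  ring

/-- The partial fraction expansion of the logarithmic derivative of an even entire function of
order at most `3 / 2` all of whose zeros are purely imaginary. -/
theorem hasSum_analyticOrderNatAt_mul {f : ℂ → ℂ} (hf : Differentiable ℂ f)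
    (heven : ∀ z, f (-z) = f z) {C : ℝ}
    (hC : ∀ R ≥ 1, ∀ z, ‖z‖ ≤ R → ‖f z‖ ≤ Real.exp (C * R ^ (3 / 2 : ℝ)))
    (hhalf : f (1 / 2) = 1) (hre : ∀ z, f z = 0 → z.re = 0) {w : ℝ} (hw : 0 < w) :
    HasSum (fun ρ : ℂ ↦ analyticOrderNatAt f ρ * (w / (w ^ 2 + ρ.im ^ 2))) (logDeriv f w).re := by
  wlog hC0 : 0 < C generalizing C
  · refine this (C := |C| + 1) (fun R hR z hz ↦ (hC R hR z hz).trans ?_) (by positivity)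
    gcongr
    linarith [le_abs_self C]
  have hhalf' : f (1 / 2) ≠ 0 := by rw [hhalf]; exact one_ne_zero
  set g : ℂ → ℝ := fun ρ ↦ analyticOrderNatAt f ρ * (w / (w ^ 2 + ρ.im ^ 2)) with hg
  have hg0 : ∀ ρ, 0 ≤ g ρ := fun ρ ↦ by positivity
  set S : ℝ → Finset ℂ := fun R ↦ (finite_zeros_inter_closedBall hf hhalf' R).toFinset with hSdef
  have hS : ∀ R ρ, ρ ∈ S R ↔ ‖ρ‖ ≤ R ∧ f ρ = 0 := fun R ρ ↦ by simp [hSdef]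
  have hlim : Tendsto (fun R ↦ ∑ ρ ∈ S R, g ρ) atTop (𝓝 (logDeriv f w).re) := by
    have h0 : Tendsto (fun R : ℝ ↦ 2048 * w * C * R ^ (-(1 / 2) : ℝ)) atTop (𝓝 0) := by
      simpa using (tendsto_rpow_neg_atTop (by norm_num : (0 : ℝ) < 1 / 2)).const_mul (2048 * w * C)
    rw [tendsto_iff_norm_sub_tendsto_zero]
    refine squeeze_zero' (Eventually.of_forall fun _ ↦ norm_nonneg _) ?_ h0
    filter_upwards [eventually_ge_atTop (8 * (w + 1))] with R hR
    rw [norm_sub_rev]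
    exact abs_re_logDeriv_sub_sum_le hf heven hC0 hC hhalf hre hw hR (hS R)
  refine hasSum_of_isLUB_of_nonneg _ hg0 ⟨?_, ?_⟩
  · rintro _ ⟨F, rfl⟩
    refine ge_of_tendsto hlim ?_
    have hb : ∃ B, ∀ ρ ∈ F, ‖ρ‖ ≤ B := by
      obtain ⟨B, hB⟩ := F.finite_toSet.isBounded.exists_norm_le
      exact ⟨B, hB⟩
    obtain ⟨B, hB⟩ := hb
    filter_upwards [eventually_ge_atTop B] with R hR
    rw [← Finset.sum_filter_ne_zero F]
    refine Finset.sum_le_sum_of_subset_of_nonneg (fun ρ hρ ↦ ?_) fun ρ _ _ ↦ hg0 ρ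
    rw [Finset.mem_filter] at hρ
    refine (hS R ρ).2 ⟨(hB ρ hρ.1).trans hR, ?_⟩
    by_contra h
    exact hρ.2 (by simp [hg, analyticOrderNatAt_eq_zero_of_ne_zero h])
  · intro b hb
    exact le_of_tendsto hlim (Eventually.of_forall fun R ↦ hb ⟨S R, rfl⟩)

end ZeroSum

section Xi

open Set Metric Topology MeasureTheory

theorem norm_Gamma_le_Gamma_re {s : ℂ} (hs : 0 < s.re) : ‖Complex.Gamma s‖ ≤ Real.Gamma s.re := by
  rw [Complex.Gamma_eq_integral hs, Real.Gamma_eq_integral hs, Complex.GammaIntegral]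
  refine (norm_integral_le_integral_norm _).trans (le_of_eq ?_)
  refine setIntegral_congr_fun measurableSet_Ioi fun x hx ↦ ?_
  simp [Complex.norm_cpow_eq_rpow_re_of_pos (mem_Ioi.1 hx), Complex.norm_exp]

theorem Gamma_le_exp_of_le {x R : ℝ} (hR : 1 ≤ R) (hx : 1 / 4 ≤ x) (hxR : x ≤ R) :
    Real.Gamma x ≤ 4 * Real.exp (2 * (3 * R) ^ (3 / 2 : ℝ)) := by
  have hx0 : 0 < x := by linarith
  have h1 : Real.Gamma (x + 2) = x * (x + 1) * Real.Gamma x := by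
    rw [show x + 2 = (x + 1) + 1 by ring, Real.Gamma_add_one (by linarith),
      Real.Gamma_add_one hx0.ne']
    ring
  have hG : 0 < Real.Gamma x := Real.Gamma_pos_of_pos hx0
  have h2 : Real.Gamma x ≤ 4 * Real.Gamma (x + 2) := by
    rw [h1]
    nlinarith [mul_pos hx0 hG]
  set k : ℕ := ⌈x⌉₊ + 1 with hk
  have hkR : (k : ℝ) ≤ 3 * R := by
    have := Nat.ceil_lt_add_one hx0.le
    rw [hk]; push_cast; linarith
  have h3 : Real.Gamma (x + 2) ≤ k.factorial := by
    rw [← Real.Gamma_nat_eq_factorial]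
    refine Real.Gamma_strictMonoOn_Ici.monotoneOn ?_ ?_ ?_
    · rw [mem_Ici]; linarith
    · rw [mem_Ici, hk]; push_cast; linarith [Nat.le_ceil x]
    · rw [hk]; push_cast; linarith [Nat.le_ceil x]
  have h4 : (k.factorial : ℝ) ≤ Real.exp (2 * (3 * R) ^ (3 / 2 : ℝ)) := by
    have hk0 : (0 : ℝ) < k := by rw [hk]; positivity
    have h5 : (k.factorial : ℝ) ≤ (k : ℝ) ^ (k : ℝ) := by
      rw [Real.rpow_natCast]
      exact_mod_cast Nat.factorial_le_pow k
    refine h5.trans ?_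
    rw [Real.rpow_def_of_pos hk0]
    refine Real.exp_le_exp.2 ?_
    have h6 := Real.log_le_rpow_div hk0.le (by norm_num : (0 : ℝ) < 1 / 2)
    calc Real.log k * k ≤ (k : ℝ) ^ (1 / 2 : ℝ) / (1 / 2) * k := by gcongr
      _ = 2 * (k : ℝ) ^ (3 / 2 : ℝ) := by
        rw [show (3 / 2 : ℝ) = 1 / 2 + 1 by norm_num, Real.rpow_add_one hk0.ne']
        ring
      _ ≤ 2 * (3 * R) ^ (3 / 2 : ℝ) := by gcongr
  linarith

theorem norm_integral_fract_mul_cpow_le {s : ℂ} (hs : 1 / 2 ≤ s.re) :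
    ‖∫ x in Ioi (1 : ℝ), ((Int.fract x : ℝ) : ℂ) * (x : ℂ) ^ (-s - 1)‖ ≤ 2 := by
  have h1 : IntegrableOn (fun x : ℝ ↦ x ^ (-(3 / 2) : ℝ)) (Ioi 1) :=
    integrableOn_Ioi_rpow_of_lt (by norm_num) one_pos
  have h2 : ∫ x in Ioi (1 : ℝ), x ^ (-(3 / 2) : ℝ) = 2 := by
    rw [integral_Ioi_rpow_of_lt (by norm_num) one_pos]
    norm_num
  rw [← h2]
  refine norm_integral_le_of_norm_le h1 ?_
  filter_upwards [ae_restrict_mem measurableSet_Ioi] with x hx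
  have hx1 : 1 < x := hx
  have hx0 : 0 < x := one_pos.trans hx1
  rw [norm_mul, Complex.norm_real, Complex.norm_cpow_eq_rpow_re_of_pos hx0, Real.norm_eq_abs,
    abs_of_nonneg (Int.fract_nonneg x), ← one_mul (x ^ (-(3 / 2) : ℝ))]
  refine mul_le_mul (Int.fract_lt_one x).le ?_ (by positivity) one_pos.le
  refine Real.rpow_le_rpow_of_exponent_le hx1.le ?_
  simp only [Complex.sub_re, Complex.neg_re, Complex.one_re]
  linarith

/-- Riemann's xi function, normalised to take the value `1` at `0` and `1`. -/
noncomputable def xi (s : ℂ) : ℂ := s * (s - 1) * completedRiemannZeta₀ s + 1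

theorem differentiable_xi : Differentiable ℂ xi := by
  have := differentiable_completedZeta₀
  unfold xi
  fun_prop

theorem xi_one_sub (s : ℂ) : xi (1 - s) = xi s := by
  rw [xi, xi, completedRiemannZeta₀_one_sub]
  ring

theorem xi_eq_mul_riemannZeta₁ {s : ℂ} (hs : 0 < s.re) :
    xi s = s * s.Gammaℝ * riemannZeta₁ s := by
  have h : ∀ s : ℂ, 0 < s.re → s ≠ 1 → xi s = s * s.Gammaℝ * riemannZeta₁ s := by
    intro s hs h1
    have h0 : s ≠ 0 := by rintro rfl; simp at hs
    have hG := Complex.Gammaℝ_ne_zero_of_re_pos hs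
    have h2 := riemannZeta_def_of_ne_zero h0
    have h3 : s - 1 ≠ 0 := sub_ne_zero.2 h1
    have h4 : 1 - s ≠ 0 := sub_ne_zero.2 h1.symm
    rw [riemannZeta_eq_inv_sub_mul h1, completedRiemannZeta_eq] at h2
    have h5 : riemannZeta₁ s
        = (s - 1) * ((completedRiemannZeta₀ s - 1 / s - 1 / (1 - s)) / s.Gammaℝ) := by
      rw [← h2, mul_inv_cancel_left₀ h3]
    rw [h5, xi]
    field_simp
    ring
  rcases eq_or_ne s 1 with rfl | h1
  · simp [xi, Complex.Gammaℝ_one]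
  · exact h s hs h1

theorem exists_norm_xi_half_add_le : ∃ C : ℝ, ∀ R ≥ 1, ∀ z : ℂ, ‖z‖ ≤ R →
    ‖xi (1 / 2 + z)‖ ≤ Real.exp (C * R ^ (3 / 2 : ℝ)) := by
  refine ⟨2 * 3 ^ (3 / 2 : ℝ) + 114, fun R hR ↦ ?_⟩
  have key : ∀ z : ℂ, 0 ≤ z.re → ‖z‖ ≤ R →
      ‖xi (1 / 2 + z)‖ ≤ Real.exp ((2 * 3 ^ (3 / 2 : ℝ) + 114) * R ^ (3 / 2 : ℝ)) := by
    intro z hz hzR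
    set s : ℂ := 1 / 2 + z with hs
    have hsre : s.re = 1 / 2 + z.re := by simp [hs]
    have hzre : z.re ≤ R := (Complex.re_le_norm z).trans hzR
    have hsn : ‖s‖ ≤ 2 * R := by
      refine (norm_add_le _ _).trans ?_
      norm_num
      linarith
    have hs1n : ‖s - 1‖ ≤ 3 * R := by
      refine (norm_sub_le _ _).trans ?_
      norm_num
      linarith
    have hG : ‖s.Gammaℝ‖ ≤ 4 * Real.exp (2 * (3 * R) ^ (3 / 2 : ℝ)) := by
      rw [Complex.Gammaℝ_def, norm_mul]
      have h1 : ‖(Real.pi : ℂ) ^ (-s / 2)‖ ≤ 1 := by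
        rw [Complex.norm_cpow_eq_rpow_re_of_pos Real.pi_pos]
        refine Real.rpow_le_one_of_one_le_of_nonpos (by linarith [Real.pi_gt_three]) ?_
        rw [← Complex.ofReal_ofNat, Complex.div_ofReal_re, Complex.neg_re, hsre]
        linarith
      have hs2 : (s / 2).re = s.re / 2 := by
        rw [← Complex.ofReal_ofNat, Complex.div_ofReal_re]
      have h2 : ‖Complex.Gamma (s / 2)‖ ≤ 4 * Real.exp (2 * (3 * R) ^ (3 / 2 : ℝ)) := by
        refine (norm_Gamma_le_Gamma_re (by rw [hs2, hsre]; linarith)).trans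
          (Gamma_le_exp_of_le hR ?_ ?_) <;> rw [hs2, hsre] <;> linarith
      calc _ ≤ 1 * (4 * Real.exp (2 * (3 * R) ^ (3 / 2 : ℝ))) := by gcongr
        _ = _ := one_mul _
    have hZ : ‖riemannZeta₁ s‖ ≤ 14 * R ^ 2 := by
      rw [riemannZeta₁_eq_sub_integral_fract (by rw [hsre]; linarith)]
      refine (norm_sub_le _ _).trans ?_
      rw [norm_mul, norm_mul]
      have h1 := norm_integral_fract_mul_cpow_le (s := s) (by rw [hsre]; linarith)
      calc _ ≤ 2 * R + 2 * R * (3 * R) * 2 := by gcongr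
        _ ≤ _ := by nlinarith
    rw [xi_eq_mul_riemannZeta₁ (by rw [hsre]; linarith), norm_mul, norm_mul]
    set y : ℝ := R ^ (3 / 2 : ℝ) with hy
    have hy1 : 1 ≤ y := Real.one_le_rpow hR (by norm_num)
    have hy2 : y ^ 2 = R ^ 3 := by
      rw [hy, ← Real.rpow_natCast, ← Real.rpow_mul (by linarith), ← Real.rpow_natCast]
      norm_num
    have h3 : (3 * R) ^ (3 / 2 : ℝ) = 3 ^ (3 / 2 : ℝ) * y :=
      Real.mul_rpow (by norm_num) (by linarith)
    have h4 : 112 * y ^ 2 ≤ Real.exp (114 * y) := by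
      have h5 : y ≤ Real.exp y := by linarith [Real.add_one_le_exp y]
      have h6 : 112 ≤ Real.exp (112 * y) := by linarith [Real.add_one_le_exp (112 * y)]
      calc 112 * y ^ 2 ≤ Real.exp (112 * y) * (Real.exp y) ^ 2 := by gcongr
        _ = _ := by rw [← Real.exp_nat_mul, ← Real.exp_add]; congr 1; push_cast; ring
    calc _ ≤ 2 * R * (4 * Real.exp (2 * (3 * R) ^ (3 / 2 : ℝ))) * (14 * R ^ 2) := by gcongr
      _ = 112 * y ^ 2 * Real.exp (2 * (3 * R) ^ (3 / 2 : ℝ)) := by rw [hy2]; ring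
      _ ≤ Real.exp (114 * y) * Real.exp (2 * (3 * R) ^ (3 / 2 : ℝ)) := by gcongr
      _ = _ := by rw [h3, ← Real.exp_add]; congr 1; ring
  intro z hz
  rcases le_total 0 z.re with h | h
  · exact key z h hz
  · have := key (-z) (by simpa using h) (by simpa using hz)
    rwa [show 1 / 2 + -z = 1 - (1 / 2 + z) by ring, xi_one_sub] at this

theorem re_eq_zero_of_xi_half_add_eq_zero
    (hRH : ∀ ρ : ℂ, riemannZeta ρ = 0 → 0 < ρ.re → ρ.re < 1 → ρ.re = 1 / 2) {z : ℂ}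
    (hz : xi (1 / 2 + z) = 0) : z.re = 0 := by
  have key : ∀ z : ℂ, 0 ≤ z.re → xi (1 / 2 + z) = 0 → z.re = 0 := by
    intro z hz0 hz
    set s : ℂ := 1 / 2 + z with hs
    have hsre : s.re = 1 / 2 + z.re := by simp [hs]
    have hs0 : 0 < s.re := by rw [hsre]; linarith
    rw [xi_eq_mul_riemannZeta₁ hs0] at hz
    have h1 : s ≠ 0 := by intro h; simp [h] at hs0
    have h2 : riemannZeta₁ s = 0 := by
      simpa [h1, Complex.Gammaℝ_ne_zero_of_re_pos hs0] using hz
    have h3 : s ≠ 1 := by rintro h; simp [h] at h2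
    have h4 : riemannZeta s = 0 := by rw [riemannZeta_eq_inv_sub_mul h3, h2, mul_zero]
    have h5 : s.re < 1 := by
      by_contra! h
      exact riemannZeta_ne_zero_of_one_le_re h h4
    have := hRH s h4 hs0 h5
    linarith
  rcases le_total 0 z.re with h | h
  · exact key z h hz
  · have := key (-z) (by simpa using h)
      (by rwa [show 1 / 2 + -z = 1 - (1 / 2 + z) by ring, xi_one_sub])
    simpa using this

theorem hasSum_logDeriv_xi
    (hRH : ∀ ρ : ℂ, riemannZeta ρ = 0 → 0 < ρ.re → ρ.re < 1 → ρ.re = 1 / 2) {w : ℝ} (hw : 0 < w) :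
    HasSum (fun ρ : ℂ ↦ analyticOrderNatAt (fun z ↦ xi (1 / 2 + z)) ρ * (w / (w ^ 2 + ρ.im ^ 2)))
      (logDeriv xi (1 / 2 + w)).re := by
  obtain ⟨C, hC⟩ := exists_norm_xi_half_add_le
  have h := hasSum_analyticOrderNatAt_mul (f := fun z ↦ xi (1 / 2 + z))
    (differentiable_xi.comp (by fun_prop)) (fun z ↦ ?_) hC ?_
    (fun z ↦ re_eq_zero_of_xi_half_add_eq_zero hRH) hw
  · convert h using 2
    rw [logDeriv_apply, logDeriv_apply, deriv_comp_const_add]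
  · rw [← xi_one_sub]
    congr 1
    ring
  · norm_num [xi]

/-- The sum of `1 / |ρ|²` over the nontrivial zeros, up to a factor of two. -/
theorem re_logDeriv_xi_one_lt : (logDeriv xi (1 / 2 + (1 / 2 : ℝ))).re < 1 / 12 := by
  have h1 : (1 / 2 : ℂ) + (1 / 2 : ℝ) = 1 := by push_cast; norm_num
  have h2 : logDeriv xi 1 = completedRiemannZeta₀ 1 := by
    have h3 : HasDerivAt xi (completedRiemannZeta₀ 1) 1 := by
      have h4 := differentiable_completedZeta₀.differentiableAt (x := 1) |>.hasDerivAt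
      refine ((((hasDerivAt_id (1 : ℂ)).mul ((hasDerivAt_id (1 : ℂ)).sub_const 1)).mul h4).add_const
        1).congr_deriv ?_
      simp
    rw [logDeriv_apply, h3.deriv]
    simp [xi]
  have hlog : 5 / 2 < Real.log (4 * Real.pi) := by
    rw [Real.lt_log_iff_exp_lt (by positivity)]
    have h5 := Real.exp_one_lt_d9
    have h6 := Real.pi_gt_d2
    have h7 : Real.exp (5 / 2) ^ 2 < (12.56 : ℝ) ^ 2 := by
      rw [← Real.exp_nat_mul, show ((2 : ℕ) : ℝ) * (5 / 2) = (5 : ℕ) * 1 by norm_num,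
        Real.exp_nat_mul]
      calc Real.exp 1 ^ 5 ≤ (2.7182818286 : ℝ) ^ 5 := by gcongr
        _ < _ := by norm_num
    have := lt_of_pow_lt_pow_left₀ 2 (by norm_num) h7
    linarith
  rw [h1, h2, completedRiemannZeta₀_one]
  have h8 : (((Real.eulerMascheroniConstant : ℂ) - Complex.log (4 * Real.pi)) / 2 + 1)
      = (((Real.eulerMascheroniConstant - Real.log (4 * Real.pi)) / 2 + 1 : ℝ) : ℂ) := by
    push_cast [Complex.ofReal_log (by positivity : 0 ≤ 4 * Real.pi)]
    rfl
  rw [h8, Complex.ofReal_re]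
  linarith [Real.eulerMascheroniConstant_lt_two_thirds]

end Xi

section Digamma

open Set Metric Topology MeasureTheory

theorem differentiableAt_log_comp_Gamma {x : ℝ} (hx : 0 < x) :
    DifferentiableAt ℝ (Real.log ∘ Real.Gamma) x :=
  (Real.differentiableAt_Gamma fun m ↦ ne_of_gt (by linarith [m.cast_nonneg (α := ℝ)])).log
    (Real.Gamma_pos_of_pos hx).ne'

theorem deriv_log_comp_Gamma_add_one {x : ℝ} (hx : 0 < x) :
    deriv (Real.log ∘ Real.Gamma) (x + 1) = deriv (Real.log ∘ Real.Gamma) x + 1 / x := by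
  rw [← deriv_comp_add_const, one_div, ← Real.deriv_log,
    ← deriv_add (differentiableAt_log_comp_Gamma hx) (Real.differentiableAt_log hx.ne')]
  apply EventuallyEq.deriv_eq
  filter_upwards [eventually_gt_nhds hx] with y hy
  simp only [Function.comp_apply, Pi.add_apply]
  rw [Real.Gamma_add_one hy.ne', Real.log_mul hy.ne' (Real.Gamma_pos_of_pos hy).ne', add_comm]

theorem monotoneOn_deriv_log_comp_Gamma : MonotoneOn (deriv (Real.log ∘ Real.Gamma)) (Ioi 0) :=
  Real.convexOn_log_Gamma.monotoneOn_deriv fun _ hx ↦ differentiableAt_log_comp_Gamma hx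

theorem deriv_log_comp_Gamma_add_nat {x : ℝ} (hx : 0 < x) (n : ℕ) :
    deriv (Real.log ∘ Real.Gamma) (x + n)
      = deriv (Real.log ∘ Real.Gamma) x + ∑ k ∈ Finset.range n, 1 / (x + k) := by
  induction n with
  | zero => simp
  | succ n ih =>
    rw [Nat.cast_succ, ← add_assoc, deriv_log_comp_Gamma_add_one (by positivity), ih,
      Finset.sum_range_succ, add_assoc]

theorem tendsto_deriv_log_comp_Gamma_sub {x : ℝ} (hx : 0 < x) :
    Tendsto (fun n : ℕ ↦ deriv (Real.log ∘ Real.Gamma) (x + n)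
      - deriv (Real.log ∘ Real.Gamma) (1 + n)) atTop (𝓝 0) := by
  set D := deriv (Real.log ∘ Real.Gamma) with hD
  set k : ℕ := ⌈x⌉₊ + 1 with hk
  have hkx : x ≤ k := by rw [hk]; push_cast; linarith [Nat.le_ceil x]
  have hb : ∀ n : ℕ, 0 < n → |D (x + n) - D (1 + n)| ≤ k * (1 / n) := by
    intro n hn
    have hn' : (0 : ℝ) < n := by exact_mod_cast hn
    have h1 : D (n + k) - D n ≤ k * (1 / n) := by
      rw [hD, deriv_log_comp_Gamma_add_nat hn', add_sub_cancel_left]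
      refine (Finset.sum_le_card_nsmul _ _ (1 / (n : ℝ)) fun i _ ↦ ?_).trans (by simp)
      gcongr
      simp
    have hk1 : (1 : ℝ) ≤ k := by rw [hk]; push_cast; linarith [(⌈x⌉₊).cast_nonneg (α := ℝ)]
    have hmono := monotoneOn_deriv_log_comp_Gamma
    have m1 : D n ≤ D (x + n) := hmono hn' (mem_Ioi.2 (by linarith)) (by linarith)
    have m2 : D (x + n) ≤ D (n + k) :=
      hmono (mem_Ioi.2 (by linarith)) (mem_Ioi.2 (by linarith)) (by linarith)
    have m3 : D n ≤ D (1 + n) := hmono hn' (mem_Ioi.2 (by linarith)) (by linarith)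
    have m4 : D (1 + n) ≤ D (n + k) :=
      hmono (mem_Ioi.2 (by linarith)) (mem_Ioi.2 (by linarith)) (by linarith)
    rw [abs_le]
    constructor <;> linarith
  have h0 : Tendsto (fun n : ℕ ↦ (k : ℝ) * (1 / n)) atTop (𝓝 0) := by
    simpa using tendsto_one_div_atTop_nhds_zero_nat.const_mul (k : ℝ)
  refine squeeze_zero_norm' ?_ h0
  filter_upwards [eventually_gt_atTop 0] with n hn using hb n hn

/-- The series of the digamma function, for positive real argument. -/
theorem hasSum_deriv_log_comp_Gamma {x : ℝ} (hx : 0 < x) :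
    HasSum (fun n : ℕ ↦ 1 / ((n : ℝ) + 1) - 1 / (x + n))
      (deriv (Real.log ∘ Real.Gamma) x - deriv (Real.log ∘ Real.Gamma) 1) := by
  have hs : Summable fun n : ℕ ↦ 1 / ((n : ℝ) + 1) - 1 / (x + n) := by
    have h1 : Summable fun n : ℕ ↦ |x - 1| * max 1 (1 / x) * (1 / ((n : ℝ) + 1) ^ 2) := by
      have := (summable_nat_add_iff 1).2 (Real.summable_one_div_nat_pow.2 one_lt_two)
      push_cast at this
      exact this.mul_left _
    refine h1.of_norm_bounded fun n ↦ ?_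
    have hn : (0 : ℝ) ≤ n := n.cast_nonneg
    have h2 : 1 / ((n : ℝ) + 1) - 1 / (x + n) = (x - 1) * (1 / (x + n)) * (1 / (n + 1)) := by
      field_simp
      ring
    have h3 : 1 / (x + n) ≤ max 1 (1 / x) * (1 / (n + 1)) := by
      rcases le_total 1 x with h | h
      · have : 1 / (x + n) ≤ 1 / ((n : ℝ) + 1) :=
          one_div_le_one_div_of_le (by positivity) (by linarith)
        refine this.trans (le_mul_of_one_le_left (by positivity) (le_max_left _ _))
      · have : 1 / (x + n) ≤ 1 / x * (1 / ((n : ℝ) + 1)) := by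
          rw [one_div_mul_one_div, one_div_le_one_div (by positivity) (by positivity)]
          nlinarith
        refine this.trans ?_
        gcongr
        exact le_max_right _ _
    rw [h2, Real.norm_eq_abs, abs_mul, abs_mul, abs_of_nonneg (by positivity : 0 ≤ 1 / (x + n)),
      abs_of_nonneg (by positivity : 0 ≤ 1 / ((n : ℝ) + 1))]
    calc _ ≤ |x - 1| * (max 1 (1 / x) * (1 / (n + 1))) * (1 / ((n : ℝ) + 1)) := by gcongr
      _ = _ := by field_simp
  rw [hs.hasSum_iff_tendsto_nat]
  have h := (tendsto_deriv_log_comp_Gamma_sub hx).const_sub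
    (deriv (Real.log ∘ Real.Gamma) x - deriv (Real.log ∘ Real.Gamma) 1)
  rw [sub_zero] at h
  refine h.congr fun n ↦ ?_
  rw [deriv_log_comp_Gamma_add_nat hx, deriv_log_comp_Gamma_add_nat one_pos,
    Finset.sum_sub_distrib]
  simp only [add_comm (1 : ℝ)]
  ring

theorem differentiableAt_Gammaℝ {s : ℂ} (hs : 0 < s.re) : DifferentiableAt ℂ Complex.Gammaℝ s := by
  have := (Complex.differentiable_Gammaℝ_inv s).inv
    (inv_ne_zero (Complex.Gammaℝ_ne_zero_of_re_pos hs))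
  exact this.congr_of_eventuallyEq (Eventually.of_forall fun z ↦ by simp)

theorem re_logDeriv_Gammaℝ {x : ℝ} (hx : 0 < x) :
    (logDeriv Complex.Gammaℝ x).re
      = -Real.log Real.pi / 2 + deriv (Real.log ∘ Real.Gamma) (x / 2) / 2 := by
  have hre : ∀ y : ℝ, 0 < y → Complex.Gammaℝ y
      = ((Real.pi ^ (-y / 2) * Real.Gamma (y / 2) : ℝ) : ℂ) := by
    intro y _
    rw [Complex.Gammaℝ_def]
    push_cast [Complex.ofReal_cpow Real.pi_pos.le]
    rw [← Complex.Gamma_ofReal]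
    push_cast
    rfl
  set g : ℝ → ℝ := fun y ↦ Real.pi ^ (-y / 2) * Real.Gamma (y / 2) with hg
  have hgpos : ∀ y, 0 < y → 0 < g y := fun y hy ↦
    mul_pos (Real.rpow_pos_of_pos Real.pi_pos _) (Real.Gamma_pos_of_pos (by linarith))
  have h1 := (differentiableAt_Gammaℝ (s := x) (by simpa using hx)).hasDerivAt.real_of_complex
  have h2 : HasDerivAt g (deriv Complex.Gammaℝ x).re x := by
    refine h1.congr_of_eventuallyEq ?_
    filter_upwards [eventually_gt_nhds hx] with y hy
    rw [hre y hy, Complex.ofReal_re]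
  have h3 := h2.log (hgpos x hx).ne'
  have h4 : HasDerivAt (fun y ↦ Real.log (g y))
      (-Real.log Real.pi / 2 + deriv (Real.log ∘ Real.Gamma) (x / 2) / 2) x := by
    have h5 : HasDerivAt (fun y : ℝ ↦ -y / 2 * Real.log Real.pi + (Real.log ∘ Real.Gamma) (y / 2))
        (-1 / 2 * Real.log Real.pi + deriv (Real.log ∘ Real.Gamma) (x / 2) * (1 / 2)) x := by
      refine (((hasDerivAt_id x).neg.div_const 2).mul_const _).add ?_
      exact HasDerivAt.comp (h₂ := Real.log ∘ Real.Gamma) x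
        (differentiableAt_log_comp_Gamma (half_pos hx)).hasDerivAt ((hasDerivAt_id x).div_const 2)
    refine (h5.congr_of_eventuallyEq ?_).congr_deriv (by ring)
    filter_upwards [eventually_gt_nhds hx] with y hy
    rw [hg, Real.log_mul (Real.rpow_pos_of_pos Real.pi_pos _).ne'
      (Real.Gamma_pos_of_pos (half_pos hy)).ne', Real.log_rpow Real.pi_pos]
    rfl
  rw [logDeriv_apply, hre x hx, Complex.div_ofReal_re]
  exact h3.unique h4

/-- The logarithmic derivative of the archimedean Euler factor as a series, up to a constant. -/
theorem exists_hasSum_logDeriv_Gammaℝ : ∃ κ : ℝ, ∀ s : ℝ, 0 < s →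
    HasSum (fun n : ℕ ↦ 1 / (2 * (n : ℝ) + 4) - 1 / (s + (2 * n + 2)))
      ((logDeriv Complex.Gammaℝ s).re + 1 / s - κ) := by
  refine ⟨-Real.log Real.pi / 2 + deriv (Real.log ∘ Real.Gamma) 1 / 2 + 1 / 2, fun s hs ↦ ?_⟩
  have h := (hasSum_deriv_log_comp_Gamma (half_pos hs)).div_const 2
  rw [← hasSum_nat_add_iff' 1] at h
  have hf : (fun n : ℕ ↦ 1 / (2 * (n : ℝ) + 4) - 1 / (s + (2 * n + 2)))
      = fun n : ℕ ↦ (1 / (((n + 1 : ℕ) : ℝ) + 1) - 1 / (s / 2 + (n + 1 : ℕ))) / 2 := by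
    ext n
    push_cast
    field_simp
    ring
  rw [hf]
  have hv : (logDeriv Complex.Gammaℝ s).re + 1 / s
        - (-Real.log Real.pi / 2 + deriv (Real.log ∘ Real.Gamma) 1 / 2 + 1 / 2)
      = (deriv (Real.log ∘ Real.Gamma) (s / 2) - deriv (Real.log ∘ Real.Gamma) 1) / 2
        - ∑ i ∈ Finset.range 1, (1 / ((i : ℝ) + 1) - 1 / (s / 2 + i)) / 2 := by
    rw [re_logDeriv_Gammaℝ hs, Finset.sum_range_one]
    simp only [CharP.cast_eq_zero, add_zero, zero_add]
    field_simp
    ring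
  rw [hv]
  exact h

end Digamma

section TailMellin

open MeasureTheory Set

/-- `K` has the Mellin transform `∫₁^∞ K(x) x^{-w-1} dx` at `w`, absolutely convergent with
value `F`. -/
def HasTailMellin (K : ℝ → ℝ) (w F : ℝ) : Prop :=
  IntegrableOn (fun x : ℝ ↦ K x * x ^ (-w - 1)) (Ioi 1) ∧
    ∫ x in Ioi (1 : ℝ), K x * x ^ (-w - 1) = F

namespace HasTailMellin

variable {K K' : ℝ → ℝ} {w F F' : ℝ}

theorem add (h : HasTailMellin K w F) (h' : HasTailMellin K' w F') :
    HasTailMellin (fun x ↦ K x + K' x) w (F + F') := by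
  refine ⟨?_, ?_⟩
  · simp only [add_mul]
    exact h.1.add h'.1
  · simp only [add_mul]
    rw [integral_add h.1 h'.1, h.2, h'.2]

theorem sub (h : HasTailMellin K w F) (h' : HasTailMellin K' w F') :
    HasTailMellin (fun x ↦ K x - K' x) w (F - F') := by
  refine ⟨?_, ?_⟩
  · simp only [sub_mul]
    exact h.1.sub h'.1
  · simp only [sub_mul]
    rw [integral_sub h.1 h'.1, h.2, h'.2]

theorem const_mul (c : ℝ) (h : HasTailMellin K w F) :
    HasTailMellin (fun x ↦ c * K x) w (c * F) := by
  refine ⟨?_, ?_⟩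
  · simp only [mul_assoc]
    exact h.1.const_mul c
  · simp only [mul_assoc]
    rw [integral_const_mul, h.2]

theorem rpow {a : ℝ} (ha : a < w) : HasTailMellin (fun x ↦ x ^ a) w (1 / (w - a)) := by
  have h : EqOn (fun x : ℝ ↦ x ^ a * x ^ (-w - 1)) (fun x ↦ x ^ (a - w - 1)) (Ioi 1) := by
    intro x hx
    have hx : (1 : ℝ) < x := hx
    simp only
    rw [← Real.rpow_add (by linarith)]
    ring_nf
  refine ⟨(integrableOn_congr_fun h measurableSet_Ioi).2
    (integrableOn_Ioi_rpow_of_lt (by linarith) one_pos), ?_⟩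
  rw [setIntegral_congr_fun measurableSet_Ioi h, integral_Ioi_rpow_of_lt (by linarith) one_pos]
  rw [Real.one_rpow, sub_add_cancel, ← neg_sub w a, neg_div_neg_eq]

theorem cos_mul_log (γ : ℝ) (hw : 0 < w) :
    HasTailMellin (fun x ↦ Real.cos (γ * Real.log x)) w (w / (w ^ 2 + γ ^ 2)) := by
  set z : ℂ := ⟨-w - 1, γ⟩ with hz
  have h : EqOn (fun x : ℝ ↦ Real.cos (γ * Real.log x) * x ^ (-w - 1))
      (fun x ↦ ((x : ℂ) ^ z).re) (Ioi 1) := by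
    intro x hx
    have hx : (0 : ℝ) < x := lt_trans one_pos hx
    simp only
    rw [Complex.cpow_def_of_ne_zero (by exact_mod_cast hx.ne'), ← Complex.ofReal_log hx.le,
      Complex.exp_re, Complex.re_ofReal_mul, Complex.im_ofReal_mul, Real.rpow_def_of_pos hx,
      mul_comm γ, mul_comm (Real.cos _)]
  have hzre : z.re < -1 := by simp only [hz]; linarith
  have hi := integrableOn_Ioi_cpow_of_lt hzre one_pos
  refine ⟨(integrableOn_congr_fun h measurableSet_Ioi).2 hi.re, ?_⟩
  rw [setIntegral_congr_fun measurableSet_Ioi h]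
  have h1 := integral_re hi
  simp only [RCLike.re_to_complex] at h1
  rw [h1, integral_Ioi_cpow_of_lt hzre one_pos]
  simp only [Complex.ofReal_one, Complex.one_cpow, hz]
  rw [Complex.div_re]
  simp [Complex.normSq_apply]
  field_simp

/-- Termwise integration of a uniformly absolutely convergent series. -/
theorem tsum {ι : Type*} [Countable ι] {f : ι → ℝ → ℝ} {A G : ι → ℝ}
    (hf : ∀ i, ContinuousOn (f i) (Ioi 1)) (hA : Summable A)
    (hfA : ∀ i, ∀ x ∈ Ioi (1 : ℝ), |f i x| ≤ A i) (hw : 0 < w)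
    (h : ∀ i, HasTailMellin (f i) w (G i)) :
    HasTailMellin (fun x ↦ ∑' i, f i x) w (∑' i, G i) := by
  have hpow : IntegrableOn (fun x : ℝ ↦ x ^ (-w - 1)) (Ioi 1) :=
    integrableOn_Ioi_rpow_of_lt (by linarith) one_pos
  have hcpow : ContinuousOn (fun x : ℝ ↦ x ^ (-w - 1)) (Ioi 1) :=
    fun x hx ↦ (Real.continuousAt_rpow_const _ _
      (Or.inl (lt_trans one_pos hx).ne')).continuousWithinAt
  have hcont : ContinuousOn (fun x ↦ ∑' i, f i x) (Ioi 1) :=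
    continuousOn_tsum hf hA fun i x hx ↦ hfA i x hx
  have hbound : ∀ i, ∀ x ∈ Ioi (1 : ℝ), ‖f i x * x ^ (-w - 1)‖ ≤ A i * x ^ (-w - 1) := by
    intro i x hx
    rw [norm_mul, Real.norm_of_nonneg (Real.rpow_nonneg (lt_trans one_pos hx).le _)]
    exact mul_le_mul_of_nonneg_right (hfA i x hx)
      (Real.rpow_nonneg (lt_trans one_pos hx).le _)
  have hsum : Summable fun i ↦ ∫ x in Ioi (1 : ℝ), ‖f i x * x ^ (-w - 1)‖ := by
    refine (hA.mul_right (∫ x in Ioi (1 : ℝ), x ^ (-w - 1))).of_nonneg_of_le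
      (fun i ↦ integral_nonneg fun x ↦ norm_nonneg _) fun i ↦ ?_
    rw [← integral_const_mul]
    exact setIntegral_mono_on (h i).1.norm (hpow.const_mul _) measurableSet_Ioi (hbound i)
  refine ⟨(hpow.const_mul (∑' i, A i)).mono'
    ((hcont.mul hcpow).aestronglyMeasurable measurableSet_Ioi) ?_, ?_⟩
  · filter_upwards [ae_restrict_mem measurableSet_Ioi] with x hx
    rw [norm_mul, Real.norm_of_nonneg (Real.rpow_nonneg (lt_trans one_pos hx).le _)]
    exact mul_le_mul_of_nonneg_right (tsum_of_norm_bounded hA.hasSum fun i ↦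
      (Real.norm_eq_abs _).trans_le (hfA i x hx)) (Real.rpow_nonneg (lt_trans one_pos hx).le _)
  · have := hasSum_integral_of_summable_integral_norm (fun i ↦ (h i).1) hsum
    simp only [(h _).2, tsum_mul_right] at this
    exact this.tsum_eq.symm

/-- A continuous function of at most polynomial growth is determined by its Mellin transform. -/
theorem eq_zero (hK : ContinuousOn K (Ici 1)) {a C : ℝ} (ha : 0 ≤ a)
    (hC : ∀ x ∈ Ici (1 : ℝ), |K x| ≤ C * x ^ a) (h : ∀ w > a, HasTailMellin K w 0) {x : ℝ}
    (hx : 1 < x) : K x = 0 := by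
  set b := a + 1 with hb
  set μ := (volume : Measure ℝ).restrict (Ioi 1)
  have hpoly : ∀ P : Polynomial ℝ, Integrable (fun x ↦ K x * x ^ (-b - 1) * P.eval x⁻¹) μ ∧
      ∫ x, K x * x ^ (-b - 1) * P.eval x⁻¹ ∂μ = 0 := by
    intro P
    induction P using Polynomial.induction_on' with
    | add p q hp hq =>
      simp only [Polynomial.eval_add, mul_add]
      exact ⟨hp.1.add hq.1, by rw [integral_add hp.1 hq.1, hp.2, hq.2, add_zero]⟩
    | monomial n c =>
      have h1 := (h (b + n) (by have := n.cast_nonneg (α := ℝ); linarith)).const_mul c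
      have h2 : EqOn (fun x : ℝ ↦ K x * x ^ (-b - 1) * (Polynomial.monomial n c).eval x⁻¹)
          (fun x ↦ c * K x * x ^ (-(b + n) - 1)) (Ioi 1) := by
        intro x hx
        have hx : (0 : ℝ) < x := lt_trans one_pos hx
        simp only [Polynomial.eval_monomial]
        rw [show -(b + n) - 1 = -b - 1 - n by ring, Real.rpow_sub hx _ n, Real.rpow_natCast, inv_pow]
        ring
      refine ⟨(integrableOn_congr_fun h2 measurableSet_Ioi).2 h1.1, ?_⟩
      rw [setIntegral_congr_fun measurableSet_Ioi h2, h1.2, mul_zero]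
  have hint : Integrable (fun x ↦ K x * x ^ (-b - 1)) μ := (h b (by linarith)).1
  set φ : ℝ → ℝ := fun t ↦ K t⁻¹ * t ^ b with hφ
  have hC0 : 0 ≤ C := by simpa using (abs_nonneg _).trans (hC 1 self_mem_Ici)
  have hφC : ∀ t ∈ Icc (0 : ℝ) 1, |φ t| ≤ C * t := by
    intro t ht
    rcases ht.1.eq_or_lt with rfl | h0
    · simp [hφ, Real.zero_rpow (show b ≠ 0 by linarith)]
    · rw [hφ, abs_mul, abs_of_pos (Real.rpow_pos_of_pos h0 _)]
      calc _ ≤ C * t⁻¹ ^ a * t ^ b := by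
            gcongr
            exact hC _ (one_le_inv_iff₀.2 ⟨h0, ht.2⟩)
        _ = C * t := by
            rw [Real.inv_rpow h0.le, hb, Real.rpow_add_one h0.ne']
            field_simp
  have hφc : ContinuousOn φ (Icc 0 1) := by
    intro t ht
    rcases ht.1.eq_or_lt with rfl | h0
    · have hφ0 : φ 0 = 0 := by simpa using hφC 0 ht
      rw [ContinuousWithinAt, hφ0]
      refine squeeze_zero_norm' (a := fun t ↦ C * t) ?_ ?_
      · filter_upwards [self_mem_nhdsWithin] with t ht using hφC t ht
      · have : Continuous fun t : ℝ ↦ C * t := by fun_prop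
        simpa using (this.tendsto 0).mono_left nhdsWithin_le_nhds
    · have h1 : ContinuousWithinAt (fun t : ℝ ↦ K t⁻¹) (Icc 0 1) t := by
        have h2 : ContinuousWithinAt K (Ici 1) t⁻¹ := hK _ (one_le_inv_iff₀.2 ⟨h0, ht.2⟩)
        have h3 : ContinuousWithinAt (fun t : ℝ ↦ K t⁻¹) (Ioc 0 1) t :=
          h2.comp (continuousAt_inv₀ h0.ne').continuousWithinAt
            fun u hu ↦ one_le_inv_iff₀.2 ⟨hu.1, hu.2⟩
        refine h3.mono_of_mem_nhdsWithin ?_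
        filter_upwards [self_mem_nhdsWithin, mem_nhdsWithin_of_mem_nhds (Ioi_mem_nhds h0)]
          with u hu hu' using ⟨hu', hu.2⟩
      exact h1.mul (Real.continuousAt_rpow_const _ _ (Or.inl h0.ne')).continuousWithinAt
  have hinv : ∀ x ∈ Ioi (1 : ℝ), x⁻¹ ∈ Icc (0 : ℝ) 1 := fun x hx ↦
    ⟨inv_nonneg.2 (lt_trans one_pos hx).le, inv_le_one_of_one_le₀ (le_of_lt hx)⟩
  have hφinv : ContinuousOn (fun x : ℝ ↦ φ x⁻¹) (Ioi 1) :=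
    hφc.comp (continuousOn_inv₀.mono fun x hx ↦ (lt_trans one_pos hx).ne') hinv
  have hintφ : Integrable (fun x ↦ K x * x ^ (-b - 1) * φ x⁻¹) μ := by
    refine hint.mul_bdd (c := C) (hφinv.aestronglyMeasurable measurableSet_Ioi) ?_
    filter_upwards [ae_restrict_mem measurableSet_Ioi] with x hx
    exact (hφC _ (hinv x hx)).trans (mul_le_of_le_one_right hC0 (hinv x hx).2)
  have hzero : ∫ x, K x * x ^ (-b - 1) * φ x⁻¹ ∂μ = 0 := by
    have hle : ∀ ε > 0, |∫ x, K x * x ^ (-b - 1) * φ x⁻¹ ∂μ|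
        ≤ ε * ∫ x, ‖K x * x ^ (-b - 1)‖ ∂μ := by
      intro ε hε
      obtain ⟨P, hP⟩ := exists_polynomial_near_of_continuousOn 0 1 φ hφc ε hε
      rw [← sub_zero (∫ x, K x * x ^ (-b - 1) * φ x⁻¹ ∂μ), ← (hpoly P).2,
        ← integral_sub hintφ (hpoly P).1, ← integral_const_mul, ← Real.norm_eq_abs]
      refine norm_integral_le_of_norm_le (hint.norm.const_mul ε) ?_
      filter_upwards [ae_restrict_mem measurableSet_Ioi] with x hx
      rw [← mul_sub, norm_mul, mul_comm, Real.norm_eq_abs (φ _ - _), abs_sub_comm]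
      exact mul_le_mul_of_nonneg_right (hP _ (hinv x hx)).le (norm_nonneg _)
    by_contra hne
    have hpos := abs_pos.2 hne
    set I := |∫ x, K x * x ^ (-b - 1) * φ x⁻¹ ∂μ|
    have hN : 0 ≤ ∫ x, ‖K x * x ^ (-b - 1)‖ ∂μ := integral_nonneg fun _ ↦ norm_nonneg _
    set N := ∫ x, ‖K x * x ^ (-b - 1)‖ ∂μ
    have h1 := hle (I / (N + 1)) (by positivity)
    rw [div_mul_eq_mul_div, le_div_iff₀ (by positivity)] at h1
    nlinarith
  have hsq : ∀ x ∈ Ioi (1 : ℝ), K x * x ^ (-b - 1) * φ x⁻¹ = K x ^ 2 * x ^ (-2 * b - 1) := by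
    intro x hx
    have hx0 : (0 : ℝ) < x := lt_trans one_pos hx
    rw [hφ]
    simp only
    rw [inv_inv, Real.inv_rpow hx0.le, ← Real.rpow_neg hx0.le,
      show -2 * b - 1 = -b - 1 + -b by ring, Real.rpow_add hx0]
    ring
  have hae := (integral_eq_zero_iff_of_nonneg_ae (by
    filter_upwards [ae_restrict_mem measurableSet_Ioi] with x hx
    rw [hsq x hx]
    exact mul_nonneg (sq_nonneg _) (Real.rpow_nonneg (lt_trans one_pos hx).le _)) hintφ).1 hzero
  have hK0 : K =ᵐ[μ] 0 := by
    filter_upwards [hae, ae_restrict_mem measurableSet_Ioi] with x hx hx1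
    rw [hsq x hx1, Pi.zero_apply, mul_eq_zero] at hx
    simpa [(Real.rpow_pos_of_pos (lt_trans one_pos hx1) _).ne'] using hx
  exact Measure.eqOn_open_of_ae_eq hK0 isOpen_Ioi (hK.mono Ioi_subset_Ici_self)
    continuousOn_const hx

end HasTailMellin
end TailMellin

section ExplicitFormula

open MeasureTheory Set

theorem integrableOn_psi_mul_rpow {s : ℝ} (hs : 1 < s) :
    IntegrableOn (fun x : ℝ ↦ Chebyshev.psi x * x ^ (-s - 1)) (Ioi 1) := by
  have h : IntegrableOn (fun x : ℝ ↦ (Real.log 4 + 4) * x ^ (-s)) (Ioi 1) :=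
    (integrableOn_Ioi_rpow_of_lt (by linarith) one_pos).const_mul _
  refine h.mono' ?_ ?_
  · refine (Chebyshev.psi_mono.measurable.aestronglyMeasurable).mul ?_
    exact (measurable_id.pow_const _).aestronglyMeasurable
  · filter_upwards [ae_restrict_mem measurableSet_Ioi] with x hx
    have hx0 : (0 : ℝ) < x := lt_trans one_pos hx
    rw [norm_mul, Real.norm_of_nonneg (Chebyshev.psi_nonneg x),
      Real.norm_of_nonneg (Real.rpow_nonneg hx0.le _), Real.rpow_sub_one hx0.ne']
    calc _ ≤ (Real.log 4 + 4) * x * (x ^ (-s) / x) := by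
          gcongr
          exact Chebyshev.psi_le_const_mul_self hx0.le
      _ = _ := by field_simp

theorem mul_integral_psi_mul_rpow {s : ℝ} (hs : 1 < s) :
    s * ∫ x in Ioi (1 : ℝ), Chebyshev.psi x * x ^ (-s - 1)
      = 1 / (s - 1) + 1 / s + (logDeriv Complex.Gammaℝ s).re - (logDeriv xi s).re := by
  have hs0 : 0 < s := by linarith
  have hs' : 1 < (s : ℂ).re := by simpa using hs
  have hsne : (s : ℂ) ≠ 0 := by exact_mod_cast hs0.ne'
  have h1 : ((s * ∫ x in Ioi (1 : ℝ), Chebyshev.psi x * x ^ (-s - 1) : ℝ) : ℂ)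
      = 1 / (s - 1) - deriv riemannZeta₁ s / riemannZeta₁ s := by
    rw [← neg_deriv_riemannZeta_div hs', ← mul_integral_psi_mul_cpow hs', Complex.ofReal_mul,
      ← integral_complex_ofReal]
    congr 1
    refine setIntegral_congr_fun measurableSet_Ioi fun x hx ↦ ?_
    rw [Complex.ofReal_mul, Complex.ofReal_cpow (lt_trans one_pos hx).le]
    push_cast
    rfl
  have h2 : logDeriv xi s = 1 / s + logDeriv Complex.Gammaℝ s
      + deriv riemannZeta₁ s / riemannZeta₁ s := by
    have h3 : xi =ᶠ[nhds (s : ℂ)] fun z ↦ z * z.Gammaℝ * riemannZeta₁ z := by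
      filter_upwards [(isOpen_re_gt 0).mem_nhds (show 0 < (s : ℂ).re by simpa using hs0)] with z hz
        using xi_eq_mul_riemannZeta₁ hz
    have hG := differentiableAt_Gammaℝ (s := s) (by simpa using hs0)
    have hG0 := Complex.Gammaℝ_ne_zero_of_re_pos (s := s) (by simpa using hs0)
    rw [logDeriv_apply, h3.deriv_eq, h3.eq_of_nhds, ← logDeriv_apply, ← logDeriv_apply,
      logDeriv_mul (f := fun z : ℂ ↦ z * z.Gammaℝ) _ (mul_ne_zero hsne hG0)
        (riemannZeta₁_ofReal_ne_zero hs0) (differentiableAt_id.mul hG)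
        (differentiable_riemannZeta₁ _),
      logDeriv_mul (f := fun z : ℂ ↦ z) _ hsne hG0 differentiableAt_id hG, logDeriv_id']
  have h4 : (s * ∫ x in Ioi (1 : ℝ), Chebyshev.psi x * x ^ (-s - 1) : ℝ)
      = ((1 / (s - 1) + 1 / s + logDeriv Complex.Gammaℝ s - logDeriv xi s : ℂ)).re := by
    rw [h2, ← Complex.ofReal_re (s * _), h1]
    ring_nf
  rw [h4]
  have h5 : (1 / (s - 1 : ℂ)).re = 1 / (s - 1) := by exact_mod_cast Complex.ofReal_re (1 / (s - 1))
  have h6 : (1 / (s : ℂ)).re = 1 / s := by exact_mod_cast Complex.ofReal_re (1 / s)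
  simp only [Complex.sub_re, Complex.add_re, h5, h6]

/-- The Mellin transform of `√x ∫₁ˣ (ψ(t) - t) / t² dt`. -/
theorem hasTailMellin_sqrt_mul_integral {w : ℝ} (hw : 1 / 2 < w) :
    HasTailMellin (fun x ↦ x ^ (1 / 2 : ℝ) * ∫ t in (1 : ℝ)..x, (Chebyshev.psi t - t) / t ^ 2) w
      (((∫ x in Ioi (1 : ℝ), Chebyshev.psi x * x ^ (-(w + 1 / 2) - 1)) - 1 / (w - 1 / 2))
        / (w - 1 / 2)) := by
  have hpsi := integrableOn_psi_mul_rpow (s := w + 1 / 2) (by linarith)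
  have hid := HasTailMellin.rpow (a := 1) (w := w + 1 / 2) (by linarith)
  have hg : IntegrableOn (fun t : ℝ ↦ (Chebyshev.psi t - t) / t ^ 2 * t ^ (-(w - 1 / 2))) (Ioi 1)
      ∧ ∫ t in Ioi (1 : ℝ), (Chebyshev.psi t - t) / t ^ 2 * t ^ (-(w - 1 / 2))
        = (∫ x in Ioi (1 : ℝ), Chebyshev.psi x * x ^ (-(w + 1 / 2) - 1)) - 1 / (w - 1 / 2) := by
    have h1 : EqOn (fun t : ℝ ↦ (Chebyshev.psi t - t) / t ^ 2 * t ^ (-(w - 1 / 2)))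
        (fun t ↦ Chebyshev.psi t * t ^ (-(w + 1 / 2) - 1) - t ^ (1 : ℝ) * t ^ (-(w + 1 / 2) - 1))
        (Ioi 1) := by
      intro t ht
      have ht0 : (0 : ℝ) < t := lt_trans one_pos ht
      simp only
      rw [Real.rpow_one, show -(w + 1 / 2) - 1 = -(w - 1 / 2) - (2 : ℕ) by push_cast; ring,
        Real.rpow_sub_natCast ht0.ne']
      ring
    refine ⟨(integrableOn_congr_fun h1 measurableSet_Ioi).2 (hpsi.sub hid.1), ?_⟩
    rw [setIntegral_congr_fun measurableSet_Ioi h1, integral_sub hpsi hid.1, hid.2]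
    congr 2
    ring
  have hcast : EqOn (fun t : ℝ ↦ (((Chebyshev.psi t - t) / t ^ 2 : ℝ) : ℂ)
      * (t : ℂ) ^ (-((w - 1 / 2 : ℝ) : ℂ)))
      (fun t ↦ (((Chebyshev.psi t - t) / t ^ 2 * t ^ (-(w - 1 / 2)) : ℝ) : ℂ)) (Ioi 1) := by
    intro t ht
    simp only
    rw [Complex.ofReal_mul _ (t ^ _), Complex.ofReal_cpow (lt_trans one_pos ht).le]
    push_cast
    rfl
  have hB := integrableOn_and_mul_integral_cpow_mul_intervalIntegral one_pos
    (s := ((w - 1 / 2 : ℝ) : ℂ)) (by simpa using hw)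
    ((integrableOn_congr_fun hcast measurableSet_Ioi).2 hg.1.ofReal)
  rw [setIntegral_congr_fun measurableSet_Ioi hcast, integral_complex_ofReal, hg.2] at hB
  have hcast2 : EqOn (fun x : ℝ ↦ (x : ℂ) ^ (-((w - 1 / 2 : ℝ) : ℂ) - 1)
      * ∫ t in (1 : ℝ)..x, (((Chebyshev.psi t - t) / t ^ 2 : ℝ) : ℂ))
      (fun x ↦ ((x ^ (1 / 2 : ℝ) * (∫ t in (1 : ℝ)..x, (Chebyshev.psi t - t) / t ^ 2)
        * x ^ (-w - 1) : ℝ) : ℂ)) (Ioi 1) := by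
    intro x hx
    have hx0 : (0 : ℝ) < x := lt_trans one_pos hx
    have h2 : x ^ (1 / 2 : ℝ) * x ^ (-w - 1) = x ^ (-(w - 1 / 2) - 1) := by
      rw [← Real.rpow_add hx0]
      ring_nf
    simp only
    rw [intervalIntegral.integral_ofReal, mul_right_comm, h2, Complex.ofReal_mul,
      Complex.ofReal_cpow hx0.le]
    push_cast
    rfl
  refine ⟨?_, ?_⟩
  · have := ((integrableOn_congr_fun hcast2 measurableSet_Ioi).1 hB.1).re
    simpa [IntegrableOn] using this
  · have h3 := hB.2
    rw [setIntegral_congr_fun measurableSet_Ioi hcast2, integral_complex_ofReal] at h3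
    rw [eq_div_iff (by linarith), mul_comm]
    exact_mod_cast h3

end ExplicitFormula

section ExplicitFormula

open MeasureTheory Set

/-- The contribution of the trivial zeros to the explicit formula. -/
theorem exists_hasTailMellin_trivial_zeros : ∃ (T : ℝ → ℝ) (κ P Q R : ℝ),
    ContinuousOn T (Ici 1) ∧ (∀ x ∈ Ici (1 : ℝ), |T x| ≤ R * x ^ (-1 / 2 : ℝ)) ∧
    ∀ w > 1 / 2, HasTailMellin T w (P / (w - 1 / 2) + Q / (w + 1 / 2)
      - ((logDeriv Complex.Gammaℝ (w + 1 / 2 : ℝ)).re + 1 / (w + 1 / 2) - κ)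
        / ((w + 1 / 2) * (w - 1 / 2))) := by
  obtain ⟨κ, hκ⟩ := exists_hasSum_logDeriv_Gammaℝ
  have hs2 : Summable fun n : ℕ ↦ 1 / ((n : ℝ) + 1) ^ 2 := by
    have := (summable_nat_add_iff 1).2 (Real.summable_one_div_nat_pow.2 one_lt_two)
    push_cast at this
    exact this
  set r : ℕ → ℝ := fun n ↦ 1 / ((2 * n + 2) * (2 * n + 3)) with hr
  have hr0 : ∀ n, 0 ≤ r n := fun n ↦ by simp only [hr]; positivity
  have hrs : Summable r := hs2.of_nonneg_of_le hr0 fun n ↦ by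
    simp only [hr]
    refine one_div_le_one_div_of_le (by positivity) ?_
    have : (0 : ℝ) ≤ n := n.cast_nonneg
    nlinarith
  have hps : Summable fun n : ℕ ↦ 1 / (2 * (n : ℝ) + 4) - 1 / (2 * n + 3) := by
    refine hs2.of_norm_bounded fun n ↦ ?_
    have : (0 : ℝ) ≤ n := n.cast_nonneg
    rw [show 1 / (2 * (n : ℝ) + 4) - 1 / (2 * n + 3) = -(1 / ((2 * n + 4) * (2 * n + 3))) by
      field_simp; ring, norm_neg, Real.norm_of_nonneg (by positivity)]
    refine one_div_le_one_div_of_le (by positivity) ?_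
    nlinarith
  have hqs : Summable fun n : ℕ ↦ 1 / (2 * (n : ℝ) + 2) - 1 / (2 * n + 4) := by
    refine hs2.of_norm_bounded fun n ↦ ?_
    have : (0 : ℝ) ≤ n := n.cast_nonneg
    rw [show 1 / (2 * (n : ℝ) + 2) - 1 / (2 * n + 4) = 1 / ((2 * n + 2) * (n + 2)) by
      field_simp; ring, Real.norm_of_nonneg (by positivity)]
    refine one_div_le_one_div_of_le (by positivity) ?_
    nlinarith
  set f : ℕ → ℝ → ℝ := fun n x ↦ r n * x ^ (-(2 * n + 5 / 2) : ℝ) with hf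
  have hfc : ∀ n, ContinuousOn (f n) (Ici 1) := fun n x hx ↦
    ((Real.continuousAt_rpow_const _ _
      (Or.inl (lt_of_lt_of_le one_pos hx).ne')).continuousWithinAt).const_mul _
  have hfb : ∀ n, ∀ x ∈ Ici (1 : ℝ), |f n x| ≤ r n * x ^ (-1 / 2 : ℝ) := by
    intro n x hx
    have hx0 : (0 : ℝ) < x := lt_of_lt_of_le one_pos hx
    rw [hf, abs_of_nonneg (mul_nonneg (hr0 n) (Real.rpow_nonneg hx0.le _))]
    refine mul_le_mul_of_nonneg_left (Real.rpow_le_rpow_of_exponent_le hx ?_) (hr0 n)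
    have : (0 : ℝ) ≤ n := n.cast_nonneg
    linarith
  have hfb' : ∀ n, ∀ x ∈ Ici (1 : ℝ), |f n x| ≤ r n := fun n x hx ↦ (hfb n x hx).trans
    (mul_le_of_le_one_right (hr0 n) (Real.rpow_le_one_of_one_le_of_nonpos hx (by norm_num)))
  refine ⟨fun x ↦ ∑' n, f n x, κ, ∑' n : ℕ, (1 / (2 * (n : ℝ) + 4) - 1 / (2 * n + 3)),
    ∑' n : ℕ, (1 / (2 * (n : ℝ) + 2) - 1 / (2 * n + 4)), ∑' n, r n,
    continuousOn_tsum hfc hrs hfb', fun x hx ↦ ?_, fun w hw ↦ ?_⟩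
  · rw [← tsum_mul_right]
    exact tsum_of_norm_bounded (hrs.mul_right _).hasSum fun n ↦
      (Real.norm_eq_abs _).trans_le (hfb n x hx)
  · have h1 := HasTailMellin.tsum (fun n ↦ (hfc n).mono Ioi_subset_Ici_self) hrs
      (fun n x hx ↦ hfb' n x (Ioi_subset_Ici_self hx)) (by linarith : 0 < w)
      (G := fun n ↦ r n * (1 / (w - (-(2 * n + 5 / 2))))) fun n ↦
        (HasTailMellin.rpow (by have : (0 : ℝ) ≤ n := n.cast_nonneg; linarith)).const_mul _
    convert h1 using 1
    refine (HasSum.tsum_eq ?_).symm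
    have h2 : (fun n : ℕ ↦ r n * (1 / (w - (-(2 * (n : ℝ) + 5 / 2))))) = fun n : ℕ ↦
        (1 / (2 * (n : ℝ) + 4) - 1 / (2 * n + 3)) / (w - 1 / 2)
          + (1 / (2 * (n : ℝ) + 2) - 1 / (2 * n + 4)) / (w + 1 / 2)
          - (1 / (2 * (n : ℝ) + 4) - 1 / (w + 1 / 2 + (2 * n + 2)))
            / ((w + 1 / 2) * (w - 1 / 2)) := by
      ext n
      simp only [hr]
      obtain ⟨v, rfl⟩ : ∃ v, w = v + 1 / 2 := ⟨w - 1 / 2, by ring⟩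
      have h0 : (0 : ℝ) ≤ n := n.cast_nonneg
      have hv : 0 < v := by linarith
      rw [show v + 1 / 2 - -(2 * (n : ℝ) + 5 / 2) = v + (2 * n + 3) by ring,
        show v + 1 / 2 - 1 / 2 = v by ring, show v + 1 / 2 + 1 / 2 = v + 1 by ring]
      field_simp
      ring
    rw [h2]
    exact ((hps.hasSum.div_const (w - 1 / 2)).add (hqs.hasSum.div_const (w + 1 / 2))).sub
      ((hκ (w + 1 / 2) (by linarith)).div_const ((w + 1 / 2) * (w - 1 / 2)))

/-- The contribution of the non-trivial zeros to the explicit formula. -/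
theorem exists_hasTailMellin_nontrivial_zeros
    (hRH : ∀ ρ : ℂ, riemannZeta ρ = 0 → 0 < ρ.re → ρ.re < 1 → ρ.re = 1 / 2) :
    ∃ (S : ℝ → ℝ) (c : ℝ), c < 1 / 6 ∧
    ContinuousOn S (Ici 1) ∧ (∀ x ∈ Ici (1 : ℝ), |S x| ≤ c) ∧
    ∀ w > 1 / 2, HasTailMellin S w ((c * w - (logDeriv xi (w + 1 / 2 : ℝ)).re)
        / ((w + 1 / 2) * (w - 1 / 2))) := by
  set m : ℂ → ℝ := fun ρ ↦ analyticOrderNatAt (fun z ↦ xi (1 / 2 + z)) ρ with hm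
  have hZ : ∀ w : ℝ, 0 < w → HasSum (fun ρ : ℂ ↦ m ρ * (w / (w ^ 2 + ρ.im ^ 2)))
      (logDeriv xi (w + 1 / 2 : ℝ)).re := fun w hw ↦ by
    have := hasSum_logDeriv_xi hRH hw
    rwa [show ((w + 1 / 2 : ℝ) : ℂ) = 1 / 2 + w by push_cast; ring]
  set A : ℂ → ℝ := fun ρ ↦ m ρ / (1 / 4 + ρ.im ^ 2) with hA
  have hA0 : ∀ ρ, 0 ≤ A ρ := fun ρ ↦ by simp only [hA, hm]; positivity
  have hAs : HasSum A (2 * (logDeriv xi (1 / 2 + 1 / 2 : ℝ)).re) := by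
    have h1 : A = fun ρ : ℂ ↦ 2 * (m ρ * (1 / 2 / ((1 / 2) ^ 2 + ρ.im ^ 2))) := by
      ext ρ
      rw [hA]
      norm_num
      ring
    rw [h1]
    exact (hZ (1 / 2) (by norm_num)).mul_left 2
  set c := 2 * (logDeriv xi (1 / 2 + 1 / 2 : ℝ)).re with hc
  have hc6 : c < 1 / 6 := by
    have := re_logDeriv_xi_one_lt
    rw [hc]
    push_cast at this ⊢
    linarith
  have hcount : Countable (Function.support A) := hAs.summable.countable_support
  have hAs' : HasSum (fun i : Function.support A ↦ A i) c :=
    (hasSum_subtype_iff_of_support_subset subset_rfl).2 hAs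
  set f : Function.support A → ℝ → ℝ :=
    fun i x ↦ A i * Real.cos ((i : ℂ).im * Real.log x) with hf
  have hfc : ∀ i, ContinuousOn (f i) (Ici 1) := fun i ↦ by
    have : ContinuousOn Real.log (Ici 1) := Real.continuousOn_log.mono fun x hx ↦
      (lt_of_lt_of_le one_pos hx).ne'
    fun_prop
  have hfb : ∀ i x, |f i x| ≤ A i := fun i x ↦ by
    rw [hf, abs_mul, abs_of_nonneg (hA0 _)]
    exact mul_le_of_le_one_right (hA0 _) (Real.abs_cos_le_one _)
  refine ⟨fun x ↦ ∑' i, f i x, c, hc6, continuousOn_tsum hfc hAs'.summable fun i x _ ↦ hfb i x,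
    fun x _ ↦ ?_, fun w hw ↦ ?_⟩
  · exact tsum_of_norm_bounded hAs' fun i ↦ (Real.norm_eq_abs _).trans_le (hfb i x)
  · have h1 := HasTailMellin.tsum (fun n ↦ (hfc n).mono Ioi_subset_Ici_self) hAs'.summable
      (fun i x _ ↦ hfb i x) (by linarith : 0 < w)
      (G := fun i : Function.support A ↦ A i * (w / (w ^ 2 + (i : ℂ).im ^ 2))) fun i ↦
        (HasTailMellin.cos_mul_log _ (by linarith)).const_mul _
    convert h1 using 1
    refine (HasSum.tsum_eq ?_).symm
    have h2 : HasSum (fun ρ ↦ A ρ * (w / (w ^ 2 + ρ.im ^ 2)))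
        ((c * w - (logDeriv xi (w + 1 / 2 : ℝ)).re) / ((w + 1 / 2) * (w - 1 / 2))) := by
      have h3 := ((hAs.mul_right w).sub (hZ w (by linarith))).div_const ((w + 1 / 2) * (w - 1 / 2))
      have h4 : (fun ρ ↦ A ρ * (w / (w ^ 2 + ρ.im ^ 2))) = fun ρ : ℂ ↦
          (A ρ * w - m ρ * (w / (w ^ 2 + ρ.im ^ 2))) / ((w + 1 / 2) * (w - 1 / 2)) := by
        ext ρ
        simp only [hA]
        have : 0 < w ^ 2 + ρ.im ^ 2 := by positivity
        have : 0 < 1 / 4 + ρ.im ^ 2 := by positivity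
        rw [eq_div_iff (mul_ne_zero (by linarith) (by linarith))]
        field_simp
        ring
      rwa [h4]
    refine (hasSum_subtype_iff_of_support_subset (f := fun ρ : ℂ ↦ A ρ * (w / (w ^ 2 + ρ.im ^ 2)))
      fun ρ hρ ↦ ?_).2 h2
    exact left_ne_zero_of_mul hρ

end ExplicitFormula

section ExplicitFormula

open MeasureTheory Set

theorem abs_psi_sub_le {x : ℝ} (hx : 0 ≤ x) : |Chebyshev.psi x - x| ≤ (Real.log 4 + 4) * x := by
  have h1 := Chebyshev.psi_le_const_mul_self hx
  have h2 := Chebyshev.psi_nonneg x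
  have h3 : 0 ≤ Real.log 4 := Real.log_nonneg (by norm_num)
  rw [abs_le]
  constructor <;> nlinarith

theorem intervalIntegrable_psi_sub_div {f : ℝ → ℝ} {a b : ℝ} (hf : ContinuousOn f (uIcc a b))
    (h0 : ∀ t ∈ uIcc a b, f t ≠ 0) :
    IntervalIntegrable (fun t ↦ (Chebyshev.psi t - t) / f t) volume a b := by
  simp only [div_eq_mul_inv]
  exact (Chebyshev.psi_mono.intervalIntegrable.sub intervalIntegral.intervalIntegrable_id).mul_continuousOn
    (hf.inv₀ h0)

theorem intervalIntegrable_psi_sub_div_sq {a b : ℝ} (ha : 0 < a) (hb : 0 < b) :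
    IntervalIntegrable (fun t ↦ (Chebyshev.psi t - t) / t ^ 2) volume a b :=
  intervalIntegrable_psi_sub_div (by fun_prop) fun t ht ↦
    pow_ne_zero 2 (lt_of_lt_of_le (lt_min ha hb) ht.1).ne'

theorem continuousOn_integral_psi_sub_div_sq :
    ContinuousOn (fun x ↦ ∫ t in (1 : ℝ)..x, (Chebyshev.psi t - t) / t ^ 2) (Ici 1) := by
  intro x hx
  have hx1 : (1 : ℝ) ≤ x + 1 := by linarith [mem_Ici.1 hx]
  have h := intervalIntegral.continuousOn_primitive_interval (a := 1) (b := x + 1) (μ := volume)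
    (f := fun t ↦ (Chebyshev.psi t - t) / t ^ 2) (by
      rw [uIcc_of_le hx1]
      exact (intervalIntegrable_iff_integrableOn_Icc_of_le hx1).1
        (intervalIntegrable_psi_sub_div_sq one_pos (one_pos.trans_le hx1)))
  rw [uIcc_of_le hx1] at h
  refine (h x ⟨hx, by linarith⟩).mono_of_mem_nhdsWithin ?_
  filter_upwards [self_mem_nhdsWithin, mem_nhdsWithin_of_mem_nhds (Iio_mem_nhds (lt_add_one x))]
    with u hu hu' using ⟨hu, le_of_lt hu'⟩

theorem abs_integral_psi_sub_div_sq_le {x : ℝ} (hx : 1 ≤ x) :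
    |∫ t in (1 : ℝ)..x, (Chebyshev.psi t - t) / t ^ 2| ≤ (Real.log 4 + 4) * x := by
  have h3 : 0 ≤ Real.log 4 := Real.log_nonneg (by norm_num)
  have h := intervalIntegral.norm_integral_le_of_norm_le_const (a := 1) (b := x)
    (f := fun t ↦ (Chebyshev.psi t - t) / t ^ 2) (C := Real.log 4 + 4) fun t ht ↦ by
      rw [uIoc_of_le hx] at ht
      have ht0 : 0 < t := one_pos.trans ht.1
      rw [norm_div, Real.norm_of_nonneg (sq_nonneg t), div_le_iff₀ (by positivity)]
      refine (abs_psi_sub_le ht0.le).trans ?_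
      have : t ≤ t ^ 2 := by nlinarith [ht.1]
      gcongr
  rw [abs_of_nonneg (by linarith)] at h
  refine h.trans ?_
  gcongr
  linarith

/-- A smoothed explicit formula for `ψ` under the Riemann hypothesis, with an explicit constant
in front of the main term of the error. -/
theorem exists_abs_sub_integral_psi_sub_div_sq_le
    (hRH : ∀ ρ : ℂ, riemannZeta ρ = 0 → 0 < ρ.re → ρ.re < 1 → ρ.re = 1 / 2) :
    ∃ a C c : ℝ, 0 ≤ C ∧ 0 ≤ c ∧ c < 1 / 6 ∧ ∀ x > 1,
      |a - ∫ t in (1 : ℝ)..x, (Chebyshev.psi t - t) / t ^ 2| ≤ c / √x + C / x := by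
  obtain ⟨T, κ, P, Q, R, hTc, hTb, hT⟩ := exists_hasTailMellin_trivial_zeros
  obtain ⟨S, c, hc6, hSc, hSb, hS⟩ := exists_hasTailMellin_nontrivial_zeros hRH
  have hc0 : 0 ≤ c := (abs_nonneg _).trans (hSb 1 self_mem_Ici)
  have hR0 : 0 ≤ R := by simpa using (abs_nonneg _).trans (hTb 1 self_mem_Ici)
  set α := P + κ - 1 - c / 2
  set β := Q - κ + 1 - c / 2
  set G : ℝ → ℝ := fun x ↦ ∫ t in (1 : ℝ)..x, (Chebyshev.psi t - t) / t ^ 2 with hG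
  set D : ℝ → ℝ := fun x ↦ x ^ (1 / 2 : ℝ) * G x + T x - S x
    - (α * x ^ (1 / 2 : ℝ) + β * x ^ (-1 / 2 : ℝ)) with hD
  have hpow : ∀ b : ℝ, ContinuousOn (fun x : ℝ ↦ x ^ b) (Ici 1) := fun b x hx ↦
    (Real.continuousAt_rpow_const _ _ (Or.inl (one_pos.trans_le hx).ne')).continuousWithinAt
  have hDc : ContinuousOn D (Ici 1) :=
    ((((hpow _).mul continuousOn_integral_psi_sub_div_sq).add hTc).sub hSc).sub
      (((hpow _).const_mul _).add ((hpow _).const_mul _))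
  have hDb : ∀ x ∈ Ici (1 : ℝ), |D x| ≤ ((Real.log 4 + 4) + R + c + |α| + |β|) * x ^ (2 : ℝ) := by
    intro x hx
    have hx1 : (1 : ℝ) ≤ x := hx
    have hx0 : (0 : ℝ) < x := one_pos.trans_le hx1
    have h2 : 1 ≤ x ^ (2 : ℝ) := Real.one_le_rpow hx1 (by norm_num)
    have h3 : x ^ (1 / 2 : ℝ) * x ≤ x ^ (2 : ℝ) := by
      rw [← Real.rpow_add_one hx0.ne']
      exact Real.rpow_le_rpow_of_exponent_le hx1 (by norm_num)
    have h4 : x ^ (1 / 2 : ℝ) ≤ x ^ (2 : ℝ) :=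
      Real.rpow_le_rpow_of_exponent_le hx1 (by norm_num)
    have h5 : x ^ (-1 / 2 : ℝ) ≤ x ^ (2 : ℝ) :=
      Real.rpow_le_rpow_of_exponent_le hx1 (by norm_num)
    have h6 : 0 ≤ Real.log 4 := Real.log_nonneg (by norm_num)
    have a1 : |x ^ (1 / 2 : ℝ) * G x| ≤ (Real.log 4 + 4) * x ^ (2 : ℝ) := by
      rw [abs_mul, abs_of_nonneg (Real.rpow_nonneg hx0.le _)]
      calc _ ≤ x ^ (1 / 2 : ℝ) * ((Real.log 4 + 4) * x) := by
            gcongr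
            exact abs_integral_psi_sub_div_sq_le hx1
        _ = (Real.log 4 + 4) * (x ^ (1 / 2 : ℝ) * x) := by ring
        _ ≤ _ := by gcongr
    have a2 : |T x| ≤ R * x ^ (2 : ℝ) := (hTb x hx).trans (by gcongr)
    have a3 : |S x| ≤ c * x ^ (2 : ℝ) := (hSb x hx).trans (le_mul_of_one_le_right hc0 h2)
    have a4 : |α * x ^ (1 / 2 : ℝ)| ≤ |α| * x ^ (2 : ℝ) := by
      rw [abs_mul, abs_of_nonneg (Real.rpow_nonneg hx0.le _)]
      gcongr
    have a5 : |β * x ^ (-1 / 2 : ℝ)| ≤ |β| * x ^ (2 : ℝ) := by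
      rw [abs_mul, abs_of_nonneg (Real.rpow_nonneg hx0.le _)]
      gcongr
    rw [abs_le] at *
    simp only [hD]
    constructor <;> nlinarith
  have hD0 : ∀ x > 1, D x = 0 := by
    intro x hx
    refine HasTailMellin.eq_zero hDc two_pos.le hDb (fun w hw ↦ ?_) hx
    have hw2 : 1 / 2 < w := by linarith
    have h1 := (((hasTailMellin_sqrt_mul_integral hw2).add (hT w hw2)).sub (hS w hw2)).sub
      (((HasTailMellin.rpow (a := 1 / 2) hw2).const_mul α).add
        ((HasTailMellin.rpow (a := -1 / 2) (w := w) (by linarith)).const_mul β))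
    convert h1 using 1
    have h2 := mul_integral_psi_mul_rpow (s := w + 1 / 2) (by linarith)
    set Ψ := ∫ x in Ioi (1 : ℝ), Chebyshev.psi x * x ^ (-(w + 1 / 2) - 1)
    obtain ⟨v, rfl⟩ : ∃ v, w = v + 1 / 2 := ⟨w - 1 / 2, by ring⟩
    have hv : 0 < v := by linarith
    have h3 : Ψ = (1 / v + 1 / (v + 1) + (logDeriv Complex.Gammaℝ (v + 1 / 2 + 1 / 2 : ℝ)).re
        - (logDeriv xi (v + 1 / 2 + 1 / 2 : ℝ)).re) / (v + 1) := by
      rw [eq_div_iff (by positivity), mul_comm]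
      ring_nf at h2 ⊢
      exact h2
    rw [h3, show v + 1 / 2 + 1 / 2 = v + 1 by ring, show v + 1 / 2 - 1 / 2 = v by ring,
      show v + 1 / 2 - -1 / 2 = v + 1 by ring]
    simp only [α, β]
    field_simp
    ring
  refine ⟨α, |β| + R, c, by positivity, hc0, hc6, fun x hx ↦ ?_⟩
  have hx0 : (0 : ℝ) < x := one_pos.trans hx
  have hx2 : 0 < √x := Real.sqrt_pos.2 hx0
  have h1 := hD0 x hx
  have h2 : x ^ (-1 / 2 : ℝ) = 1 / √x := by
    rw [neg_div, Real.rpow_neg hx0.le, ← Real.sqrt_eq_rpow, one_div]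
  have hT' := hTb x hx.le
  have hxx : √x * √x = x := Real.mul_self_sqrt hx0.le
  simp only [hD, h2, ← Real.sqrt_eq_rpow] at h1
  rw [h2] at hT'
  have h3 : α - G x = (T x - S x - β * (1 / √x)) / √x := by
    rw [eq_div_iff hx2.ne']
    linarith
  rw [h3, abs_div, abs_of_pos hx2, div_le_iff₀ hx2]
  have h4 : (c / √x + (|β| + R) / x) * √x = c + |β| * (1 / √x) + R * (1 / √x) := by
    nth_rewrite 2 [← hxx]
    field_simp
    ring
  rw [h4]
  have h5 : |β * (1 / √x)| = |β| * (1 / √x) := by rw [abs_mul, abs_of_pos (by positivity : 0 < 1 / √x)]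
  have h6 := hSb x hx.le
  calc _ ≤ |T x| + |S x| + |β * (1 / √x)| := (abs_sub _ _).trans (by gcongr; exact abs_sub _ _)
    _ ≤ _ := by linarith

end ExplicitFormula

section PsiBound

open MeasureTheory Set Topology

theorem sq_sub_div_le_integral_sub_div_sq {u v : ℝ} (hu : 0 < u) (huv : u ≤ v) :
    (v - u) ^ 2 / (2 * v ^ 2) ≤ ∫ t in u..v, (v - t) / t ^ 2 := by
  have hv : 0 < v := hu.trans_le huv
  have h1 : ∫ t in u..v, (v - t) / v ^ 2 = (v - u) ^ 2 / (2 * v ^ 2) := by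
    rw [intervalIntegral.integral_div, intervalIntegral.integral_sub (by simp) (by simp)]
    simp
    field_simp
    ring
  rw [← h1]
  refine intervalIntegral.integral_mono_on huv ?_ ?_ fun t ht ↦ ?_
  · exact Continuous.intervalIntegrable (by fun_prop) _ _
  · refine ContinuousOn.intervalIntegrable fun t ht ↦ ?_
    rw [uIcc_of_le huv] at ht
    have : t ≠ 0 := (hu.trans_le ht.1).ne'
    fun_prop (disch := simp [this])
  · have : 0 < t := hu.trans_le ht.1
    exact div_le_div_of_nonneg_left (by linarith [ht.2]) (by positivity) (by gcongr; exact ht.2)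

theorem sq_sub_div_le_integral_sub_div_sq' {u v : ℝ} (hu : 0 < u) (huv : u ≤ v) :
    (v - u) ^ 2 / (2 * v ^ 2) ≤ ∫ t in u..v, (t - u) / t ^ 2 := by
  have hv : 0 < v := hu.trans_le huv
  have h1 : ∫ t in u..v, (t - u) / v ^ 2 = (v - u) ^ 2 / (2 * v ^ 2) := by
    rw [intervalIntegral.integral_div, intervalIntegral.integral_sub (by simp) (by simp)]
    simp
    field_simp
    ring
  rw [← h1]
  refine intervalIntegral.integral_mono_on huv ?_ ?_ fun t ht ↦ ?_
  · exact Continuous.intervalIntegrable (by fun_prop) _ _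
  · refine ContinuousOn.intervalIntegrable fun t ht ↦ ?_
    rw [uIcc_of_le huv] at ht
    have : t ≠ 0 := (hu.trans_le ht.1).ne'
    fun_prop (disch := simp [this])
  · have : 0 < t := hu.trans_le ht.1
    exact div_le_div_of_nonneg_left (by linarith [ht.1]) (by positivity) (by gcongr; exact ht.2)

/-- Since `ψ` is monotone, a large value of `ψ(x) - x` forces a large variation of
`∫ (ψ(t) - t) / t² dt`. -/
theorem sq_psi_sub_div_le_abs_integral {x : ℝ} (hx : 0 < x) (hψ : 0 < Chebyshev.psi x) :
    (Chebyshev.psi x - x) ^ 2 / (2 * max x (Chebyshev.psi x) ^ 2)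
      ≤ |∫ t in min x (Chebyshev.psi x)..max x (Chebyshev.psi x), (Chebyshev.psi t - t) / t ^ 2| := by
  rcases le_total x (Chebyshev.psi x) with h | h
  · rw [min_eq_left h, max_eq_right h]
    refine (sq_sub_div_le_integral_sub_div_sq hx h).trans (le_trans ?_ (le_abs_self _))
    refine intervalIntegral.integral_mono_on h ?_ (intervalIntegrable_psi_sub_div_sq hx hψ)
      fun t ht ↦ ?_
    · refine ContinuousOn.intervalIntegrable fun t ht ↦ ?_
      rw [uIcc_of_le h] at ht
      have : t ≠ 0 := (hx.trans_le ht.1).ne'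
      fun_prop (disch := simp [this])
    · have := Chebyshev.psi_mono ht.1
      gcongr
  · rw [min_eq_right h, max_eq_left h]
    have h1 := sq_sub_div_le_integral_sub_div_sq' hψ h
    rw [← neg_sq, neg_sub]
    refine h1.trans (le_trans ?_ (neg_le_abs _))
    rw [← intervalIntegral.integral_neg]
    refine intervalIntegral.integral_mono_on h ?_ (intervalIntegrable_psi_sub_div_sq hψ hx).neg
      fun t ht ↦ ?_
    · refine ContinuousOn.intervalIntegrable fun t ht ↦ ?_
      rw [uIcc_of_le h] at ht
      have : t ≠ 0 := (hψ.trans_le ht.1).ne'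
      fun_prop (disch := simp [this])
    · have := Chebyshev.psi_mono ht.2
      rw [← neg_div, neg_sub]
      gcongr

variable {a C c : ℝ}

theorem sq_psi_sub_le (hC : 0 ≤ C) (hc : 0 ≤ c)
    (hJ : ∀ x > 1, |a - ∫ t in (1 : ℝ)..x, (Chebyshev.psi t - t) / t ^ 2| ≤ c / √x + C / x)
    {x : ℝ} (hx : 1 < x) (hψ : 1 < Chebyshev.psi x) :
    (Chebyshev.psi x - x) ^ 2 ≤ 4 * max x (Chebyshev.psi x) ^ 2
      * (c / √(min x (Chebyshev.psi x)) + C / min x (Chebyshev.psi x)) := by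
  have h1 := sq_psi_sub_div_le_abs_integral (one_pos.trans hx) (one_pos.trans hψ)
  have huv : min x (Chebyshev.psi x) ≤ max x (Chebyshev.psi x) := min_le_max
  have hu : 1 < min x (Chebyshev.psi x) := lt_min hx hψ
  set u := min x (Chebyshev.psi x)
  set v := max x (Chebyshev.psi x)
  have hv : 1 < v := hu.trans_le huv
  have h2 : ∫ t in u..v, (Chebyshev.psi t - t) / t ^ 2
      = (a - ∫ t in (1 : ℝ)..u, (Chebyshev.psi t - t) / t ^ 2)
        - (a - ∫ t in (1 : ℝ)..v, (Chebyshev.psi t - t) / t ^ 2) := by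
    rw [sub_sub_sub_cancel_left, intervalIntegral.integral_interval_sub_left]
    · exact intervalIntegrable_psi_sub_div_sq one_pos (one_pos.trans hv)
    · exact intervalIntegrable_psi_sub_div_sq one_pos (one_pos.trans hu)
  rw [h2] at h1
  have h3 : c / √v + C / v ≤ c / √u + C / u := by gcongr
  have h4 : (Chebyshev.psi x - x) ^ 2 / (2 * v ^ 2) ≤ 2 * (c / √u + C / u) := by
    refine h1.trans ((abs_sub _ _).trans ?_)
    linarith [hJ u hu, hJ v hv]
  rw [div_le_iff₀ (by positivity)] at h4
  linarith

theorem eventually_two_thirds_mul_le_psi : ∀ᶠ x : ℝ in atTop, 2 / 3 * x ≤ Chebyshev.psi x := by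
  have h1 : (fun x : ℝ ↦ Real.log x) =o[atTop] fun x ↦ x := Real.isLittleO_log_id_atTop
  have h2 := (h1.bound (show (0 : ℝ) < 0.01 by norm_num))
  filter_upwards [h2, eventually_gt_atTop 1000] with x hx hx1
  have h3 := Chebyshev.psi_ge' (x := x) (by linarith)
  have h4 := Real.log_two_gt_d9
  have h5 : Real.log (x + 2) ≤ Real.log x + Real.log 2 := by
    rw [← Real.log_mul (by linarith) (by norm_num)]
    exact Real.log_le_log (by linarith) (by linarith)
  have h6 := Real.log_two_lt_d9
  rw [Real.norm_of_nonneg (Real.log_nonneg (by linarith)), Real.norm_of_nonneg (by linarith)] at hx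
  nlinarith

end PsiBound

section PsiAsymptotic

open MeasureTheory Set Topology

variable {a C c : ℝ}

theorem tendsto_div_self_of_sq_sub_le {f g : ℝ → ℝ} {l : ℝ} (hg : Tendsto g atTop (𝓝 l))
    (h : ∀ᶠ x in atTop, (f x - x) ^ 2 / (x * √x) ≤ g x) :
    Tendsto (fun x ↦ f x / x) atTop (𝓝 1) := by
  have h1 : Tendsto (fun x ↦ g x / √x) atTop (𝓝 0) :=
    hg.div_atTop Real.tendsto_sqrt_atTop
  have h2 : Tendsto (fun x ↦ (f x / x - 1) ^ 2) atTop (𝓝 0) := by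
    refine squeeze_zero' (Eventually.of_forall fun x ↦ sq_nonneg _) ?_ h1
    filter_upwards [h, eventually_gt_atTop 0] with x hx hx0
    have hs : 0 < √x := Real.sqrt_pos.2 hx0
    rw [le_div_iff₀ hs]
    refine le_trans (le_of_eq ?_) hx
    have : √x ^ 2 = x := Real.sq_sqrt hx0.le
    field_simp
    linear_combination (f x - x) ^ 2 * this
  have h3 : Tendsto (fun x ↦ |f x / x - 1|) atTop (𝓝 0) := by
    simpa [Real.sqrt_sq_eq_abs] using h2.sqrt
  simpa using ((tendsto_zero_iff_abs_tendsto_zero _).2 h3).add_const 1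

theorem sq_psi_sub_div_le (hC : 0 ≤ C) (hc : 0 ≤ c)
    (hJ : ∀ x > 1, |a - ∫ t in (1 : ℝ)..x, (Chebyshev.psi t - t) / t ^ 2| ≤ c / √x + C / x)
    {x : ℝ} (hx : 1 < x) (hψ : 1 < Chebyshev.psi x) :
    (Chebyshev.psi x - x) ^ 2 / (x * √x) ≤ 4 * max 1 (Chebyshev.psi x / x) ^ 2
      * (c / √(min 1 (Chebyshev.psi x / x)) + C / √x / min 1 (Chebyshev.psi x / x)) := by
  have hx0 : 0 < x := one_pos.trans hx
  have hs : 0 < √x := Real.sqrt_pos.2 hx0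
  have h := sq_psi_sub_le hC hc hJ hx hψ
  have hmax : max x (Chebyshev.psi x) = x * max 1 (Chebyshev.psi x / x) := by
    rw [mul_max_of_nonneg _ _ hx0.le, mul_one, mul_div_cancel₀ _ hx0.ne']
  have hmin : min x (Chebyshev.psi x) = x * min 1 (Chebyshev.psi x / x) := by
    rw [mul_min_of_nonneg _ _ hx0.le, mul_one, mul_div_cancel₀ _ hx0.ne']
  rw [hmax, hmin, Real.sqrt_mul hx0.le] at h
  have hm : 0 < min 1 (Chebyshev.psi x / x) := lt_min one_pos (by positivity)
  set M := max 1 (Chebyshev.psi x / x)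
  set m := min 1 (Chebyshev.psi x / x)
  have hm2 : 0 < √m := Real.sqrt_pos.2 hm
  rw [div_le_iff₀ (by positivity)]
  refine h.trans (le_of_eq ?_)
  have hss : √x ^ 2 = x := Real.sq_sqrt hx0.le
  field_simp
  linear_combination (-(M ^ 2 * c * m)) * hss

/-- Under the smoothed explicit formula, `(θ(x) - x)² ≤ (4c + o(1)) x^{3/2}`. -/
theorem exists_tendsto_sq_theta_sub_div_le (hC : 0 ≤ C) (hc : 0 ≤ c)
    (hJ : ∀ x > 1, |a - ∫ t in (1 : ℝ)..x, (Chebyshev.psi t - t) / t ^ 2| ≤ c / √x + C / x) :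
    ∃ g : ℝ → ℝ, Tendsto g atTop (𝓝 (4 * c)) ∧
      ∀ᶠ x in atTop, (Chebyshev.theta x - x) ^ 2 / (x * √x) ≤ g x := by
  set b : ℝ → ℝ := fun x ↦ 4 * max 1 (Chebyshev.psi x / x) ^ 2
      * (c / √(min 1 (Chebyshev.psi x / x)) + C / √x / min 1 (Chebyshev.psi x / x)) with hb
  have hb1 : ∀ᶠ x in atTop, (Chebyshev.psi x - x) ^ 2 / (x * √x) ≤ b x := by
    filter_upwards [eventually_gt_atTop 2, eventually_two_thirds_mul_le_psi] with x hx hx1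
    exact sq_psi_sub_div_le hC hc hJ (by linarith) (by linarith)
  have hr : Tendsto (fun x ↦ Chebyshev.psi x / x) atTop (𝓝 1) := by
    set B := 4 * (Real.log 4 + 4) ^ 2 * (c / √(2 / 3) + C / (2 / 3))
    refine tendsto_div_self_of_sq_sub_le (tendsto_const_nhds (x := B)) ?_
    filter_upwards [hb1, eventually_gt_atTop 1, eventually_two_thirds_mul_le_psi] with x hx hx1 hx2
    refine hx.trans ?_
    have h3 : 0 ≤ Real.log 4 := Real.log_nonneg (by norm_num)
    have h4 : 2 / 3 ≤ min 1 (Chebyshev.psi x / x) :=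
      le_min (by norm_num) ((le_div_iff₀ (by linarith)).2 hx2)
    have h5 : max 1 (Chebyshev.psi x / x) ≤ Real.log 4 + 4 :=
      max_le (by linarith) ((div_le_iff₀ (by linarith)).2
        (Chebyshev.psi_le_const_mul_self (by linarith)))
    have h6 : C / √x ≤ C := div_le_self hC (Real.one_le_sqrt.2 hx1.le)
    have h7 : 0 ≤ max 1 (Chebyshev.psi x / x) := zero_le_one.trans (le_max_left _ _)
    have h8 : 0 < min 1 (Chebyshev.psi x / x) := lt_of_lt_of_le (by norm_num) h4
    simp only [hb, B]
    gcongr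
  have hbt : Tendsto b atTop (𝓝 (4 * c)) := by
    have hmax : Tendsto (fun x ↦ max 1 (Chebyshev.psi x / x)) atTop (𝓝 1) := by
      simpa using (tendsto_const_nhds (x := (1 : ℝ))).max hr
    have hmin : Tendsto (fun x ↦ min 1 (Chebyshev.psi x / x)) atTop (𝓝 1) := by
      simpa using (tendsto_const_nhds (x := (1 : ℝ))).min hr
    have h1 := ((hmax.pow 2).const_mul 4).mul
      (((tendsto_const_nhds (x := c)).div hmin.sqrt (by simp)).add
        (((tendsto_const_nhds (x := C)).div_atTop Real.tendsto_sqrt_atTop).div hmin one_ne_zero))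
    simpa using h1
  obtain ⟨C', hC'⟩ := Chebyshev.psi_sub_theta_le_mul_sqrt
  have hC'0 : 0 ≤ C' := by
    have := (sub_nonneg.2 (Chebyshev.theta_le_psi 1)).trans (hC' 1)
    simpa using this
  refine ⟨fun x ↦ (√(b x) + C' / √(√x)) ^ 2, ?_, ?_⟩
  · have h1 := (hbt.sqrt.add ((tendsto_const_nhds (x := C')).div_atTop
      (Real.tendsto_sqrt_atTop.comp Real.tendsto_sqrt_atTop))).pow 2
    rw [add_zero, Real.sq_sqrt (by positivity)] at h1
    exact h1
  · filter_upwards [hb1, eventually_gt_atTop 0] with x hx hx0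
    have hs : 0 < √x := Real.sqrt_pos.2 hx0
    have hss : 0 < √(√x) := Real.sqrt_pos.2 hs
    have h2 : √(x * √x) = √x * √(√x) := Real.sqrt_mul hx0.le _
    have h3 : |Chebyshev.psi x - x| / √(x * √x) ≤ √(b x) := by
      rw [← Real.sqrt_sq_eq_abs, ← Real.sqrt_div (sq_nonneg _)]
      exact Real.sqrt_le_sqrt hx
    have h4 : |Chebyshev.theta x - x| ≤ |Chebyshev.psi x - x| + C' * √x := by
      have h5 := hC' x
      have h6 := Chebyshev.theta_le_psi x
      have h7 : |Chebyshev.theta x - Chebyshev.psi x| ≤ C' * √x := by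
        rw [abs_le]; constructor <;> linarith
      have h8 := abs_sub_le (Chebyshev.theta x) (Chebyshev.psi x) x
      linarith
    have h5 : |Chebyshev.theta x - x| / √(x * √x) ≤ √(b x) + C' / √(√x) := by
      calc _ ≤ (|Chebyshev.psi x - x| + C' * √x) / √(x * √x) := by gcongr
        _ = |Chebyshev.psi x - x| / √(x * √x) + C' / √(√x) := by
          rw [add_div, h2]
          congr 1
          field_simp
        _ ≤ _ := by gcongr
    calc (Chebyshev.theta x - x) ^ 2 / (x * √x) = (|Chebyshev.theta x - x| / √(x * √x)) ^ 2 := by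
          rw [div_pow, sq_abs, Real.sq_sqrt (by positivity)]
      _ ≤ _ := by gcongr

end PsiAsymptotic

section LogIntegral

open MeasureTheory Set Topology

theorem chebyshevTheta_eq_theta (x : ℝ) : chebyshevTheta x = Chebyshev.theta x := by
  rw [Chebyshev.theta_eq_sum_Icc, chebyshevTheta]
  rfl

theorem log_pos_of_mem_uIcc {a b t : ℝ} (ha : 1 < a) (hb : 1 < b) (ht : t ∈ uIcc a b) :
    1 < t ∧ 0 < Real.log t :=
  have h : 1 < t := (lt_min ha hb).trans_le ht.1
  ⟨h, Real.log_pos h⟩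

theorem intervalIntegrable_one_div_log {a b : ℝ} (ha : 1 < a) (hb : 1 < b) :
    IntervalIntegrable (fun t ↦ 1 / Real.log t) volume a b := by
  refine ContinuousOn.intervalIntegrable fun t ht ↦ ?_
  obtain ⟨h1, h2⟩ := log_pos_of_mem_uIcc ha hb ht
  have h3 : t ≠ 0 := by linarith
  have h4 := h2.ne'
  exact ContinuousAt.continuousWithinAt (by fun_prop (disch := assumption))

theorem Li_eq {x : ℝ} (hx : 1 < x) :
    Li x = x / Real.log x - 2 / Real.log 2 + ∫ t in (2 : ℝ)..x, 1 / Real.log t ^ 2 := by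
  have h1 := intervalIntegrable_one_div_log one_lt_two hx
  have h2 := Chebyshev.intervalIntegrable_one_div_log_sq one_lt_two hx
  have h := intervalIntegral.integral_eq_sub_of_hasDerivAt (f := fun t ↦ t / Real.log t)
    (fun t ht ↦ ?_) (h1.sub h2)
  · rw [intervalIntegral.integral_sub h1 h2] at h
    rw [Li]
    linarith
  · obtain ⟨h3, h4⟩ := log_pos_of_mem_uIcc one_lt_two hx ht
    refine ((hasDerivAt_id t).div (Real.hasDerivAt_log (by linarith)) h4.ne').congr_deriv ?_
    have : t ≠ 0 := by linarith
    simp only [id]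
    field_simp

theorem intervalIntegrable_theta_div {a b : ℝ} (ha : 1 < a) (hb : 1 < b) :
    IntervalIntegrable (fun t ↦ (Chebyshev.theta t - t) / (t * Real.log t ^ 2)) volume a b := by
  simp only [div_eq_mul_inv]
  refine (Chebyshev.theta_mono.intervalIntegrable.sub
    intervalIntegral.intervalIntegrable_id).mul_continuousOn fun t ht ↦ ?_
  obtain ⟨h1, h2⟩ := log_pos_of_mem_uIcc ha hb ht
  have h3 : t ≠ 0 := by linarith
  have h4 := h2.ne'
  have h5 : t * Real.log t ^ 2 ≠ 0 := by positivity
  exact ContinuousAt.continuousWithinAt (by fun_prop (disch := assumption))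

theorem Li_theta_sub_primePi_eq {x : ℝ} (hx : 2 ≤ x) (hθ : 1 < Chebyshev.theta x) :
    Li (chebyshevTheta x) - primePi x = -(2 / Real.log 2)
      - (∫ t in (2 : ℝ)..x, (Chebyshev.theta t - t) / (t * Real.log t ^ 2))
      - ∫ t in x..Chebyshev.theta x, (1 / Real.log x - 1 / Real.log t) := by
  have hx1 : 1 < x := by linarith
  have h1 : Li (Chebyshev.theta x) = Li x + ∫ t in x..Chebyshev.theta x, 1 / Real.log t := by
    rw [Li, Li, intervalIntegral.integral_add_adjacent_intervals] <;>
    exact intervalIntegrable_one_div_log (by linarith) (by linarith)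
  have h2 : ∫ t in x..Chebyshev.theta x, (1 / Real.log x - 1 / Real.log t)
      = (Chebyshev.theta x - x) / Real.log x - ∫ t in x..Chebyshev.theta x, 1 / Real.log t := by
    rw [intervalIntegral.integral_sub (by simp) (intervalIntegrable_one_div_log hx1 hθ),
      intervalIntegral.integral_const, smul_eq_mul, mul_one_div]
  have h3 : ∫ t in (2 : ℝ)..x, (Chebyshev.theta t - t) / (t * Real.log t ^ 2)
      = (∫ t in (2 : ℝ)..x, Chebyshev.theta t / (t * Real.log t ^ 2))
        - ∫ t in (2 : ℝ)..x, 1 / Real.log t ^ 2 := by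
    rw [← intervalIntegral.integral_sub]
    · refine intervalIntegral.integral_congr fun t ht ↦ ?_
      obtain ⟨h3, h4⟩ := log_pos_of_mem_uIcc one_lt_two hx1 ht
      have : t ≠ 0 := by linarith
      field_simp
    · exact (intervalIntegrable_iff_integrableOn_Icc_of_le hx).2
        (Chebyshev.integrableOn_theta_div_id_mul_log_sq x)
    · exact Chebyshev.intervalIntegrable_one_div_log_sq one_lt_two hx1
  rw [chebyshevTheta_eq_theta, primePi, Chebyshev.primeCounting_eq_theta_div_log_add_integral hx,
    h1, Li_eq hx1, h2, h3, sub_div]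
  ring

theorem integral_one_div_log_sub_nonneg {x y : ℝ} (hx : 1 < x) (hy : 1 < y) :
    0 ≤ ∫ t in x..y, (1 / Real.log x - 1 / Real.log t) := by
  have hlx := Real.log_pos hx
  rcases le_total x y with h | h
  · refine intervalIntegral.integral_nonneg h fun t ht ↦ sub_nonneg.2 ?_
    exact one_div_le_one_div_of_le hlx (Real.log_le_log (by linarith) ht.1)
  · rw [intervalIntegral.integral_symm, ← intervalIntegral.integral_neg]
    refine intervalIntegral.integral_nonneg h fun t ht ↦ ?_
    rw [neg_sub]
    exact sub_nonneg.2 (one_div_le_one_div_of_le (Real.log_pos (hy.trans_le ht.1))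
      (Real.log_le_log (by linarith [ht.1]) ht.2))

theorem abs_log_sub_log_le {m s t : ℝ} (hm : 0 < m) (hs : m ≤ s) (ht : m ≤ t) :
    |Real.log t - Real.log s| ≤ |t - s| / m := by
  wlog h : s ≤ t generalizing s t
  · rw [abs_sub_comm, abs_sub_comm t]
    exact this ht hs (le_of_not_ge h)
  have hs0 := hm.trans_le hs
  have ht0 := hm.trans_le ht
  rw [abs_of_nonneg (sub_nonneg.2 (Real.log_le_log hs0 h)), abs_of_nonneg (sub_nonneg.2 h),
    ← Real.log_div ht0.ne' hs0.ne']
  calc _ ≤ t / s - 1 := Real.log_le_sub_one_of_pos (by positivity)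
    _ = (t - s) / s := by field_simp
    _ ≤ _ := div_le_div_of_nonneg_left (sub_nonneg.2 h) hm hs

theorem integral_one_div_log_sub_le {x y : ℝ} (hx : 1 < x) (hy : 1 < y) :
    ∫ t in x..y, (1 / Real.log x - 1 / Real.log t)
      ≤ (y - x) ^ 2 / (min x y * Real.log (min x y) ^ 2) := by
  have hm : 1 < min x y := lt_min hx hy
  have hmx : min x y ≤ x := min_le_left _ _
  set m := min x y with hmdef
  have hm0 : 0 < m := one_pos.trans hm
  have hlm := Real.log_pos hm
  have h := intervalIntegral.norm_integral_le_of_norm_le_const (a := x) (b := y)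
    (f := fun t ↦ 1 / Real.log x - 1 / Real.log t) (C := |y - x| / m / Real.log m ^ 2) fun t ht ↦ by
      have hmt : m ≤ t := le_of_lt ht.1
      have hl1 := Real.log_le_log hm0 hmt
      have hl2 := Real.log_le_log hm0 hmx
      have hl3 := hlm.trans_le hl1
      have hl4 := hlm.trans_le hl2
      rw [div_sub_div _ _ hl4.ne' hl3.ne', one_mul, mul_one, norm_div,
        Real.norm_of_nonneg (mul_pos hl4 hl3).le, Real.norm_eq_abs]
      have h1 : |t - x| ≤ |y - x| := abs_sub_left_of_mem_uIcc (uIoc_subset_uIcc ht)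
      gcongr
      · exact (abs_log_sub_log_le hm0 hmx hmt).trans (by gcongr)
      · rw [sq]
        gcongr
  refine (le_abs_self _).trans (h.trans (le_of_eq ?_))
  rw [← sq_abs (y - x)]
  field_simp

end LogIntegral

section Asymptotics

open MeasureTheory Set Topology

theorem hasDerivAt_sqrt_div_log_sq {x : ℝ} (hx : 1 < x) :
    HasDerivAt (fun t ↦ √t / Real.log t ^ 2)
      (1 / (√x * Real.log x ^ 2) * (1 / 2 - 2 / Real.log x)) x := by
  have hl := Real.log_pos hx
  have hx0 : 0 < x := by linarith
  have h := (Real.hasDerivAt_sqrt hx0.ne').div ((Real.hasDerivAt_log hx0.ne').pow 2)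
    (pow_pos hl 2).ne'
  refine h.congr_deriv ?_
  have hs : 0 < √x := Real.sqrt_pos.2 hx0
  obtain ⟨s, hs', rfl⟩ : ∃ s : ℝ, 0 < s ∧ x = s ^ 2 := ⟨√x, hs, (Real.sq_sqrt hx0.le).symm⟩
  rw [Real.sqrt_sq hs'.le]
  simp only [Nat.cast_ofNat, Pi.pow_apply]
  field_simp
  ring

theorem tendsto_sqrt_div_log_sq : Tendsto (fun t : ℝ ↦ √t / Real.log t ^ 2) atTop atTop := by
  have h := (isLittleO_log_rpow_rpow_atTop (r := 2) (s := 1 / 2) (by norm_num) :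
    (fun x ↦ Real.log x ^ (2 : ℝ)) =o[atTop] fun x ↦ x ^ (1 / 2 : ℝ))
  have h1 := h.tendsto_div_nhds_zero
  have h2 : Tendsto (fun t : ℝ ↦ Real.log t ^ 2 / √t) atTop (𝓝[>] 0) := by
    refine tendsto_nhdsWithin_iff.2 ⟨?_, ?_⟩
    · simpa [Real.sqrt_eq_rpow] using h1
    · filter_upwards [eventually_gt_atTop 1] with t ht
      have := Real.log_pos ht
      have : 0 < √t := Real.sqrt_pos.2 (by linarith)
      rw [mem_Ioi]
      positivity
  refine h2.inv_tendsto_nhdsGT_zero.congr fun t ↦ ?_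
  simp

theorem eventually_integral_le_of_eventually_le {f : ℝ → ℝ} {k ε b : ℝ}
    (hb : 1 < b) (hf : ∀ x ≥ b, IntervalIntegrable f volume b x)
    (h : ∀ᶠ t in atTop, f t ≤ k / (√t * Real.log t ^ 2)) (hε : 0 < ε) :
    ∀ᶠ x in atTop, ∫ t in b..x, f t ≤ (2 * k + ε) * (√x / Real.log x ^ 2) := by
  set k' := 2 * k + ε / 2 with hk'
  have hlim : Tendsto (fun t ↦ k' * (1 / 2 - 2 / Real.log t)) atTop (𝓝 (k' * (1 / 2 - 0))) :=
    (tendsto_const_nhds.sub (tendsto_const_nhds.div_atTop Real.tendsto_log_atTop)).const_mul _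
  have hk : ∀ᶠ t in atTop, k < k' * (1 / 2 - 2 / Real.log t) :=
    hlim.eventually (eventually_gt_nhds (by rw [hk']; linarith))
  obtain ⟨T, hT⟩ := eventually_atTop.1 (h.and hk)
  set y := max b T with hy
  have hby : b ≤ y := le_max_left _ _
  have hTy : T ≤ y := le_max_right _ _
  have hy1 : 1 < y := hb.trans_le hby
  have hconst := tendsto_sqrt_div_log_sq.const_mul_atTop (half_pos hε) |>.eventually_ge_atTop
    ((∫ t in b..y, f t) - k' * (√y / Real.log y ^ 2))
  filter_upwards [hconst, eventually_ge_atTop y] with x hx hxy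
  have hder : ∀ t ∈ uIcc y x, HasDerivAt (fun t ↦ k' * (√t / Real.log t ^ 2))
      (k' * (1 / (√t * Real.log t ^ 2) * (1 / 2 - 2 / Real.log t))) t := fun t ht ↦
    (hasDerivAt_sqrt_div_log_sq (log_pos_of_mem_uIcc hy1 (hy1.trans_le hxy) ht).1).const_mul _
  have hint : IntervalIntegrable
      (fun t ↦ k' * (1 / (√t * Real.log t ^ 2) * (1 / 2 - 2 / Real.log t))) volume y x := by
    refine ContinuousOn.intervalIntegrable fun t ht ↦ ?_
    obtain ⟨h1, h2⟩ := log_pos_of_mem_uIcc hy1 (hy1.trans_le hxy) ht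
    have h3 : t ≠ 0 := by linarith
    have h4 := h2.ne'
    have h5 : 0 < √t := Real.sqrt_pos.2 (by linarith)
    have h6 : √t * Real.log t ^ 2 ≠ 0 := by positivity
    exact ContinuousAt.continuousWithinAt (by fun_prop (disch := assumption))
  have hfyx : IntervalIntegrable f volume y x := (hf y hby).symm.trans (hf x (hby.trans hxy))
  have hle := intervalIntegral.integral_mono_on hxy hfyx hint fun t ht ↦ by
    have h1 : 1 < t := hy1.trans_le ht.1
    have h2 := Real.log_pos h1
    have h3 : 0 < √t := Real.sqrt_pos.2 (by linarith)
    obtain ⟨h4, h5⟩ := hT t (hTy.trans ht.1)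
    calc f t ≤ k / (√t * Real.log t ^ 2) := h4
      _ ≤ k' * (1 / 2 - 2 / Real.log t) / (√t * Real.log t ^ 2) := by gcongr
      _ = _ := by ring
  rw [intervalIntegral.integral_eq_sub_of_hasDerivAt hder hint] at hle
  rw [← intervalIntegral.integral_add_adjacent_intervals (hf y hby) hfyx]
  have hsplit : (2 * k + ε) * (√x / Real.log x ^ 2) =
      k' * (√x / Real.log x ^ 2) + ε / 2 * (√x / Real.log x ^ 2) := by
    rw [hk']
    ring
  linarith

theorem hasDerivAt_div_log_sq {t : ℝ} (ht : 1 < t) :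
    HasDerivAt (fun t ↦ t / Real.log t ^ 2) (1 / Real.log t ^ 2 - 2 / Real.log t ^ 3) t := by
  have hl := Real.log_pos ht
  have ht0 : 0 < t := by linarith
  refine ((hasDerivAt_id t).div ((Real.hasDerivAt_log ht0.ne').pow 2)
    (pow_pos hl 2).ne').congr_deriv ?_
  simp only [Nat.cast_ofNat, Pi.pow_apply, id]
  field_simp
  ring

theorem intervalIntegrable_psi_sub_div_mul_log_sq {a b : ℝ} (ha : 1 < a) (hb : 1 < b) :
    IntervalIntegrable (fun t ↦ (Chebyshev.psi t - t) / (t * Real.log t ^ 2)) volume a b := by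
  refine intervalIntegrable_psi_sub_div (fun t ht ↦ ?_) fun t ht ↦ ?_
  all_goals
    obtain ⟨h1, h2⟩ := log_pos_of_mem_uIcc ha hb ht
    have h3 : t ≠ 0 := by linarith
  · exact ContinuousAt.continuousWithinAt (by fun_prop (disch := assumption))
  · positivity

theorem intervalIntegrable_mul_deriv_div_log_sq {J : ℝ → ℝ} {b x : ℝ} (hb : 1 < b) (hx : b ≤ x)
    (hJ : ContinuousOn J (Ici 1)) : IntervalIntegrable
      (fun t ↦ J t * (1 / Real.log t ^ 2 - 2 / Real.log t ^ 3)) volume b x := by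
  refine ContinuousOn.intervalIntegrable ?_
  rw [uIcc_of_le hx]
  refine (hJ.mono fun t ht ↦ hb.le.trans ht.1).mul fun t ht ↦ ?_
  have h2 := Real.log_pos (hb.trans_le ht.1)
  have h3 : t ≠ 0 := by linarith [ht.1]
  have h4 : Real.log t ^ 2 ≠ 0 := by positivity
  have h5 : Real.log t ^ 3 ≠ 0 := by positivity
  exact ContinuousAt.continuousWithinAt (by fun_prop (disch := assumption))

theorem integral_psi_sub_div_log_sq_eq (a : ℝ) {x : ℝ} (hx : 2 ≤ x) :
    let J := fun x : ℝ ↦ a - ∫ t in (1 : ℝ)..x, (Chebyshev.psi t - t) / t ^ 2;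
    -(∫ t in (2 : ℝ)..x, (Chebyshev.psi t - t) / (t * Real.log t ^ 2)) =
      J x * (x / Real.log x ^ 2) - J 2 * (2 / Real.log 2 ^ 2)
        - ∫ t in (2 : ℝ)..x, J t * (1 / Real.log t ^ 2 - 2 / Real.log t ^ 3) := by
  intro J
  have hx1 : 1 < x := by linarith
  have hJ : ContinuousOn J (Ici 1) := continuousOn_const.sub continuousOn_integral_psi_sub_div_sq
  have hsub : Icc 2 x ⊆ Ici 1 := fun t ht ↦ one_le_two.trans ht.1
  have hcont : ContinuousOn (fun t ↦ J t * (t / Real.log t ^ 2)) (Icc 2 x) :=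
    (hJ.mono hsub).mul fun t ht ↦
      (hasDerivAt_div_log_sq (one_lt_two.trans_le ht.1)).continuousAt.continuousWithinAt
  have h1 := intervalIntegrable_psi_sub_div_mul_log_sq one_lt_two hx1
  have h2 := intervalIntegrable_mul_deriv_div_log_sq one_lt_two hx hJ
  have key := integral_eq_of_hasDerivAt_off_countable_of_le _
    (fun t ↦ J t * (1 / Real.log t ^ 2 - 2 / Real.log t ^ 3)
      - (Chebyshev.psi t - t) / (t * Real.log t ^ 2)) hx
    Chebyshev.psi_mono.countable_not_continuousAt hcont (fun t ht ↦ ?_) (h2.sub h1)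
  · rw [intervalIntegral.integral_sub h2 h1] at key
    linarith
  · obtain ⟨⟨ht2, htx⟩, htc⟩ := ht
    have htc : ContinuousAt Chebyshev.psi t := not_not.1 htc
    have ht1 : 1 < t := one_lt_two.trans ht2
    have hl := Real.log_pos ht1
    have ht0 : t ≠ 0 := by linarith
    have hder : HasDerivAt J (-((Chebyshev.psi t - t) / t ^ 2)) t := by
      refine (intervalIntegral.integral_hasDerivAt_right
        (intervalIntegrable_psi_sub_div_sq one_pos (by linarith)) ?_ ?_).const_sub a
      · have : Measurable fun t ↦ (Chebyshev.psi t - t) / t ^ 2 :=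
          (Chebyshev.psi_mono.measurable.sub measurable_id).div (measurable_id.pow_const 2)
        exact this.stronglyMeasurable.stronglyMeasurableAtFilter
      · exact (htc.sub continuousAt_id).div (continuousAt_id.pow 2) (by positivity)
    refine (hder.mul (hasDerivAt_div_log_sq ht1)).congr_deriv ?_
    field_simp
    ring

end Asymptotics

section Positivity

open MeasureTheory Set Topology

theorem one_lt_theta {x : ℝ} (hx : 3 ≤ x) : 1 < Chebyshev.theta x := by
  refine lt_of_lt_of_le ?_ (Chebyshev.theta_mono hx)
  rw [Chebyshev.theta_eq_log_primorial, Real.lt_log_iff_exp_lt]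
  all_goals
    rw [show primorial ⌊(3 : ℝ)⌋₊ = 6 by norm_num; decide]
    norm_num
  linarith [Real.exp_one_lt_three]

theorem eventually_two_thirds_mul_sqrt_le_psi_sub_theta :
    ∀ᶠ x : ℝ in atTop, 2 / 3 * √x ≤ Chebyshev.psi x - Chebyshev.theta x := by
  filter_upwards [Real.tendsto_sqrt_atTop.eventually eventually_two_thirds_mul_le_psi,
    eventually_ge_atTop 0] with x hx hx0
  refine le_trans ?_ (Chebyshev.psi_sub_theta_ge_psi_add_psi_add_psi hx0)
  rw [inv_eq_one_div, ← Real.sqrt_eq_rpow]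
  linarith [Chebyshev.psi_nonneg (x ^ (3 : ℝ)⁻¹), Chebyshev.psi_nonneg (x ^ (7 : ℝ)⁻¹)]

theorem eventually_integral_one_div_log_sub_le {g : ℝ → ℝ} {l : ℝ} (hg : Tendsto g atTop (𝓝 l))
    (h : ∀ᶠ x in atTop, (Chebyshev.theta x - x) ^ 2 / (x * √x) ≤ g x) {ε : ℝ} (hε : 0 < ε) :
    ∀ᶠ x in atTop, ∫ t in x..Chebyshev.theta x, (1 / Real.log x - 1 / Real.log t)
      ≤ (l + ε) * (√x / Real.log x ^ 2) := by
  have hθ := tendsto_div_self_of_sq_sub_le hg h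
  have hm : Tendsto (fun x ↦ min 1 (Chebyshev.theta x / x)) atTop (𝓝 1) := by
    simpa using (tendsto_const_nhds (x := (1 : ℝ))).min hθ
  have hlog : Tendsto (fun x ↦ 1 + Real.log (min 1 (Chebyshev.theta x / x)) / Real.log x)
      atTop (𝓝 1) := by
    have := ((Real.continuousAt_log one_ne_zero).tendsto.comp hm).div_atTop Real.tendsto_log_atTop
    simpa using this.const_add 1
  have hlim : Tendsto (fun x ↦ g x / (min 1 (Chebyshev.theta x / x) *
      (1 + Real.log (min 1 (Chebyshev.theta x / x)) / Real.log x) ^ 2)) atTop (𝓝 l) := by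
    have := hg.div (hm.mul (hlog.pow 2)) (by norm_num)
    rwa [one_pow, one_mul, div_one] at this
  filter_upwards [h, hlim.eventually (eventually_lt_nhds (lt_add_of_pos_right l hε)),
    hm.eventually (eventually_gt_nhds (show (1 / 2 : ℝ) < 1 by norm_num)),
    eventually_gt_atTop 2] with x hx hx1 hx2 hx3
  have hx0 : 0 < x := by linarith
  have hl : 0 < Real.log x := Real.log_pos (by linarith)
  have hs : 0 < √x := Real.sqrt_pos.2 hx0
  have hmin : min x (Chebyshev.theta x) = x * min 1 (Chebyshev.theta x / x) := by
    rw [mul_min_of_nonneg _ _ hx0.le, mul_one, mul_div_cancel₀ _ hx0.ne']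
  set m := min 1 (Chebyshev.theta x / x)
  have hm0 : 0 < m := by linarith
  have hxm : 1 < x * m := by nlinarith
  have hθ1 : 1 < Chebyshev.theta x := (hxm.trans_eq hmin.symm).trans_le (min_le_right _ _)
  refine (integral_one_div_log_sub_le (by linarith) hθ1).trans ?_
  have hlm : 0 < Real.log x + Real.log m := by
    rw [← Real.log_mul hx0.ne' hm0.ne']
    exact Real.log_pos hxm
  rw [hmin, Real.log_mul hx0.ne' hm0.ne']
  have hfac : 1 + Real.log m / Real.log x = (Real.log x + Real.log m) / Real.log x := by
    field_simp
  rw [hfac] at hx1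
  calc (Chebyshev.theta x - x) ^ 2 / (x * m * (Real.log x + Real.log m) ^ 2)
      = (Chebyshev.theta x - x) ^ 2 / (x * √x) /
          (m * ((Real.log x + Real.log m) / Real.log x) ^ 2) * (√x / Real.log x ^ 2) := by
        field_simp
    _ ≤ g x / (m * ((Real.log x + Real.log m) / Real.log x) ^ 2) * (√x / Real.log x ^ 2) := by
        gcongr
    _ ≤ _ := by gcongr

variable {a C c : ℝ}

theorem eventually_Li_theta_sub_primePi_pos (hC : 0 ≤ C) (hc : 0 ≤ c) (hc6 : c < 1 / 6)
    (hJ : ∀ x > 1, |a - ∫ t in (1 : ℝ)..x, (Chebyshev.psi t - t) / t ^ 2| ≤ c / √x + C / x) :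
    ∀ᶠ x : ℝ in atTop, 0 < Li (chebyshevTheta x) - primePi x := by
  obtain ⟨g, hg, hgθ⟩ := exists_tendsto_sq_theta_sub_div_le hC hc hJ
  set J := fun x : ℝ ↦ a - ∫ t in (1 : ℝ)..x, (Chebyshev.psi t - t) / t ^ 2 with hJdef
  set ε := (4 / 3 - 7 * c) / 10 with hεdef
  have hε : 0 < ε := by rw [hεdef]; linarith
  have hCε : ∀ᶠ x : ℝ in atTop, C / √x ≤ ε :=
    (tendsto_const_nhds.div_atTop Real.tendsto_sqrt_atTop).eventually_le_const hε
  have hJle : ∀ᶠ x : ℝ in atTop, |J x| ≤ (c + ε) / √x := by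
    filter_upwards [hCε, eventually_gt_atTop 1] with x hx hx1
    have hs : 0 < √x := Real.sqrt_pos.2 (by linarith)
    calc |J x| ≤ c / √x + C / x := hJ x hx1
      _ = (c + C / √x) / √x := by
        rw [add_div, div_div, Real.mul_self_sqrt (by linarith)]
      _ ≤ _ := by gcongr
  have hR := eventually_integral_one_div_log_sub_le hg hgθ hε
  set f : ℝ → ℝ := fun t ↦ J t * (1 / Real.log t ^ 2 - 2 / Real.log t ^ 3)
    - (Chebyshev.psi t - Chebyshev.theta t) / (t * Real.log t ^ 2) with hf
  have hψ : ∀ x > 1, IntervalIntegrable (fun t ↦ (Chebyshev.psi t - t) / (t * Real.log t ^ 2))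
      volume 2 x := fun x hx ↦ intervalIntegrable_psi_sub_div_mul_log_sq one_lt_two hx
  have hJint : ∀ x ≥ 2, IntervalIntegrable
      (fun t ↦ J t * (1 / Real.log t ^ 2 - 2 / Real.log t ^ 3)) volume 2 x := fun x hx ↦
    intervalIntegrable_mul_deriv_div_log_sq one_lt_two hx
      (continuousOn_const.sub continuousOn_integral_psi_sub_div_sq)
  have hD : ∀ x > 1, IntervalIntegrable
      (fun t ↦ (Chebyshev.psi t - Chebyshev.theta t) / (t * Real.log t ^ 2)) volume 2 x := by
    intro x hx
    refine ((hψ x hx).sub (intervalIntegrable_theta_div one_lt_two hx)).congr fun t _ ↦ ?_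
    simp only [← sub_div, sub_sub_sub_cancel_right]
  have hfle := eventually_integral_le_of_eventually_le (f := f) (k := c + ε - 2 / 3) one_lt_two
    (fun x hx ↦ (hJint x hx).sub (hD x (by linarith))) ?_ hε
  · filter_upwards [hJle, hR, hfle, eventually_gt_atTop 3,
      (tendsto_sqrt_div_log_sq.const_mul_atTop hε).eventually_gt_atTop
        (2 / Real.log 2 + J 2 * (2 / Real.log 2 ^ 2))] with x h1 h2 h3 h4 h5
    have hx2 : 2 ≤ x := by linarith
    have hs : 0 < √x := Real.sqrt_pos.2 (by linarith)
    have hl : 0 < Real.log x := Real.log_pos (by linarith)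
    rw [Li_theta_sub_primePi_eq hx2 (one_lt_theta h4.le)]
    have hparts := integral_psi_sub_div_log_sq_eq a hx2
    simp only at hparts
    have hsub : ∫ t in (2 : ℝ)..x, (Chebyshev.theta t - t) / (t * Real.log t ^ 2) =
        (∫ t in (2 : ℝ)..x, (Chebyshev.psi t - t) / (t * Real.log t ^ 2)) - ∫ t in (2 : ℝ)..x,
          (Chebyshev.psi t - Chebyshev.theta t) / (t * Real.log t ^ 2) := by
      rw [← intervalIntegral.integral_sub (hψ x (by linarith)) (hD x (by linarith))]
      refine intervalIntegral.integral_congr fun t _ ↦ ?_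
      simp only [← sub_div, sub_sub_sub_cancel_left]
    have hfsplit := intervalIntegral.integral_sub (hJint x hx2) (hD x (by linarith))
    have hJh : -((c + ε) * (√x / Real.log x ^ 2)) ≤ J x * (x / Real.log x ^ 2) := by
      have : (c + ε) / √x * (x / Real.log x ^ 2) = (c + ε) * (√x / Real.log x ^ 2) := by
        have : √x ^ 2 = x := Real.sq_sqrt (by linarith)
        field_simp
        rw [this]
      rw [← this, ← neg_mul]
      exact mul_le_mul_of_nonneg_right (neg_le_of_abs_le h1) (by positivity)
    have h7 : (∫ t in (2 : ℝ)..x, J t * (1 / Real.log t ^ 2 - 2 / Real.log t ^ 3)) -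
        (∫ t in (2 : ℝ)..x, (Chebyshev.psi t - Chebyshev.theta t) / (t * Real.log t ^ 2)) ≤
        (2 * (c + ε - 2 / 3) + ε) * (√x / Real.log x ^ 2) := hfsplit ▸ h3
    have hΦ : 0 < √x / Real.log x ^ 2 := by positivity
    have hc' : c = (4 / 3 - 10 * ε) / 7 := by rw [hεdef]; ring
    generalize √x / Real.log x ^ 2 = Φ at *
    have hfin : (c + ε) * Φ + (2 * (c + ε - 2 / 3) + ε) * Φ + (4 * c + ε) * Φ = -(5 * (ε * Φ)) := by
      rw [hc']; ring
    have : 0 < ε * Φ := by positivity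
    linarith
  · filter_upwards [hJle, eventually_two_thirds_mul_sqrt_le_psi_sub_theta, eventually_gt_atTop 1,
      Real.tendsto_log_atTop.eventually_ge_atTop 2] with t h1 h2 h3 h4
    have ht0 : 0 < t := by linarith
    have hs : 0 < √t := Real.sqrt_pos.2 ht0
    have hl : 0 < Real.log t := by linarith
    have hh : 0 ≤ 1 / Real.log t ^ 2 - 2 / Real.log t ^ 3 := by
      have : 1 / Real.log t ^ 2 - 2 / Real.log t ^ 3 = (Real.log t - 2) / Real.log t ^ 3 := by
        field_simp
      rw [this]
      exact div_nonneg (by linarith) (by positivity)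
    have hh2 : 1 / Real.log t ^ 2 - 2 / Real.log t ^ 3 ≤ 1 / Real.log t ^ 2 :=
      sub_le_self _ (by positivity)
    calc f t ≤ (c + ε) / √t * (1 / Real.log t ^ 2) - 2 / 3 * √t / (t * Real.log t ^ 2) := by
          refine sub_le_sub ?_ (by gcongr)
          exact (mul_le_mul_of_nonneg_right ((le_abs_self _).trans h1) hh).trans (by gcongr)
      _ = _ := by
          have : √t ^ 2 = t := Real.sq_sqrt ht0.le
          field_simp
          rw [this]
          ring

end Positivity

section Criterion

open MeasureTheory Set Topology

theorem riemannZeta_ne_zero_of_eventually_pos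
    (h : ∀ᶠ x : ℝ in atTop, 0 < Li (chebyshevTheta x) - primePi x) {s : ℂ} (hs : 1 / 2 < s.re)
    (hs1 : s ≠ 1) : riemannZeta s ≠ 0 := by
  obtain ⟨x₀, hx₀⟩ := eventually_atTop.1 (h.and (eventually_ge_atTop 3))
  have h2 : 3 ≤ x₀ := (hx₀ x₀ le_rfl).2
  rw [riemannZeta_eq_inv_sub_mul hs1]
  refine mul_ne_zero (inv_ne_zero (sub_ne_zero.2 hs1))
    (riemannZeta₁_ne_zero_of_forall_nonneg (x₀ := x₀) (by linarith)
    (c := -(∫ t in (2 : ℝ)..x₀, (Chebyshev.theta t - t) / (t * Real.log t ^ 2)))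
    (fun x hx ↦ ?_) hs)
  obtain ⟨h3, h4⟩ := hx₀ x hx
  have h5 := one_lt_theta h4
  rw [Li_theta_sub_primePi_eq (by linarith) h5,
    ← intervalIntegral.integral_add_adjacent_intervals
      (intervalIntegrable_theta_div one_lt_two (by linarith : 1 < x₀))
      (intervalIntegrable_theta_div (by linarith) (by linarith))] at h3
  have h6 := integral_one_div_log_sub_nonneg (by linarith : 1 < x) h5
  have h7 : 0 < 2 / Real.log 2 := div_pos two_pos (Real.log_pos one_lt_two)
  linarith

/-- Robin's criterion: RH holds iff Li(θ(x)) − π(x) > 0 for all sufficiently large x. -/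
theorem riemannHypothesis_iff_eventually_li_theta_sub_pi_pos :
    (∀ ρ : ℂ, riemannZeta ρ = 0 → 0 < ρ.re → ρ.re < 1 → ρ.re = 1 / 2) ↔
    ∀ᶠ x : ℝ in atTop, 0 < Li (chebyshevTheta x) - primePi x := by
  refine ⟨fun hRH ↦ ?_, fun h ρ hρ h0 h1 ↦ ?_⟩
  · obtain ⟨a, C, c, hC, hc, hc6, hJ⟩ := exists_abs_sub_integral_psi_sub_div_sq_le hRH
    exact eventually_Li_theta_sub_primePi_pos hC hc hc6 hJ
  · rcases lt_trichotomy ρ.re (1 / 2) with hlt | heq | hgt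
    · have hne : 1 - ρ ≠ 1 := by
        intro h2
        rw [sub_eq_self.1 h2] at h0
        simp at h0
      refine absurd ?_ (riemannZeta_ne_zero_of_eventually_pos h (s := 1 - ρ) ?_ hne)
      · rw [riemannZeta_one_sub (s := ρ) (fun n hn ↦ ?_) ?_, hρ, mul_zero]
        · rintro rfl
          simp at h1
        · rw [hn, Complex.neg_re, Complex.natCast_re] at h0
          linarith [(n.cast_nonneg : (0 : ℝ) ≤ n)]
      · simp only [Complex.sub_re, Complex.one_re]
        linarith
    · exact heq
    · refine absurd hρ (riemannZeta_ne_zero_of_eventually_pos h hgt ?_)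
      rintro rfl
      simp at h1

end Criterion
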